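/- Let X be a connected Cayley graph on a finite abelian group, let 𝒞 be its cycle space and ℋ its Hamilton space. Then: (i) ℋ = 𝒞 if X is bipartite or has an odd number of vertices; (ii) ℋ has codimension 2 in 𝒞 if X is a prism over an odd cycle (i.e., isomorphic to the Cartesian product of a cycle of odd length with a single edge); (iii) in all other cases ℋ has codimension 1 in 𝒞. -/

import Mathlib

open SimpleGraph

/-- The Cayley graph of a group `G` with connection set `S` (for symmetric `S`
with `1 ∉ S` this is the usual Cayley graph: `g ~ h` iff `g⁻¹ * h ∈ S`). -/
def cayleyGraph {G : Type*} [Group G] (S : Set G) : SimpleGraph G :=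
  SimpleGraph.fromRel (fun g h => g⁻¹ * h ∈ S)

/-- The element of the edge space (over `𝔽₂`) supported on the edges of a
closed walk `w`. -/
def walkIndicator {V : Type*} [DecidableEq V] (X : SimpleGraph V) {u : V}
    (w : X.Walk u u) : X.edgeSet → ZMod 2 :=
  fun e => if (e : Sym2 V) ∈ w.edges then 1 else 0

/-- The cycle space of a graph: the `𝔽₂`-span of the edge sets of its cycles. -/
def cycleSpace {V : Type*} [DecidableEq V] (X : SimpleGraph V) :
    Submodule (ZMod 2) (X.edgeSet → ZMod 2) :=
  Submodule.span (ZMod 2)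
    {f | ∃ (u : V) (w : X.Walk u u), w.IsCycle ∧ f = walkIndicator X w}

/-- The Hamilton space of a graph: the `𝔽₂`-span of the edge sets of its Hamilton
cycles. -/
def hamiltonSpace {V : Type*} [DecidableEq V] (X : SimpleGraph V) :
    Submodule (ZMod 2) (X.edgeSet → ZMod 2) :=
  Submodule.span (ZMod 2)
    {f | ∃ (u : V) (w : X.Walk u u), w.IsHamiltonianCycle ∧ f = walkIndicator X w}

/-! Part 1 -/

namespace HamSp

/-- Existence of a path from `x` to `z` with vertex set exactly `U`. -/
inductive EP {α : Type*} (R : α → α → Prop) : Set α → α → α → Prop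
  | single (x : α) : EP R {x} x x
  | cons {U : Set α} {x y z : α} : x ∉ U → R x y → EP R U y z → EP R (insert x U) x z

/-- Valued version: `v` is the sum of `f` along the path. -/
inductive HP {α : Type*} (R : α → α → Prop) (f : α → α → ZMod 2) :
    Set α → α → α → ZMod 2 → Prop
  | single (x : α) : HP R f {x} x x 0
  | cons {U : Set α} {x y z : α} {v : ZMod 2} : x ∉ U → R x y → HP R f U y z v →
      HP R f (insert x U) x z (f x y + v)

section paths
variable {α β : Type*} {R R' : α → α → Prop} {f g : α → α → ZMod 2} {U V W : Set α}
  {x y z w : α} {v v' : ZMod 2}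

theorem EP.mem_left (h : EP R U x y) : x ∈ U := by
  cases h <;> simp

theorem EP.mem_right (h : EP R U x y) : y ∈ U := by
  induction h with
  | single x => simp
  | cons _ _ _ ih => exact Set.mem_insert_of_mem _ ih

theorem HP.toEP (h : HP R f U x y v) : EP R U x y := by
  induction h with
  | single x => exact .single x
  | cons h1 h2 _ ih => exact .cons h1 h2 ih

theorem EP.toHP (f : α → α → ZMod 2) (h : EP R U x y) : ∃ v, HP R f U x y v := by
  induction h with
  | single x => exact ⟨_, .single x⟩
  | cons h1 h2 _ ih => obtain ⟨v, hv⟩ := ih; exact ⟨_, .cons h1 h2 hv⟩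

theorem EP.toHP_zero (h : EP R U x y) (hf : ∀ a ∈ U, ∀ b ∈ U, R a b → f a b = 0) :
    HP R f U x y 0 := by
  induction h with
  | single x => exact .single x
  | @cons U x y z h1 h2 h3 ih =>
    have := ih (fun a ha b hb => hf a (Set.mem_insert_of_mem _ ha) b (Set.mem_insert_of_mem _ hb))
    have h4 := HP.cons h1 h2 this
    rwa [hf x (Set.mem_insert _ _) y (Set.mem_insert_of_mem _ h3.mem_left) h2, zero_add] at h4

theorem EP.congr (h : EP R U x y) (hU : U = V) : EP R V x y := hU ▸ h
theorem HP.congr (h : HP R f U x y v) (hU : U = V) (hv : v = v') : HP R f V x y v' := hU ▸ hv ▸ h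

theorem HP.append (h : HP R f U x y v) (hr : R y z) (h' : HP R f V z w v')
    (hd : Disjoint U V) : HP R f (U ∪ V) x w (v + f y z + v') := by
  induction h with
  | single x =>
    have := HP.cons (by simpa using hd) hr h'
    simpa using this
  | @cons U x y' y v h1 h2 h3 ih =>
    rw [Set.disjoint_insert_left] at hd
    have := HP.cons (x := x) (by simp [h1, hd.1]) h2 (ih hr hd.2)
    refine this.congr (by rw [Set.insert_union]) (by ring)

theorem EP.append (h : EP R U x y) (hr : R y z) (h' : EP R V z w)
    (hd : Disjoint U V) : EP R (U ∪ V) x w := by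
  obtain ⟨v, hv⟩ := h.toHP 0
  obtain ⟨v', hv'⟩ := h'.toHP 0
  exact (hv.append hr hv' hd).toEP

theorem HP.reverse (hR : ∀ a b, R a b → R b a) (hf : ∀ a b, f a b = f b a)
    (h : HP R f U x y v) : HP R f U y x v := by
  induction h with
  | single x => exact .single x
  | @cons U x y z v h1 h2 h3 ih =>
    have := ih.append (hR _ _ h2) (.single x) (by simpa using h1)
    refine this.congr (by ext; simp [or_comm]) (by rw [hf y x]; ring)

theorem EP.reverse (hR : ∀ a b, R a b → R b a) (h : EP R U x y) : EP R U y x := by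
  obtain ⟨v, hv⟩ := h.toHP 0
  exact (hv.reverse hR (fun _ _ => rfl)).toEP

theorem EP.mono (h : EP R U x y) (hR : ∀ a ∈ U, ∀ b ∈ U, R a b → R' a b) : EP R' U x y := by
  induction h with
  | single x => exact .single x
  | @cons U x y z h1 h2 h3 ih =>
    exact .cons h1 (hR _ (by simp) _ (by simp [h3.mem_left]) h2)
      (ih (fun a ha b hb => hR a (by simp [ha]) b (by simp [hb])))

theorem EP.map {Q : β → β → Prop} (h : EP R U x y) (F : α → β) (hF : Set.InjOn F U)
    (hR : ∀ a ∈ U, ∀ b ∈ U, R a b → Q (F a) (F b)) : EP Q (F '' U) (F x) (F y) := by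
  induction h with
  | single x => simpa using EP.single (R := Q) (F x)
  | @cons U x y z h1 h2 h3 ih =>
    have ih' := ih (hF.mono (Set.subset_insert _ _))
      (fun a ha b hb => hR a (by simp [ha]) b (by simp [hb]))
    rw [Set.image_insert_eq]
    refine .cons ?_ (hR _ (by simp) _ (by simp [h3.mem_left]) h2) ih'
    rintro ⟨a, ha, hax⟩
    have := hF (by simp [ha]) (by simp) hax
    exact h1 (this ▸ ha)

theorem HP.map {Q : β → β → Prop} {f' : β → β → ZMod 2} (h : HP R f U x y v) (F : α → β)
    (hF : Set.InjOn F U)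
    (hR : ∀ a ∈ U, ∀ b ∈ U, R a b → Q (F a) (F b))
    (hf : ∀ a ∈ U, ∀ b ∈ U, R a b → f' (F a) (F b) = f a b) : HP Q f' (F '' U) (F x) (F y) v := by
  induction h with
  | single x => simpa using HP.single (R := Q) (F x)
  | @cons U x y z v h1 h2 h3 ih =>
    have ih' := ih (hF.mono (Set.subset_insert _ _))
      (fun a ha b hb => hR a (by simp [ha]) b (by simp [hb]))
      (fun a ha b hb => hf a (by simp [ha]) b (by simp [hb]))
    rw [Set.image_insert_eq, ← hf x (by simp) y (by simp [h3.toEP.mem_left]) h2]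
    refine .cons ?_ (hR _ (by simp) _ (by simp [h3.toEP.mem_left]) h2) ih'
    rintro ⟨a, ha, hax⟩
    have := hF (by simp [ha]) (by simp) hax
    exact h1 (this ▸ ha)

theorem EP.first (h : EP R U x y) (hxy : x ≠ y) :
    ∃ z V, U = insert x V ∧ x ∉ V ∧ R x z ∧ EP R V z y := by
  cases h with
  | single x => exact absurd rfl hxy
  | cons h1 h2 h3 => exact ⟨_, _, rfl, h1, h2, h3⟩

theorem EP.split (h : EP R U x z) (hy : y ∈ U) (hyx : y ≠ x) :
    ∃ U1 U2 y', U = U1 ∪ U2 ∧ Disjoint U1 U2 ∧ EP R U1 x y' ∧ R y' y ∧ EP R U2 y z := by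
  induction h with
  | single x => exact absurd hy hyx
  | @cons U x x' z h1 h2 h3 ih =>
    have hy' : y ∈ U := by simpa [hyx] using hy
    by_cases hyx' : y = x'
    · subst hyx'
      exact ⟨{x}, U, x, rfl, by simpa using h1, .single x, h2, h3⟩
    · obtain ⟨U1, U2, y', e, hd, p1, r, p2⟩ := ih hy' hyx'
      refine ⟨insert x U1, U2, y', by rw [e, Set.insert_union], ?_, ?_, r, p2⟩
      · rw [Set.disjoint_insert_left]; exact ⟨fun h => h1 (e ▸ Or.inr h), hd⟩
      · exact .cons (fun h => h1 (e ▸ Or.inl h)) h2 p1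

/-- Either some consecutive pair lies in `W`, and a detour can be inserted there, or the
inner vertices of the path lying in `W` have two different neighbours outside `W`. -/
theorem EP.insertAux (hsub : ∀ a b, R a b → R' a b) (D : Set α)
    (hbr : ∀ a ∈ U, ∀ b ∈ U, a ∈ W → b ∈ W → R a b → ∃ p q, EP R' D p q ∧ R' a p ∧ R' q b)
    (hD : Disjoint U D) (h : EP R U x y) :
    EP R' (U ∪ D) x y ∨
      ((x ∈ W → x ≠ y → ∃ q ∈ U, q ∉ W ∧ R x q) ∧
       ∀ w ∈ U, w ∈ W → w ≠ x → w ≠ y → ∃ p ∈ U, ∃ q ∈ U, p ∉ W ∧ q ∉ W ∧ p ≠ q ∧ R p w ∧ R w q) := by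
  induction h with
  | single x => right; simp
  | @cons U x x' y h1 h2 h3 ih =>
    rw [Set.disjoint_insert_left] at hD
    have hx' := h3.mem_left
    by_cases hW : x ∈ W ∧ x' ∈ W
    · left
      obtain ⟨p, q, e, r1, r2⟩ := hbr x (by simp) x' (by simp [hx']) hW.1 hW.2 h2
      have h4 : EP R' U x' y := h3.mono (fun a _ b _ => hsub a b)
      have := EP.cons (x := x) (by simp [h1, hD.1]) r1 (e.append r2 h4 hD.2.symm)
      exact this.congr (by rw [Set.insert_union, Set.union_comm])
    · rcases ih (fun a ha b hb => hbr a (by simp [ha]) b (by simp [hb])) hD.2 with h5 | ⟨h5, h6⟩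
      · left
        exact (EP.cons (x := x) (by simp [h1, hD.1]) (hsub _ _ h2) h5).congr
          (by rw [Set.insert_union])
      · right
        refine ⟨fun hx _ => ⟨x', by simp [hx'], fun h => hW ⟨hx, h⟩, h2⟩, ?_⟩
        intro w hw hwW hwx hwy
        have hw' : w ∈ U := by simpa [hwx] using hw
        by_cases hwx' : w = x'
        · subst hwx'
          obtain ⟨q, hq, hqW, hr⟩ := h5 hwW hwy
          exact ⟨x, by simp, q, by simp [hq], fun h => hW ⟨h, hwW⟩, hqW,
            fun h => h1 (h ▸ hq), h2, hr⟩
        · obtain ⟨p, hp, q, hq, h⟩ := h6 w hw' hwW hwx' hwy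
          exact ⟨p, by simp [hp], q, by simp [hq], h⟩

end paths

end HamSp


/-! Part 2 -/
set_option linter.unusedSectionVars false
set_option linter.unusedSimpArgs false

namespace HamSp

section grp
variable {G : Type*} [CommGroup G]

/-- Adjacency by a letter from `A`. -/
def L (A : Set G) (x y : G) : Prop := x⁻¹ * y ∈ A

/-- closed under inverses -/
def Sy (A : Set G) : Prop := ∀ a ∈ A, a⁻¹ ∈ A

theorem L_symm {A : Set G} (hA : Sy A) (x y : G) (h : L A x y) : L A y x := by
  have := hA _ h
  simpa [L] using this

theorem L_mono {A B : Set G} (h : A ⊆ B) (x y : G) (hl : L A x y) : L B x y := h hl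

theorem L_mul {A : Set G} (g x y : G) : L A (g * x) (g * y) ↔ L A x y := by
  simp [L, mul_assoc]

theorem L_right {A : Set G} (x : G) {a : G} (ha : a ∈ A) : L A x (x * a) := by
  simpa [L] using ha

theorem EP.trl {A U : Set G} {x y : G} (g : G) (h : EP (L A) U x y) :
    EP (L A) {z | g⁻¹ * z ∈ U} (g * x) (g * y) := by
  have := h.map (Q := L A) (fun z => g * z) (by intro a _ b _ h; simpa using h)
    (fun a _ b _ h => (L_mul g a b).2 h)
  refine this.congr ?_
  ext z
  simp only [Set.mem_image, Set.mem_ofPred_eq]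
  constructor
  · rintro ⟨a, ha, rfl⟩; simpa using ha
  · intro h; exact ⟨_, h, by simp⟩

theorem EP.monoL {A B U : Set G} {x y : G} (h : EP (L A) U x y) (hAB : A ⊆ B) :
    EP (L B) U x y := h.mono (fun a _ b _ => L_mono hAB a b)

structure RE (K : Subgroup G) (A : Set G) : Prop where
  sub : A ⊆ K
  symm : Sy A
  ne : A.Nonempty
  one : (1 : G) ∉ A
  path : ∀ a ∈ A, EP (L A) (K : Set G) 1 a

def Strip (K : Subgroup G) (b : G) (l : ℕ) : Set G := {z | ∃ i < l, (b ^ i)⁻¹ * z ∈ K}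

theorem Strip_one (K : Subgroup G) (b : G) : Strip K b 1 = (K : Set G) := by
  ext z; simp [Strip]

theorem Strip_succ (K : Subgroup G) (b : G) (l : ℕ) :
    Strip K b (l + 1) = (K : Set G) ∪ {z | b⁻¹ * z ∈ Strip K b l} := by
  ext z
  simp only [Strip, Set.mem_ofPred_eq, Set.mem_union, SetLike.mem_coe]
  constructor
  · rintro ⟨i, hi, h⟩
    rcases i with _ | i
    · left; simpa using h
    · right
      refine ⟨i, by omega, ?_⟩
      rw [pow_succ', mul_inv_rev] at h
      simpa [mul_assoc, mul_comm, mul_left_comm] using h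
  · rintro (h | ⟨i, hi, h⟩)
    · exact ⟨0, by omega, by simpa using h⟩
    · refine ⟨i + 1, by omega, ?_⟩
      rw [pow_succ', mul_inv_rev]
      simpa [mul_assoc, mul_comm, mul_left_comm] using h

/-- `b^i ∉ K` for `1 ≤ i < l`. -/
def Free (K : Subgroup G) (b : G) (l : ℕ) : Prop := ∀ i, 1 ≤ i → i < l → b ^ i ∉ K

theorem Free.mono {K : Subgroup G} {b : G} {l l' : ℕ} (h : Free K b l) (hl : l' ≤ l) :
    Free K b l' := fun i h1 h2 => h i h1 (by omega)

theorem Free.row_unique {K : Subgroup G} {b : G} {l : ℕ} (h : Free K b l) {i j : ℕ} (hi : i < l)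
    (hj : j < l) {z : G} (h1 : (b ^ i)⁻¹ * z ∈ K) (h2 : (b ^ j)⁻¹ * z ∈ K) : i = j := by
  wlog hij : i ≤ j generalizing i j
  · exact (this hj hi h2 h1 (by omega)).symm
  by_contra hne
  refine h (j - i) (by omega) (by omega) ?_
  have := K.mul_mem h1 (K.inv_mem h2)
  have e : (b ^ i)⁻¹ * z * ((b ^ j)⁻¹ * z)⁻¹ = b ^ (j - i) := by
    obtain ⟨d, rfl⟩ := Nat.exists_eq_add_of_le hij
    rw [Nat.add_sub_cancel_left, pow_add]
    exact Additive.ofMul.injective (by simp only [ofMul_mul, ofMul_inv, ofMul_pow]; abel)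
  rwa [e] at this

theorem Strip_disj {K : Subgroup G} {b : G} {l : ℕ} (h : Free K b (l + 1)) :
    Disjoint (K : Set G) {z | b⁻¹ * z ∈ Strip K b l} := by
  rw [Set.disjoint_left]
  rintro z hz ⟨i, hi, h'⟩
  have : (b ^ (i + 1))⁻¹ * z ∈ K := by
    rw [pow_succ', mul_inv_rev]
    simpa [mul_assoc, mul_comm, mul_left_comm] using h'
  have := h.row_unique (i := i + 1) (j := 0) (by omega) (by omega) this (by simpa using hz)
  omega

theorem fat {K : Subgroup G} {A B : Set G} (hK : RE K A) {b : G} (hB : A ⊆ B) (hb : b ∈ B)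
    (hb' : b⁻¹ ∈ B) (l : ℕ) (hf : Free K b (l + 1)) :
    ∀ a ∈ A, EP (L B) (Strip K b (l + 1)) 1 a := by
  induction l with
  | zero =>
    intro a ha
    rw [Strip_one]
    exact (hK.path a ha).monoL hB
  | succ l ih =>
    intro a ha
    have h1 := hK.path a ha
    obtain ⟨c, V, e, h1V, hr, hV⟩ := h1.first (fun h => hK.one (h ▸ ha))
    have hc : c ∈ A := by simpa [L] using hr
    have h2 := (ih (hf.mono (by omega)) c hc).trl b
    have hd := Strip_disj hf
    rw [e, Set.disjoint_insert_left] at hd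
    have h3 := EP.cons (x := (1 : G)) (y := b) (R := L B) (z := a)
      (U := {z | b⁻¹ * z ∈ Strip K b (l + 1)} ∪ V) ?_ ?_ ?_
    · refine h3.congr ?_
      rw [Strip_succ K b (l + 1), e, Set.insert_union, Set.union_comm]
    · rw [Set.mem_union]; exact fun h => h.elim hd.1 h1V
    · simpa [L] using hb
    · have := h2.append (z := c) (w := a) (by simpa [L] using hb') (hV.monoL hB) hd.2.symm
      simpa using this

/-- the order of `b` modulo `K` -/
noncomputable def idx (K : Subgroup G) (b : G) : ℕ := orderOf (QuotientGroup.mk b : G ⧸ K)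

theorem pow_mem_iff (K : Subgroup G) (b : G) (i : ℕ) : b ^ i ∈ K ↔ idx K b ∣ i := by
  rw [idx, orderOf_dvd_iff_pow_eq_one, ← QuotientGroup.mk_pow, QuotientGroup.eq_one_iff]

theorem free_idx (K : Subgroup G) (b : G) : Free K b (idx K b) := by
  intro i h1 h2 h
  rw [pow_mem_iff] at h
  exact absurd (Nat.le_of_dvd h1 h) (by omega)

variable [Finite G]

theorem idx_pos (K : Subgroup G) (b : G) : 0 < idx K b := orderOf_pos _

theorem idx_two {K : Subgroup G} {b : G} (hb : b ∉ K) : 2 ≤ idx K b := by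
  have h0 := idx_pos K b
  rcases Nat.lt_or_ge (idx K b) 2 with h | h
  · have : idx K b = 1 := by omega
    exact absurd ((pow_mem_iff K b 1).2 (by rw [this])) (by simpa using hb)
  · exact h

theorem Free.le_idx {K : Subgroup G} {b : G} {l : ℕ} (h : Free K b l) : l ≤ idx K b := by
  by_contra hc
  exact h _ (idx_pos K b) (by omega) ((pow_mem_iff K b _).2 dvd_rfl)

/-- subgroup generated by `K` and `b` -/
def ext (K : Subgroup G) (b : G) : Subgroup G := K ⊔ Subgroup.zpowers b

theorem le_ext (K : Subgroup G) (b : G) : K ≤ ext K b := le_sup_left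
theorem mem_ext (K : Subgroup G) (b : G) : b ∈ ext K b :=
  (le_sup_right : _ ≤ ext K b) (Subgroup.mem_zpowers b)
theorem ext_inv (K : Subgroup G) (b : G) : ext K b⁻¹ = ext K b := by simp [ext]

theorem mem_ext_iff {K : Subgroup G} {b z : G} : z ∈ ext K b ↔ ∃ i < idx K b, (b ^ i)⁻¹ * z ∈ K := by
  constructor
  · intro h
    obtain ⟨y, hy, w, ⟨j, rfl⟩, rfl⟩ := Subgroup.mem_sup.1 h
    have hp := idx_pos K b
    obtain ⟨i, hi, hij⟩ : ∃ i : ℕ, i < idx K b ∧ ∃ q : ℤ, j = i + q * idx K b := by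
      refine ⟨(j % idx K b).toNat, ?_, j / idx K b, ?_⟩
      · have := Int.emod_lt_of_pos j (by exact_mod_cast hp : (0 : ℤ) < idx K b)
        have h0 := Int.emod_nonneg j (by exact_mod_cast hp.ne' : (idx K b : ℤ) ≠ 0)
        omega
      · have h0 := Int.emod_nonneg j (by exact_mod_cast hp.ne' : (idx K b : ℤ) ≠ 0)
        rw [Int.toNat_of_nonneg h0]
        have := Int.emod_add_mul_ediv j (idx K b)
        linarith [mul_comm (j / (idx K b : ℤ)) (idx K b : ℤ)]
    obtain ⟨q, rfl⟩ := hij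
    refine ⟨i, hi, ?_⟩
    have hk : b ^ idx K b ∈ K := (pow_mem_iff K b _).2 dvd_rfl
    have : (b ^ i)⁻¹ * (y * b ^ ((i : ℤ) + q * idx K b)) = y * (b ^ idx K b) ^ q := by
      rw [zpow_add, mul_comm q, zpow_mul, zpow_natCast, zpow_natCast]
      rw [mul_comm, mul_assoc, mul_comm _ ((b ^ idx K b) ^ q), mul_assoc, mul_inv_cancel, mul_one]
    simp only [this]
    exact K.mul_mem hy (K.zpow_mem hk q)
  · rintro ⟨i, _, h⟩
    have := (ext K b).mul_mem ((ext K b).pow_mem (mem_ext K b) i) (le_ext K b h)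
    simpa using this

theorem Strip_full (K : Subgroup G) (b : G) : Strip K b (idx K b) = (ext K b : Set G) := by
  ext z; rw [SetLike.mem_coe, mem_ext_iff]; rfl

theorem Strip_sub (K : Subgroup G) (b : G) (l : ℕ) : Strip K b l ⊆ (ext K b : Set G) := by
  rintro z ⟨i, _, h⟩
  have := (ext K b).mul_mem ((ext K b).pow_mem (mem_ext K b) i) (le_ext K b h)
  simpa using this

theorem idx_inv (K : Subgroup G) (b : G) : idx K b⁻¹ = idx K b := by
  simp [idx]

/-- letters `A` together with `b` and its inverse -/
def Adj1 (A : Set G) (b : G) : Set G := A ∪ {b, b⁻¹}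

theorem Adj1_inv (A : Set G) (b : G) : Adj1 A b⁻¹ = Adj1 A b := by
  simp [Adj1, Set.pair_comm]

theorem Adj1_sub (A : Set G) (b : G) : A ⊆ Adj1 A b := Set.subset_union_left
theorem mem_Adj1 (A : Set G) (b : G) : b ∈ Adj1 A b := by simp [Adj1]
theorem inv_mem_Adj1 (A : Set G) (b : G) : b⁻¹ ∈ Adj1 A b := by simp [Adj1]

theorem Adj1_symm {A : Set G} (hA : Sy A) (b : G) : Sy (Adj1 A b) := by
  rintro a (h | h | h)
  · exact Or.inl (hA a h)
  · subst h; simp [Adj1]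
  · rw [Set.mem_singleton_iff] at h; subst h; simp [Adj1]

theorem RE_step_aux {K : Subgroup G} {A : Set G} (hK : RE K A) {b : G} (hb : b ∉ K) :
    EP (L (Adj1 A b)) (ext K b : Set G) 1 b := by
  obtain ⟨a, ha⟩ := hK.ne
  obtain ⟨n, hn⟩ := Nat.exists_eq_add_of_le (idx_two hb)
  have hf := free_idx K b
  rw [hn] at hf
  have h1 := (fat hK (Adj1_sub A b) (mem_Adj1 A b) (inv_mem_Adj1 A b) n (hf.mono (by omega)) a ha)
  have h2 := (h1.trl b).reverse (L_symm (Adj1_symm hK.symm b))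
  have h3 := ((hK.path a ha).monoL (Adj1_sub A b)).append (z := b * a) ?_ h2 ?_
  · rw [mul_one] at h3
    refine h3.congr ?_
    rw [← Strip_full, hn, show 2 + n = (n + 1) + 1 by ring, Strip_succ K b (n + 1)]
  · rw [L, mul_comm b a]; simpa using mem_Adj1 A b
  · exact Strip_disj (hf.mono (by omega))

theorem RE_step {K : Subgroup G} {A : Set G} (hK : RE K A) {b : G} (hb : b ∉ K) :
    RE (ext K b) (Adj1 A b) where
  sub := by
    rintro a (h | h | h)
    · exact le_ext K b (hK.sub h)
    · subst h; exact mem_ext K _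
    · rw [Set.mem_singleton_iff] at h; subst h; exact (ext K b).inv_mem (mem_ext K _)
  symm := Adj1_symm hK.symm b
  ne := ⟨b, mem_Adj1 A b⟩
  one := by
    rintro (h | h | h)
    · exact hK.one h
    · exact hb (h ▸ K.one_mem)
    · rw [Set.mem_singleton_iff] at h
      have : b = 1 := by simpa using congrArg (·⁻¹) h.symm
      exact hb (this ▸ K.one_mem)
  path := by
    rintro a (h | h | h)
    · obtain ⟨n, hn⟩ := Nat.exists_eq_add_of_le (idx_pos K b)
      have := fat hK (Adj1_sub A b) (mem_Adj1 A b) (inv_mem_Adj1 A b) n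
        ((free_idx K b).mono (by omega)) a h
      refine this.congr ?_
      rw [← Strip_full, hn]; congr 1; omega
    · subst h; exact RE_step_aux hK hb
    · rw [Set.mem_singleton_iff] at h; subst h
      have := RE_step_aux hK (b := b⁻¹) (by simpa using hb)
      rwa [ext_inv, Adj1_inv] at this

/-- The complement of `U` can be bridged at the pair `x,y`. -/
def Br (S U : Set G) (x y : G) : Prop :=
  Uᶜ = ∅ ∨ ∃ p q, EP (L S) Uᶜ p q ∧ L S x p ∧ L S q y

theorem Br.trl {S U : Set G} {x y : G} (g : G) (h : Br S U x y) :
    Br S {z | g⁻¹ * z ∈ U} (g * x) (g * y) := by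
  rcases h with h | ⟨p, q, h, h1, h2⟩
  · left; ext z; simp only [Set.mem_compl_iff, Set.mem_ofPred_eq, Set.mem_empty_iff_false, iff_false]
    intro hz; have : g⁻¹ * z ∈ Uᶜ := hz
    rw [h] at this; exact this
  · right
    exact ⟨g * p, g * q, h.trl g, (L_mul _ _ _).2 h1, (L_mul _ _ _).2 h2⟩

theorem coset_eq (K : Subgroup G) {g : G} (hg : g ∈ K) : {z | g⁻¹ * z ∈ (K : Set G)} = (K : Set G) := by
  ext z; simp only [Set.mem_ofPred_eq, SetLike.mem_coe]
  exact K.mul_mem_cancel_left (K.inv_mem hg)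

theorem absorb {S A U : Set G} {K : Subgroup G} (hAS : A ⊆ S) (hbr : ∀ c ∈ A, Br S K 1 c)
    (hU : U ⊆ K) {x y : G} (h : EP (L A) U x y) (hxy : x ≠ y) :
    EP (L S) (U ∪ (K : Set G)ᶜ) x y := by
  obtain ⟨z, V, e, hx, hr, hV⟩ := h.first hxy
  have hxK : x ∈ K := hU h.mem_left
  have := (hbr _ hr).trl x
  rw [coset_eq K hxK, mul_one, mul_inv_cancel_left] at this
  rcases this with h0 | ⟨p, q, hpq, h1, h2⟩
  · rw [h0, Set.union_empty]; exact h.monoL hAS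
  · have hVK : V ⊆ K := fun v hv => hU (e ▸ Set.mem_insert_of_mem _ hv)
    have hd : Disjoint (K : Set G)ᶜ V := by
      rw [Set.disjoint_left]; exact fun v hv hv' => hv (hVK hv')
    have := EP.cons (x := x) ?_ h1 (hpq.append h2 (hV.monoL hAS) hd)
    · exact this.congr (by rw [e, Set.insert_union, Set.union_comm])
    · rintro (h | h)
      · exact h hxK
      · exact hx h

theorem exists_not_mem {S : Set G} (hS : Subgroup.closure S = ⊤) {K : Subgroup G} (hK : K ≠ ⊤) :
    ∃ b ∈ S, b ∉ K := by
  by_contra! h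
  exact hK (top_le_iff.1 (hS ▸ (Subgroup.closure_le K).2 h))

theorem Adj1_subS {S A : Set G} {b : G} (hA : A ⊆ S) (hb : b ∈ S) (hS : Sy S) : Adj1 A b ⊆ S := by
  rintro a (h | h | h)
  · exact hA h
  · exact h ▸ hb
  · rw [Set.mem_singleton_iff] at h; subst h; exact hS _ hb

theorem br_strip_aux {S A : Set G} {K : Subgroup G} (hK : RE K A) (hA : A ⊆ S) (hS : Sy S)
    {b : G} (hbS : b ∈ S) (hbK : b ∉ K) (ih : ∀ c ∈ Adj1 A b, Br S (ext K b) 1 c)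
    (l : ℕ) (hl : 1 ≤ l) (hf : Free K b l) {a : G} (ha : a ∈ A) :
    Br S (Strip K b l) (b ^ (l - 1)) (b ^ (l - 1) * a) := by
  have hle := hf.le_idx
  have hbp : ∀ i, b ^ i ∈ ext K b := fun i => (ext K b).pow_mem (mem_ext K b) i
  rcases hle.eq_or_lt with he | hlt
  · rw [he, Strip_full]
    have := (ih a (Or.inl ha)).trl (b ^ (l - 1))
    rw [coset_eq _ (hbp _), mul_one] at this
    rwa [← he]
  · right
    obtain ⟨n, hn⟩ := Nat.exists_eq_add_of_lt hlt
    have hfr := free_idx K b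
    have h1 := (fat hK (Adj1_sub A b) (mem_Adj1 A b) (inv_mem_Adj1 A b) n
      (hfr.mono (by omega)) a ha).trl (b ^ l)
    have hset : {z | (b ^ l)⁻¹ * z ∈ Strip K b (n + 1)} ∪ (ext K b : Set G)ᶜ = (Strip K b l)ᶜ := by
      ext z
      simp only [Set.mem_union, Set.mem_ofPred_eq, Set.mem_compl_iff, SetLike.mem_coe]
      constructor
      · rintro (⟨i, hi, h⟩ | h)
        · rintro ⟨j, hj, hj'⟩
          rw [← mul_assoc, ← mul_inv_rev, ← pow_add, add_comm] at h
          have := hfr.row_unique (by omega) (by omega) h hj'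
          omega
        · exact fun h' => h (Strip_sub K b l h')
      · intro h
        by_cases hz : z ∈ ext K b
        · left
          obtain ⟨i, hi, hi'⟩ := mem_ext_iff.1 hz
          have : l ≤ i := by
            by_contra hc
            exact h ⟨i, by omega, hi'⟩
          obtain ⟨d, rfl⟩ := Nat.exists_eq_add_of_le this
          refine ⟨d, by omega, ?_⟩
          rw [← mul_assoc, ← mul_inv_rev, ← pow_add]; exact hi'
        · right; exact hz
    have h2 := absorb (Adj1_subS hA hbS hS) ih (fun z hz => by
        have := (ext K b).mul_mem (hbp l) (Strip_sub K b (n + 1) hz)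
        simpa using this) h1 (by
          intro h; rw [mul_right_inj] at h; exact hK.one (h ▸ ha))
    rw [hset, mul_one] at h2
    have e1 : b ^ l = b ^ (l - 1) * b := by rw [← pow_succ]; congr 1; omega
    refine ⟨_, _, h2, ?_, ?_⟩
    · rw [e1]; exact L_right _ hbS
    · rw [e1, L]
      have : (b ^ (l - 1) * b * a)⁻¹ * (b ^ (l - 1) * a) = b⁻¹ := by
        exact Additive.ofMul.injective (by simp only [ofMul_mul, ofMul_inv, ofMul_pow]; abel)
      rw [this]; exact hS _ hbS

theorem br_all {S : Set G} (hS : Sy S) (hgen : Subgroup.closure S = ⊤) (K : Subgroup G) :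
    ∀ A : Set G, RE K A → A ⊆ S → ∀ a ∈ A, Br S K 1 a := by
  induction K using WellFoundedGT.induction with
  | ind K ih =>
    intro A hK hA a ha
    by_cases hT : K = ⊤
    · left; simp [hT]
    · obtain ⟨b, hbS, hbK⟩ := exists_not_mem hgen hT
      have hlt : K < ext K b := lt_of_le_of_ne (le_ext K b) (fun h => hbK (by rw [h]; exact mem_ext K b))
      have := br_strip_aux hK hA hS hbS hbK
        (ih (ext K b) hlt _ (RE_step hK hbK) (Adj1_subS hA hbS hS)) 1 le_rfl
        (fun i h1 h2 => by omega) ha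
      simpa [Strip_one] using this

theorem br_strip {S A : Set G} {K : Subgroup G} (hS : Sy S) (hgen : Subgroup.closure S = ⊤)
    (hK : RE K A) (hA : A ⊆ S)
    {b : G} (hbS : b ∈ S) (hbK : b ∉ K)
    (l : ℕ) (hl : 1 ≤ l) (hf : Free K b l) {a : G} (ha : a ∈ A) :
    Br S (Strip K b l) (b ^ (l - 1)) (b ^ (l - 1) * a) :=
  br_strip_aux hK hA hS hbS hbK
    (br_all hS hgen _ _ (RE_step hK hbK) (Adj1_subS hA hbS hS)) l hl hf ha

end grp
end HamSp


/-! Part 3 -/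
set_option linter.unusedSectionVars false
set_option linter.unusedSimpArgs false
set_option linter.unusedVariables false

namespace HamSp

/-- Grid adjacency on `ℤ × ℤ`, rows of length `m` being closed up to cycles. -/
def GR (m : ℤ) (p q : ℤ × ℤ) : Prop :=
  (p.1 = q.1 ∧ (q.2 = p.2 + 1 ∨ p.2 = q.2 + 1 ∨ q.2 = p.2 + (m - 1) ∨ p.2 = q.2 + (m - 1))) ∨
  (p.2 = q.2 ∧ (q.1 = p.1 + 1 ∨ p.1 = q.1 + 1))

theorem GR_symm (m : ℤ) (p q : ℤ × ℤ) (h : GR m p q) : GR m q p := by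
  unfold GR at *; omega

theorem hseg {R : ℤ × ℤ → ℤ × ℤ → Prop} (m : ℤ) (hR : ∀ p q, GR m p q → R p q) (i a : ℤ) (k : ℕ) :
    EP R {p : ℤ × ℤ | p.1 = i ∧ a ≤ p.2 ∧ p.2 ≤ a + k} (i, a) (i, a + k) := by
  induction k generalizing a with
  | zero =>
    have := EP.single (R := R) (i, a)
    simp only [Nat.cast_zero, add_zero]
    refine this.congr ?_
    ext ⟨j, c⟩; simp only [Set.mem_singleton_iff, Prod.mk.injEq, Set.mem_ofPred_eq]; omega
  | succ k ih =>
    have := EP.cons (x := (i, a)) ?_ (hR _ _ ?_) (ih (a + 1))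
    · rw [show a + 1 + (k : ℤ) = a + ((k + 1 : ℕ) : ℤ) by push_cast; ring] at this
      refine this.congr ?_
      ext ⟨j, c⟩
      simp only [Set.mem_insert_iff, Prod.mk.injEq, Set.mem_ofPred_eq]; push_cast; omega
    · simp
    · simp [GR]

theorem hsegZ {R : ℤ × ℤ → ℤ × ℤ → Prop} (m : ℤ) (hR : ∀ p q, GR m p q → R p q) (i a c : ℤ)
    (h : a ≤ c) : EP R {p : ℤ × ℤ | p.1 = i ∧ a ≤ p.2 ∧ p.2 ≤ c} (i, a) (i, c) := by
  obtain ⟨k, rfl⟩ := Int.le.dest h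
  exact hseg m hR i a k

theorem hsegR {R : ℤ × ℤ → ℤ × ℤ → Prop} (m : ℤ) (hR : ∀ p q, GR m p q → R p q) (i a c : ℤ)
    (h : a ≤ c) : EP R {p : ℤ × ℤ | p.1 = i ∧ a ≤ p.2 ∧ p.2 ≤ c} (i, c) (i, a) :=
  ((hsegZ m (fun _ _ => id) i a c h).reverse (GR_symm m)).mono (fun a _ b _ => hR a b)

theorem grid_disj {P Q : ℤ × ℤ → Prop} (h : ∀ i k, P (i, k) → Q (i, k) → False) :
    Disjoint {p | P p} {p | Q p} := by
  rw [Set.disjoint_left]; rintro ⟨i, k⟩ h1 h2; exact h i k h1 h2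

theorem grid_eq {P Q : ℤ × ℤ → Prop} {T : Set (ℤ × ℤ)}
    (h : ∀ i k, (P (i, k) ∨ Q (i, k)) ↔ (i, k) ∈ T) :
    {p | P p} ∪ {p | Q p} = T := by
  ext ⟨i, k⟩; exact h i k

/-- zigzag through `2k+2` columns -/
theorem zz {R : ℤ × ℤ → ℤ × ℤ → Prop} (m : ℤ) (hR : ∀ p q, GR m p q → R p q) (i j c : ℤ)
    (hij : i = j + 1 ∨ j = i + 1) (k : ℕ) :
    EP R {p : ℤ × ℤ | (p.1 = i ∨ p.1 = j) ∧ c ≤ p.2 ∧ p.2 ≤ c + 2 * k + 1} (i, c)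
      (i, c + 2 * k + 1) := by
  have base : ∀ c, EP R {p : ℤ × ℤ | (p.1 = i ∨ p.1 = j) ∧ c ≤ p.2 ∧ p.2 ≤ c + 1} (i, c)
      (i, c + 1) := by
    intro c
    have h1 := hsegZ m hR j c (c + 1) (by omega)
    have h2 := (hsegZ m hR i c c le_rfl).append (hR _ _ (by unfold GR; simp; omega)) h1
      (grid_disj (by intro a b; simp; omega))
    have h3 := h2.append (hR (j, c + 1) (i, c + 1) (by unfold GR; simp; omega)) (hsegZ m hR i (c + 1) (c + 1) le_rfl)
      (by rw [Set.disjoint_left]; rintro ⟨a, b⟩; simp; omega)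
    refine h3.congr ?_
    ext ⟨a, b⟩; simp; omega
  induction k generalizing c with
  | zero => simpa using base c
  | succ k ih =>
    have h := (base c).append (hR (i, c + 1) (i, c + 2) (by unfold GR; simp; omega)) (ih (c + 2))
      (grid_disj (by intro a b; simp; omega))
    rw [show c + 2 * ((k + 1 : ℕ) : ℤ) + 1 = c + 2 + 2 * k + 1 by push_cast; ring]
    refine h.congr ?_
    ext ⟨a, b⟩; simp; omega

/-- comb tail -/
theorem ctail {R : ℤ × ℤ → ℤ × ℤ → Prop} (m : ℤ) (hR : ∀ p q, GR m p q → R p q) (e c : ℤ) (h : e ≤ c) :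
    EP R {p : ℤ × ℤ | (p.1 = 0 ∨ p.1 = 1) ∧ e ≤ p.2 ∧ p.2 ≤ c} (0, e) (1, e) := by
  have h1 := (hsegZ m hR 0 e c h).append (hR (0, c) (1, c) (by simp [GR])) (hsegR m hR 1 e c h)
    (grid_disj (by intro a b; simp; omega))
  refine h1.congr ?_
  ext ⟨a, b⟩; simp; omega

theorem gridL1 {R : ℤ × ℤ → ℤ × ℤ → Prop} (m : ℤ) (hR : ∀ p q, GR m p q → R p q) (k : ℕ)
    (h : 2 * (k : ℤ) < m) :
    EP R {p : ℤ × ℤ | (0 ≤ p.1 ∧ p.1 < 2) ∧ 0 ≤ p.2 ∧ p.2 < m} (0, 0) (1, 2 * k) := by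
  rcases k with _ | k
  · refine (ctail m hR 0 (m - 1) (by push_cast at h; omega)).congr ?_
    ext ⟨a, b⟩; simp; omega
  · have := (zz m hR 0 1 0 (by simp) k).append (hR _ (0, 2 * ((k + 1 : ℕ) : ℤ)) (by unfold GR; push_cast; simp; omega))
      (ctail m hR (2 * ((k + 1 : ℕ) : ℤ)) (m - 1) (by omega)) (grid_disj (by intro a b; simp; omega))
    refine this.congr ?_
    ext ⟨a, b⟩; simp; push_cast; omega

theorem gridQ {R : ℤ × ℤ → ℤ × ℤ → Prop} (m : ℤ) (hR : ∀ p q, GR m p q → R p q) (k : ℕ) :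
    EP R {p : ℤ × ℤ | (p.1 = 1 ∨ (p.1 = 0 ∧ p.2 ≠ 0)) ∧ 0 ≤ p.2 ∧ p.2 ≤ 2 * k + 1} (1, 0) (0, 2 * k + 1) := by
  rcases k with _ | k
  · have := (hsegZ m hR 1 0 1 (by omega)).append (hR (1, 1) (0, 1) (by simp [GR])) (hsegZ m hR 0 1 1 le_rfl)
      (grid_disj (by intro a b; simp; omega))
    refine (this.congr ?_)
    ext ⟨a, b⟩; simp; omega
  · have h1 := (hsegZ m hR 1 0 0 le_rfl).append (hR (1, 0) (1, 1) (by simp [GR])) (zz m hR 1 0 1 (by simp) k)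
      (grid_disj (by intro a b; simp; omega))
    have h2 := h1.append (hR _ (1, 2 * ((k + 1 : ℕ) : ℤ) + 1) (by unfold GR; push_cast; simp; omega))
      (hsegZ m hR 1 (2 * ((k + 1 : ℕ) : ℤ) + 1) _ le_rfl) (by
        rw [Set.disjoint_left]; rintro ⟨a, b⟩; simp; omega)
    have h3 := h2.append (hR _ (0, 2 * ((k + 1 : ℕ) : ℤ) + 1) (by unfold GR; push_cast; simp))
      (hsegZ m hR 0 (2 * ((k + 1 : ℕ) : ℤ) + 1) _ le_rfl) (by
        rw [Set.disjoint_left]; rintro ⟨a, b⟩; simp; omega)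
    refine (h3.congr ?_)
    ext ⟨a, b⟩; simp; omega

/-- row `0` backwards from `0` down to `d+1`, up, forward to `(1,0)` -/
theorem gridBack {R : ℤ × ℤ → ℤ × ℤ → Prop} (m : ℤ) (hR : ∀ p q, GR m p q → R p q) (d : ℤ)
    (h : d + 1 < m) (hd : 0 ≤ d) :
    EP R {p : ℤ × ℤ | p = (0, 0) ∨ (p.1 = 0 ∨ p.1 = 1) ∧ d + 1 ≤ p.2 ∧ p.2 ≤ m - 1} (0, 0) (1, m - 1) := by
  have h1 := (EP.single (R := R) ((0, 0) : ℤ × ℤ)).append (hR _ (0, m - 1) (by simp [GR])) (hsegR m hR 0 (d + 1) (m - 1) (by omega))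
    (by rw [Set.disjoint_left]; rintro ⟨a, b⟩; simp; omega)
  have h2 := h1.append (hR _ (1, d + 1) (by simp [GR])) (hsegZ m hR 1 (d + 1) (m - 1) (by omega))
    (by rw [Set.disjoint_left]; rintro ⟨a, b⟩; simp; omega)
  refine h2.congr ?_
  ext ⟨a, b⟩; simp; omega

theorem gridL2 {R : ℤ × ℤ → ℤ × ℤ → Prop} (m : ℤ) (hR : ∀ p q, GR m p q → R p q) (k : ℕ)
    (h : 2 * (k : ℤ) + 1 < m) :
    EP R {p : ℤ × ℤ | (0 ≤ p.1 ∧ p.1 < 2) ∧ 0 ≤ p.2 ∧ p.2 < m} (0, 0) (0, 2 * k + 1) := by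
  by_cases hd : 2 * (k : ℤ) + 1 = m - 1
  · have := (EP.single (R := R) ((0, 0) : ℤ × ℤ)).append (hR _ (1, 0) (by simp [GR])) (gridQ m hR k)
      (by rw [Set.disjoint_left]; rintro ⟨a, b⟩; simp; omega)
    refine this.congr ?_
    ext ⟨a, b⟩; simp; omega
  · have := (gridBack m hR (2 * k + 1) (by omega) (by omega)).append (hR _ (1, 0) (by simp [GR])) (gridQ m hR k)
      (by rw [Set.disjoint_left]; rintro ⟨a, b⟩; simp; omega)
    refine this.congr ?_
    ext ⟨a, b⟩; simp; omega

section grp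
variable {G : Type*} [CommGroup G] [Finite G]

def cy (b s : G) (p : ℤ × ℤ) : G := b ^ p.1 * s ^ p.2

theorem cy_inj {b s : G} {l : ℕ} (hf : Free (Subgroup.zpowers s) b l) (c : ℤ) :
    Set.InjOn (cy b s) {p | (0 ≤ p.1 ∧ p.1 < l) ∧ c ≤ p.2 ∧ p.2 < c + orderOf s} := by
  rintro ⟨i, k⟩ ⟨⟨hi, hi'⟩, hk, hk'⟩ ⟨j, k'⟩ ⟨⟨hj, hj'⟩, hk2, hk2'⟩ h
  simp only [cy] at *
  have hij : i = j := by
    obtain ⟨i, rfl⟩ := Int.eq_ofNat_of_zero_le hi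
    obtain ⟨j, rfl⟩ := Int.eq_ofNat_of_zero_le hj
    have := hf.row_unique (i := i) (j := j) (by omega) (by omega) (z := b ^ i * s ^ k)
      (by simp) (by
        rw [zpow_natCast, zpow_natCast] at h
        rw [h]; simp)
    omega
  subst hij
  rw [mul_right_inj, zpow_eq_zpow_iff_modEq] at h
  have : k = k' := by
    have h3 : (k - k') % (orderOf s : ℤ) = 0 := by
      rw [Int.emod_eq_zero_of_dvd]; exact (Int.modEq_iff_dvd.1 h.symm)
    obtain ⟨q, hq⟩ := Int.dvd_of_emod_eq_zero h3
    have : q = 0 := by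
      by_contra hne
      rcases lt_or_gt_of_ne hne with h4 | h4
      · nlinarith
      · nlinarith
    subst this; simp at hq; omega
  rw [this]

theorem cy_image (b s : G) (l : ℕ) (c : ℤ) :
    cy b s '' {p | (0 ≤ p.1 ∧ p.1 < l) ∧ c ≤ p.2 ∧ p.2 < c + orderOf s} =
      Strip (Subgroup.zpowers s) b l := by
  ext z
  constructor
  · rintro ⟨⟨i, k⟩, ⟨⟨hi, hi'⟩, _⟩, rfl⟩
    simp only at hi hi'
    obtain ⟨i, rfl⟩ := Int.eq_ofNat_of_zero_le hi
    exact ⟨i, by omega, by simp [cy]⟩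
  · rintro ⟨i, hi, k, hk⟩
    have hp : 0 < orderOf s := orderOf_pos s
    refine ⟨(i, c + (k - c) % orderOf s), ⟨⟨by simp, by simpa using hi⟩, ?_, ?_⟩, ?_⟩
    · have := Int.emod_nonneg (k - c) (by omega : (orderOf s : ℤ) ≠ 0); simp; omega
    · have := Int.emod_lt_of_pos (k - c) (by omega : 0 < (orderOf s : ℤ)); simp; omega
    · have : s ^ (c + (k - c) % orderOf s) = s ^ k := by
        rw [zpow_add, zpow_mod_orderOf, ← zpow_add]; congr 1; ring
      simp only [cy, this]
      simp only at hk
      rw [hk]; simp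

theorem cy_L {b s : G} {B : Set G} (hs : s ∈ B) (hs' : s⁻¹ ∈ B) (hb : b ∈ B) (hb' : b⁻¹ ∈ B)
    (p q : ℤ × ℤ) (h : GR (orderOf s) p q) : L B (cy b s p) (cy b s q) := by
  have hp : s ^ ((orderOf s : ℤ) - 1) = s⁻¹ := by
    rw [zpow_sub, zpow_natCast, pow_orderOf_eq_one]; simp
  obtain ⟨i, k⟩ := p
  obtain ⟨j, k'⟩ := q
  unfold L cy
  rcases h with ⟨h1, h2⟩ | ⟨h1, h2⟩ <;> simp only at h1 h2 <;> subst h1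
  · rcases h2 with h2 | h2 | h2 | h2 <;> subst h2 <;> rw [mul_inv_rev, mul_assoc, inv_mul_cancel_left]
    · rw [zpow_add_one]; simpa using hs
    · rw [zpow_add_one]; simpa using hs'
    · rw [zpow_add, hp]; simpa using hs'
    · rw [zpow_add, hp]; simpa using hs
  · rcases h2 with h2 | h2 <;> subst h2 <;> rw [mul_inv_rev, mul_comm (b ^ _) (s ^ _), mul_comm ((s ^ _)⁻¹), mul_assoc, inv_mul_cancel_left]
    · rw [zpow_add_one]; simpa using hb
    · rw [zpow_add_one]; simpa using (hb')

theorem gridmap {R : ℤ × ℤ → ℤ × ℤ → Prop} {b s : G} {B : Set G} {l : ℕ}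
    (hR : ∀ p q, R p q → L B (cy b s p) (cy b s q))
    (hf : Free (Subgroup.zpowers s) b l) (c : ℤ) {p q : ℤ × ℤ}
    (h : EP R {p | (0 ≤ p.1 ∧ p.1 < l) ∧ c ≤ p.2 ∧ p.2 < c + orderOf s} p q) :
    EP (L B) (Strip (Subgroup.zpowers s) b l) (cy b s p) (cy b s q) := by
  rw [← cy_image b s l c]
  exact h.map (cy b s) (cy_inj hf c) (fun p _ q _ => hR p q)

theorem free_one (K : Subgroup G) (b : G) : Free K b 1 := fun i h1 h2 => by omega

theorem RE_single_aux {s : G} :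
    EP (L {s, s⁻¹}) (Subgroup.zpowers s : Set G) 1 s⁻¹ := by
  have hp : 0 < orderOf s := orderOf_pos s
  have h := hsegZ (orderOf s) (fun p q h => h) 0 0 (orderOf s - 1) (by omega)
  have := gridmap (b := s) (s := s) (B := {s, s⁻¹}) (l := 1) (cy_L (by simp) (by simp) (by simp) (by simp))
    (free_one _ _) 0 (h.congr (V := {p : ℤ × ℤ | (0 ≤ p.1 ∧ p.1 < ((1 : ℕ) : ℤ)) ∧ 0 ≤ p.2 ∧ p.2 < 0 + (orderOf s : ℤ)}) (by ext ⟨a, b⟩; simp; omega))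
  rw [Strip_one] at this
  have e : s ^ ((orderOf s : ℤ) - 1) = s⁻¹ := by
    rw [zpow_sub, zpow_natCast, pow_orderOf_eq_one]; simp
  simpa [cy, e] using this

theorem RE_single {s : G} (hs : s ≠ 1) : RE (Subgroup.zpowers s) {s, s⁻¹} where
  sub := by rintro a (h | h) <;> subst h <;> simp
  symm := by rintro a (h | h) <;> subst h <;> simp
  ne := ⟨s, by simp⟩
  one := by
    rintro (h | h)
    · exact hs h.symm
    · exact hs (by simpa using congrArg (·⁻¹) h.symm)
  path := by
    rintro a (h | h)
    · subst h
      have := RE_single_aux (s := a⁻¹)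
      rw [Subgroup.zpowers_inv, inv_inv, Set.pair_comm] at this; exact this
    · subst h; exact RE_single_aux

end grp
end HamSp


/-! Part 4 -/
set_option linter.unusedSectionVars false
set_option linter.unusedSimpArgs false
set_option linter.unusedVariables false

namespace HamSp
section grp
variable {G : Type*} [CommGroup G] [Finite G]

/-- `F` vanishes on the `A`-edges of the strip and on the `b`-edges between consecutive rows -/
structure ZS (F : G → G → ZMod 2) (A : Set G) (K : Subgroup G) (b : G) (l : ℕ) : Prop where
  row : ∀ z ∈ Strip K b l, ∀ a ∈ A, F z (z * a) = 0
  col : ∀ i, i + 1 < l → ∀ z, (b ^ i)⁻¹ * z ∈ K → F z (z * b) = 0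

/-- flatness -/
def Fl (S : Set G) (F : G → G → ZMod 2) : Prop :=
  ∀ g, ∀ s ∈ S, ∀ t ∈ S, t ≠ s → t ≠ s⁻¹ →
    F g (g * s) + F (g * t) (g * t * s) + F g (g * t) + F (g * s) (g * s * t) = 0

def gau (F : G → G → ZMod 2) (φ : G → ZMod 2) : G → G → ZMod 2 := fun x y => F x y + φ x + φ y

/-- colouring defect -/
def cdef (c : G → ZMod 2) : G → G → ZMod 2 := fun x y => 1 + c x + c y

theorem Fl.gau {S : Set G} {F : G → G → ZMod 2} (h : Fl S F) (φ : G → ZMod 2) :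
    Fl S (gau F φ) := by
  intro g s hs t ht h1 h2
  have := h g s hs t ht h1 h2
  have e : g * s * t = g * t * s := by rw [mul_right_comm]
  simp only [HamSp.gau]
  rw [e] at *
  grind

theorem Fl.add {S : Set G} {F F' : G → G → ZMod 2} (h : Fl S F) (h' : Fl S F') :
    Fl S (fun x y => F x y + F' x y) := by
  intro g s hs t ht h1 h2
  have := h g s hs t ht h1 h2
  have := h' g s hs t ht h1 h2
  grind

theorem Fl.const (S : Set G) (e : ZMod 2) : Fl S (fun _ _ => e) := by
  intro g s hs t ht h1 h2
  grind

theorem Fl.cdef (S : Set G) (c : G → ZMod 2) : Fl S (cdef c) := (Fl.const S 1).gau c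

theorem Strip_mono (K : Subgroup G) (b : G) {l l' : ℕ} (h : l ≤ l') : Strip K b l ⊆ Strip K b l' := by
  rintro z ⟨i, hi, h'⟩; exact ⟨i, by omega, h'⟩

theorem row_mul {K : Subgroup G} {b z c : G} {i : ℕ} (hc : c ∈ K) :
    (b ^ i)⁻¹ * (z * c) ∈ K ↔ (b ^ i)⁻¹ * z ∈ K := by
  rw [← mul_assoc]; exact K.mul_mem_cancel_right hc

theorem row_succ {K : Subgroup G} {b z : G} {i : ℕ} :
    (b ^ (i + 1))⁻¹ * (z * b) ∈ K ↔ (b ^ i)⁻¹ * z ∈ K := by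
  have : (b ^ (i + 1))⁻¹ * (z * b) = (b ^ i)⁻¹ * z := by
    rw [pow_succ]
    exact Additive.ofMul.injective (by simp only [ofMul_mul, ofMul_inv, ofMul_pow]; abel)
  rw [this]

theorem row_succ' {K : Subgroup G} {b z : G} {i : ℕ} :
    (b ^ (i + 1))⁻¹ * z ∈ K ↔ (b ^ i)⁻¹ * (z * b⁻¹) ∈ K := by
  have := row_succ (K := K) (b := b) (z := z * b⁻¹) (i := i)
  rwa [inv_mul_cancel_right] at this

theorem rowGauge {S A : Set G} {F : G → G → ZMod 2} (hF : Fl S F) {K : Subgroup G} {b : G}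
    (hAK : A ⊆ K) (hAS : A ⊆ S) (hbS : b ∈ S) (hbK : b ∉ K)
    (h0 : ∀ z ∈ K, ∀ a ∈ A, F z (z * a) = 0) (l : ℕ) (hf : Free K b (l + 1)) :
    ∃ φ : G → ZMod 2, (∀ z ∈ K, φ z = 0) ∧ ZS (gau F φ) A K b (l + 1) := by
  classical
  induction l with
  | zero =>
    refine ⟨fun _ => 0, fun _ _ => rfl, ⟨?_, ?_⟩⟩
    · intro z hz a ha
      simp only [zero_add, Strip_one] at hz
      simp [gau, h0 z hz a ha]
    · intro i hi; omega
  | succ l ih =>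
    obtain ⟨φ, hφ, hz⟩ := ih (hf.mono (by omega))
    set F' := gau F φ with hF'
    have hFl : Fl S F' := hF.gau φ
    let ψ : G → ZMod 2 := fun z => if (b ^ (l + 1))⁻¹ * z ∈ K then F' (z * b⁻¹) z else 0
    have hg : gau F (fun z => φ z + ψ z) = gau F' ψ := by
      funext x y; simp only [gau, hF']; ring
    have hrow : ∀ i, i ≤ l → ∀ z, (b ^ i)⁻¹ * z ∈ K → ψ z = 0 := by
      intro i hi z hz
      simp only [ψ]
      rw [if_neg]
      intro h
      have := hf.row_unique (by omega) (by omega) hz h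
      omega
    refine ⟨fun z => φ z + ψ z, ?_, ?_⟩
    · intro z hz
      have := hrow 0 (by omega) z (by simpa using hz)
      simp [hφ z hz, this]
    rw [hg]
    refine ⟨?_, ?_⟩
    · rintro z ⟨i, hi, hzi⟩ a ha
      have haK := hAK ha
      by_cases hil : i ≤ l
      · have h1 := hrow i hil z hzi
        have h2 := hrow i hil (z * a) ((row_mul haK).2 hzi)
        have h3 := hz.row z ⟨i, by omega, hzi⟩ a ha
        simp only [gau] at *
        rw [h1, h2]; simpa using h3
      · have hil' : i = l + 1 := by omega
        subst hil'
        have h1 : ψ z = F' (z * b⁻¹) z := if_pos hzi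
        have h2 : ψ (z * a) = F' (z * a * b⁻¹) (z * a) := if_pos ((row_mul haK).2 hzi)
        have hz' := row_succ'.1 hzi
        have h3 := hz.row (z * b⁻¹) ⟨l, by omega, hz'⟩ a ha
        have hne : ∀ c ∈ K, b ≠ c := fun c hc h => hbK (h ▸ hc)
        have h4 := hFl (z * b⁻¹) a (hAS ha) b hbS (hne _ haK) (hne _ (K.inv_mem haK))
        rw [inv_mul_cancel_right] at h4
        have e : z * b⁻¹ * a = z * a * b⁻¹ := mul_right_comm _ _ _
        rw [e, inv_mul_cancel_right] at h4
        rw [e] at h3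
        have : gau F' ψ z (z * a) = F' z (z * a) + F' (z * b⁻¹) z + F' (z * a * b⁻¹) (z * a) := by
          simp only [gau, h1, h2]
        rw [this]
        grind
    · intro i hi z hzi
      by_cases hil : i + 1 ≤ l
      · have h1 := hrow i (by omega) z hzi
        have h2 := hrow (i + 1) hil (z * b) (row_succ.2 hzi)
        have h3 := hz.col i (by omega) z hzi
        simp only [gau] at *
        rw [h1, h2]; simpa using h3
      · have hil' : i = l := by omega
        subst hil'
        have h1 := hrow i (by omega) z hzi
        have h2 : ψ (z * b) = F' (z * b * b⁻¹) (z * b) := if_pos (row_succ.2 hzi)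
        rw [mul_inv_cancel_right] at h2
        show F' z (z * b) + ψ z + ψ (z * b) = 0
        rw [h1, h2]; grind

/-- (semi-)Hamilton-connectedness of strips, starting from row `0` -/
def SHC (B : Set G) (K : Subgroup G) (b : G) (l : ℕ) (bip : Prop) (c : G → ZMod 2) : Prop :=
  ∀ x ∈ K, ∀ y ∈ Strip K b l, x ≠ y → (bip → c x ≠ c y) → EP (L B) (Strip K b l) x y

theorem Strip_coset (K : Subgroup G) (b : G) (l : ℕ) {g : G} (hg : g ∈ K) :
    {z | g⁻¹ * z ∈ Strip K b l} = Strip K b l := by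
  ext z
  simp only [Set.mem_ofPred_eq, Strip]
  have : ∀ i, (b ^ i)⁻¹ * (g⁻¹ * z) ∈ K ↔ (b ^ i)⁻¹ * z ∈ K := by
    intro i
    rw [mul_comm g⁻¹, row_mul (K.inv_mem hg)]
  simp [this]

theorem zmod2_ne {a b : ZMod 2} : a ≠ b ↔ a = b + 1 := by
  revert a b; decide

theorem cdef_zero {c : G → ZMod 2} {x y : G} : cdef c x y = 0 ↔ c y = c x + 1 := by
  unfold cdef; grind

theorem shc_cyc2_aux {s b : G} (hm : 3 ≤ orderOf s) (hf : Free (Subgroup.zpowers s) b 2)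
    (i k : ℤ) (hk : 0 ≤ k) (hk' : k < orderOf s)
    (h : (i = 0 ∧ Odd k) ∨ (i = 1 ∧ Even k)) :
    EP (L (Adj1 {s, s⁻¹} b)) (Strip (Subgroup.zpowers s) b 2) 1 (b ^ i * s ^ k) := by
  have hL := cy_L (b := b) (s := s) (B := Adj1 {s, s⁻¹} b) (by simp [Adj1]) (by simp [Adj1])
    (by simp [Adj1]) (by simp [Adj1])
  rcases h with ⟨rfl, j, rfl⟩ | ⟨rfl, j, rfl⟩
  · obtain ⟨j, rfl⟩ := Int.eq_ofNat_of_zero_le (show 0 ≤ j by omega)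
    have := gridmap (l := 2) hL hf 0 (by simpa using gridL2 (orderOf s) (fun p q h => h) j hk')
    simpa [cy] using this
  · obtain ⟨j, rfl⟩ := Int.eq_ofNat_of_zero_le (show 0 ≤ j by omega)
    have := gridmap (l := 2) hL hf 0 (by simpa using gridL1 (orderOf s) (fun p q h => h) j (by omega))
    simpa [cy, two_mul] using this

theorem col_zpow {s : G} {c : G → ZMod 2} (P : G → Prop) (hP : ∀ z, P z → P (z * s))
    (hc : ∀ z, P z → c (z * s) = c z + 1) (z : G) (hz : P z) (k : ℕ) :
    P (z * s ^ k) ∧ c (z * s ^ k) = c z + k := by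
  induction k with
  | zero => simpa using hz
  | succ k ih =>
    rw [pow_succ, ← mul_assoc]
    refine ⟨hP _ ih.1, ?_⟩
    rw [hc _ ih.1, ih.2]; push_cast; ring

theorem shc_cyc2 {s b : G} (hm : 3 ≤ orderOf s) (hf : Free (Subgroup.zpowers s) b 2)
    {bip : Prop} (hodd : Odd (orderOf s) ∨ bip) {c : G → ZMod 2}
    (hc : bip → ZS (cdef c) {s, s⁻¹} (Subgroup.zpowers s) b 2) :
    SHC (Adj1 {s, s⁻¹} b) (Subgroup.zpowers s) b 2 bip c := by
  intro x hx y hy hxy hcol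
  have hy' : x⁻¹ * y ∈ Strip (Subgroup.zpowers s) b 2 := by
    rw [← Strip_coset _ b 2 hx] at hy; exact hy
  suffices h : EP (L (Adj1 {s, s⁻¹} b)) (Strip (Subgroup.zpowers s) b 2) 1 (x⁻¹ * y) by
    have := h.trl x
    rwa [Strip_coset _ b 2 hx, mul_one, mul_inv_cancel_left] at this
  rw [← cy_image b s 2 0] at hy'
  obtain ⟨⟨i, k⟩, ⟨⟨hi, hi'⟩, hk, hk'⟩, hik⟩ := hy'
  simp only [cy] at hi hi' hk hk' hik
  obtain ⟨k, rfl⟩ := Int.eq_ofNat_of_zero_le hk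
  rw [← hik]
  have hyx : y = x * (b ^ i * s ^ (k : ℤ)) := by rw [hik]; simp
  by_cases hg : (i = 0 ∧ Odd (k : ℤ)) ∨ (i = 1 ∧ Even (k : ℤ))
  · exact shc_cyc2_aux hm hf i k hk (by omega) hg
  rcases hodd with hodd | hbip
  · have hne : k ≠ 0 ∨ i ≠ 0 := by
      by_contra! h
      rw [h.1, h.2] at hyx; simp at hyx; exact hxy hyx.symm
    have hk0 : k ≠ 0 := by
      rintro rfl
      have : i = 1 := by omega
      exact hg (Or.inr ⟨this, by simp⟩)
    have := shc_cyc2_aux (s := s⁻¹) (b := b) (by simpa using hm) (by simpa using hf) i (orderOf s - k) (by omega)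
      (by simp; omega) (by
        have : i = 0 ∨ i = 1 := by omega
        rcases this with rfl | rfl
        · left; refine ⟨rfl, ?_⟩
          have : Even (k : ℤ) := by
            by_contra h; exact hg (Or.inl ⟨rfl, Int.not_even_iff_odd.1 h⟩)
          exact Odd.sub_even (by exact_mod_cast hodd) this
        · right; refine ⟨rfl, ?_⟩
          have : Odd (k : ℤ) := by
            by_contra h; exact hg (Or.inr ⟨rfl, Int.not_odd_iff_even.1 h⟩)
          exact Odd.sub_odd (by exact_mod_cast hodd) this)
    have e : s⁻¹ ^ ((orderOf s : ℤ) - k) = s ^ (k : ℤ) := by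
      rw [inv_zpow', neg_sub, zpow_sub, zpow_natCast s (orderOf s), pow_orderOf_eq_one]; simp
    rw [e, Subgroup.zpowers_inv, inv_inv, Set.pair_comm] at this
    exact this
  · exfalso
    have hz := hc hbip
    have hrow : ∀ z, z ∈ Strip (Subgroup.zpowers s) b 2 → z * s ∈ Strip (Subgroup.zpowers s) b 2 := by
      rintro z ⟨j, hj, h⟩
      exact ⟨j, hj, (row_mul (Subgroup.mem_zpowers s)).2 h⟩
    have h1 : ∀ z ∈ Strip (Subgroup.zpowers s) b 2, c (z * s) = c z + 1 := fun z hz' =>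
      cdef_zero.1 (hz.row z hz' s (by simp))
    have hxs : x ∈ Strip (Subgroup.zpowers s) b 2 := ⟨0, by omega, by simpa using hx⟩
    have hcol := zmod2_ne.1 (hcol hbip)
    have h01 : i = 0 ∨ i = 1 := by omega
    rcases h01 with rfl | rfl
    · have := (col_zpow _ hrow h1 x hxs k).2
      have hkk : y = x * s ^ k := by rw [hyx]; simp
      rw [← hkk] at this
      have hev : Even k := by
        by_contra h
        exact hg (Or.inl ⟨rfl, by exact_mod_cast Nat.not_even_iff_odd.1 h⟩)
      have : (k : ZMod 2) = 0 := (ZMod.natCast_eq_zero_iff_even).2 hev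
      grind
    · have hb1 : c (x * b) = c x + 1 := cdef_zero.1 (hz.col 0 (by omega) x (by simpa using hx))
      have hbs : x * b ∈ Strip (Subgroup.zpowers s) b 2 := ⟨1, by omega, by
        rw [row_succ (i := 0)]; simpa using hx⟩
      have := (col_zpow _ hrow h1 (x * b) hbs k).2
      have hkk : y = x * b * s ^ k := by rw [hyx]; simp [mul_assoc]
      rw [← hkk] at this
      have hev : Odd k := by
        by_contra h
        exact hg (Or.inr ⟨rfl, by exact_mod_cast Nat.not_odd_iff_even.1 h⟩)
      have : (k : ZMod 2) = 1 := (ZMod.natCast_eq_one_iff_odd).2 hev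
      grind

theorem ZS.mono {F : G → G → ZMod 2} {A : Set G} {K : Subgroup G} {b : G} {l l' : ℕ}
    (h : ZS F A K b l) (hl : l' ≤ l) : ZS F A K b l' :=
  ⟨fun z hz => h.row z (Strip_mono K b hl hz), fun i hi => h.col i (by omega)⟩

theorem shc_step {A : Set G} {K : Subgroup G} (hK : RE K A) {b : G} {l : ℕ} (hl : 1 ≤ l)
    (hf : Free K b (l + 1)) {bip : Prop} {c : G → ZMod 2} (hc : bip → ZS (cdef c) A K b (l + 1))
    (hz : l = 1 → ¬ bip → ∀ x ∈ K, ∀ w ∈ K, ∃ z ∈ K, z ≠ w ∧ EP (L (Adj1 A b)) K x z)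
    (ih : SHC (Adj1 A b) K b l bip c) : SHC (Adj1 A b) K b (l + 1) bip c := by
  intro x hx y hy hxy hcol
  have hbK : b ∉ K := by simpa using hf 1 le_rfl (by omega)
  obtain ⟨l, rfl⟩ : ∃ l', l = l' + 1 := ⟨l - 1, by omega⟩
  by_cases hyl : y ∈ Strip K b (l + 1)
  · have hp := ih x hx y hyl hxy hcol
    have hset : Strip K b (l + 1) ∪ {z | (b ^ (l + 1))⁻¹ * z ∈ K} = Strip K b (l + 1 + 1) := by
      ext z
      simp only [Strip, Set.mem_union, Set.mem_ofPred_eq]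
      constructor
      · rintro (⟨i, hi, h⟩ | h)
        · exact ⟨i, by omega, h⟩
        · exact ⟨l + 1, by omega, h⟩
      · rintro ⟨i, hi, h⟩
        by_cases hi' : i = l + 1
        · right; exact hi' ▸ h
        · left; exact ⟨i, by omega, h⟩
    have key := hp.insertAux (R' := L (Adj1 A b)) (W := {z | (b ^ l)⁻¹ * z ∈ K})
      (fun _ _ h => h) {z | (b ^ (l + 1))⁻¹ * z ∈ K} ?_ ?_
    · rcases key with key | ⟨k1, k2⟩
      · exact key.congr hset
      · exfalso
        by_cases hl0 : l = 0
        · subst hl0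
          obtain ⟨q, hq, hq', _⟩ := k1 (by simpa using hx) hxy
          rw [zero_add, Strip_one] at hq
          exact hq' (by simpa using hq)
        · obtain ⟨a, ha⟩ := hK.ne
          have haK := hK.sub ha
          have hx' : ∀ w, (b ^ l)⁻¹ * w ∈ K → w ≠ x := by
            rintro w hw rfl
            have := hf.row_unique (i := l) (j := 0) (by omega) (by omega) hw (by simpa using hx)
            omega
          obtain ⟨w, hw, hwy⟩ : ∃ w, (b ^ l)⁻¹ * w ∈ K ∧ w ≠ y := by
            by_cases h : b ^ l = y
            · refine ⟨b ^ l * a, by simpa using haK, ?_⟩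
              rw [h]; intro h'
              exact hK.one (by rw [mul_eq_left] at h'; exact h' ▸ ha)
            · exact ⟨b ^ l, by simp, h⟩
          obtain ⟨p, hp1, q, hq1, hpW, hqW, hpq, r1, r2⟩ := k2 w ⟨l, by omega, hw⟩ hw (hx' w hw) hwy
          have hnb : w * b ∉ Strip K b (l + 1) := by
            rintro ⟨i, hi, h⟩
            have := hf.row_unique (i := i) (j := l + 1) (by omega) (by omega) h (row_succ.2 hw)
            omega
          have aux : ∀ q, q ∈ Strip K b (l + 1) → q ∉ {z | (b ^ l)⁻¹ * z ∈ K} → L (Adj1 A b) w q → q = w * b⁻¹ := by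
            intro q hq1 hqW hr
            rcases hr with h | h | h
            · exfalso; apply hqW
              have := (row_mul (b := b) (z := w) (i := l) (hK.sub h)).2 hw
              simpa using this
            · exfalso; apply hnb
              have h' : q = w * b := inv_mul_eq_iff_eq_mul.1 h
              exact h' ▸ hq1
            · rw [Set.mem_singleton_iff] at h
              exact inv_mul_eq_iff_eq_mul.1 h
          apply hpq
          rw [aux p hp1 hpW (L_symm (Adj1_symm hK.symm b) _ _ r1), aux q hq1 hqW r2]
    · intro u hu v hv huW hvW hr
      have huv : u⁻¹ * v ∈ K := by
        have := K.mul_mem (K.inv_mem huW) hvW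
        simpa [mul_assoc] using this
      have hA : u⁻¹ * v ∈ A := by
        rcases hr with h | h | h
        · exact h
        · exact absurd (h ▸ huv) hbK
        · rw [Set.mem_singleton_iff] at h
          exact absurd (K.inv_mem (h ▸ huv)) (by simpa using hbK)
      have h1 := ((hK.path _ hA).monoL (Adj1_sub A b)).trl (u * b)
      refine ⟨u * b, v * b, ?_, L_right _ (mem_Adj1 A b), ?_⟩
      · have e : u * b * (u⁻¹ * v) = v * b := by
          exact Additive.ofMul.injective (by simp only [ofMul_mul, ofMul_inv, ofMul_pow]; abel)
        rw [mul_one, e] at h1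
        refine h1.congr ?_
        ext z
        simp only [Set.mem_ofPred_eq, SetLike.mem_coe]
        have h2 : (b ^ (l + 1))⁻¹ * (u * b) ∈ K := row_succ.2 huW
        have e2 : (b ^ (l + 1))⁻¹ * z = ((b ^ (l + 1))⁻¹ * (u * b)) * ((u * b)⁻¹ * z) := by
          simp [mul_assoc]
        rw [e2]; exact (K.mul_mem_cancel_left h2).symm
      · have := L_right (A := Adj1 A b) (v * b) (inv_mem_Adj1 A b)
        simpa using this
    · rw [Set.disjoint_left]
      rintro z ⟨i, hi, h⟩ h'
      have := hf.row_unique (by omega) (by omega) h h'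
      omega
  · -- y in the last row
    obtain ⟨i, hi, hyi⟩ := hy
    have hi' : i = l + 1 := by
      by_contra h; exact hyl ⟨i, by omega, hyi⟩
    subst hi'
    have hwi := row_succ'.1 hyi
    set w := y * b⁻¹ with hw
    have hyw : y = w * b := by simp [hw]
    obtain ⟨z, hzK, hzw, hxz, hcz⟩ : ∃ z ∈ K, z ≠ w ∧ EP (L (Adj1 A b)) (K : Set G) x z ∧
        (bip → c z ≠ c w) := by
      obtain ⟨a, ha⟩ := hK.ne
      have h1 := ((hK.path a ha).monoL (Adj1_sub A b)).trl x
      rw [coset_eq K hx, mul_one] at h1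
      by_cases hb : bip
      · have hcw : c y = c w + 1 := by
          rw [hyw]; exact cdef_zero.1 ((hc hb).col l (by omega) w hwi)
        have hca : c (x * a) = c x + 1 :=
          cdef_zero.1 ((hc hb).row x ⟨0, by omega, by simpa using hx⟩ a ha)
        have h2 := zmod2_ne.1 (hcol hb)
        have h3 : c (x * a) ≠ c w := by rw [zmod2_ne]; grind
        exact ⟨x * a, K.mul_mem hx (hK.sub ha), fun h => h3 (by rw [h]), h1, fun _ => h3⟩
      · by_cases hl0 : l = 0
        · subst hl0
          obtain ⟨z, h1, h2, h3⟩ := hz (by omega) hb x hx w (by simpa using hwi)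
          exact ⟨z, h1, h2, h3, fun h => absurd h hb⟩
        · refine ⟨x * a, K.mul_mem hx (hK.sub ha), ?_, h1, fun h => absurd h hb⟩
          rintro h
          have := hf.row_unique (i := l) (j := 0) (by omega) (by omega) hwi (by
            rw [← h]; simpa using K.mul_mem hx (hK.sub ha))
          omega
    have h1 := (ih z hzK w ⟨l, by omega, hwi⟩ hzw hcz).trl b
    have h2 := hxz.append (z := b * z) (by rw [mul_comm]; exact L_right _ (mem_Adj1 A b)) h1
      (Strip_disj hf)
    rw [mul_comm b w, ← hyw] at h2
    refine h2.congr ?_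
    rw [Strip_succ K b (l + 1)]

end grp
end HamSp


/-! Part 5 -/
set_option linter.unusedSectionVars false
set_option linter.unusedSimpArgs false
set_option linter.unusedVariables false

namespace HamSp
section grp
variable {G : Type*} [CommGroup G] [Finite G]

/-- Hamilton connectedness of the subgroup `K` -/
def HCn (S : Set G) (K : Subgroup G) : Prop :=
  (∀ w : G, ∃ z ∈ K, z ≠ 1 ∧ z ≠ w) ∧ ∀ y ∈ K, y ≠ 1 → EP (L S) (K : Set G) 1 y

/-- Hamilton laceability of the subgroup `K` -/
def HCb (S : Set G) (K : Subgroup G) (c : G → ZMod 2) : Prop :=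
  (∀ z ∈ K, ∀ t ∈ S, t ∈ K → c (z * t) = c z + 1) ∧
    ∀ y ∈ K, c y ≠ c 1 → EP (L S) (K : Set G) 1 y

structure Kit (S A : Set G) (K : Subgroup G) (bip : Prop) (l0 : ℕ) : Prop where
  re : RE K A
  sub : A ⊆ S
  pos : 1 ≤ l0
  shc : ∀ b ∈ S, b ∉ K → ∀ c l, l0 ≤ l → l ≤ idx K b → (bip → ZS (cdef c) A K b l) →
    SHC (Adj1 A b) K b l bip c

/-- `c` behaves like a translate of a character along paths -/
theorem col_path {B : Set G} {c : G → ZMod 2} {U : Set G} {x y g : G} (h : EP (L B) U x y)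
    (h1 : ∀ z ∈ U, ∀ a ∈ B, z * a ∈ U → c (z * a) = c z + 1)
    (h2 : ∀ z ∈ U, ∀ a ∈ B, z * a ∈ U → c (g * z * a) = c (g * z) + 1) :
    c (g * x) + c x = c (g * y) + c y := by
  induction h with
  | single x => rfl
  | @cons U x y z hx hr hp ih =>
    have ih := ih (fun z hz a ha hza => h1 z (by simp [hz]) a ha (by simp [hza]))
      (fun z hz a ha hza => h2 z (by simp [hz]) a ha (by simp [hza]))
    rw [← ih]
    have e : x * (x⁻¹ * y) = y := by simp
    have e' : g * x * (x⁻¹ * y) = g * y := by simp [mul_assoc]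
    have k1 := h1 x (by simp) _ hr (by rw [e]; simp [hp.mem_left])
    have k2 := h2 x (by simp) _ hr (by rw [e]; simp [hp.mem_left])
    rw [e] at k1
    rw [e'] at k2
    grind

/-- translation invariance of colourings on a subgroup -/
theorem col_sub {B : Set G} {K : Subgroup G} {A : Set G} (hK : RE K A) {c : G → ZMod 2}
    (hc : ∀ z ∈ K, ∀ a ∈ A, c (z * a) = c z + 1) :
    ∀ g ∈ K, ∀ z ∈ K, c (g * z) = c g + c z + c 1 := by
  intro g hg z hz
  have key : ∀ z ∈ K, c (g * 1) + c 1 = c (g * z) + c z := by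
    intro z hz
    by_cases h1 : z = 1
    · subst h1; rfl
    obtain ⟨a, ha⟩ := hK.ne
    obtain ⟨U1, U2, y', e, hd, p1, hr, p2⟩ := (hK.path a ha).split hz h1
    have hU1 : ∀ w ∈ U1, w ∈ K := fun w hw => by
      have : w ∈ (K : Set G) := e ▸ Or.inl hw
      exact this
    have hy' : y' ∈ K := hU1 _ p1.mem_right
    have k1 := col_path (g := g) p1 (fun z hz a ha _ => hc z (hU1 z hz) a ha)
      (fun z hz a ha _ => hc _ (K.mul_mem hg (hU1 z hz)) a ha)
    have e : y' * (y'⁻¹ * z) = z := by simp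
    have e' : g * y' * (y'⁻¹ * z) = g * z := by simp [mul_assoc]
    have k2 := hc y' hy' _ hr
    have k3 := hc (g * y') (K.mul_mem hg hy') _ hr
    rw [e] at k2
    rw [e'] at k3
    rw [k1]
    grind
  have := key z hz
  rw [mul_one] at this
  grind

theorem row_zero {K : Subgroup G} {b z : G} : (b ^ 0)⁻¹ * z ∈ K ↔ z ∈ K := by simp

/-- translation of strips by elements of `K` -/
theorem col_strip {K : Subgroup G} {A : Set G} (hK : RE K A) {b : G} {l : ℕ} {c : G → ZMod 2}
    (hc : ZS (cdef c) A K b l) :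
    ∀ g ∈ K, ∀ i < l, ∀ z, (b ^ i)⁻¹ * z ∈ K → c (g * z) = c g + c z + c 1 := by
  intro g hg i
  induction i with
  | zero =>
    intro hi z hz
    exact col_sub (B := A) hK (fun z hz a ha => cdef_zero.1 (hc.row z ⟨0, hi, row_zero.2 hz⟩ a ha)) g hg z
      (row_zero.1 hz)
  | succ i ih =>
    intro hi z hz
    have hz' := row_succ'.1 hz
    have h1 := cdef_zero.1 (hc.col i hi _ hz')
    have hz'' : (b ^ i)⁻¹ * (g * (z * b⁻¹)) ∈ K := by
      rw [mul_comm g, row_mul hg]; exact hz'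
    have h2 := cdef_zero.1 (hc.col i hi _ hz'')
    have h3 := ih (by omega) _ hz'
    rw [inv_mul_cancel_right] at h1
    rw [mul_assoc, inv_mul_cancel_right] at h2
    grind

theorem Strip_split (K : Subgroup G) (b : G) {l lo : ℕ} (h : lo ≤ l) :
    Strip K b lo ∪ {z | (b ^ lo)⁻¹ * z ∈ Strip K b (l - lo)} = Strip K b l := by
  have e : ∀ i z, (b ^ i)⁻¹ * ((b ^ lo)⁻¹ * z) = (b ^ (lo + i))⁻¹ * z := by
    intro i z
    rw [pow_add]
    exact Additive.ofMul.injective (by simp only [ofMul_mul, ofMul_inv, ofMul_pow]; abel)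
  ext z
  simp only [Strip, Set.mem_union, Set.mem_ofPred_eq, e]
  constructor
  · rintro (⟨i, hi, h'⟩ | ⟨i, hi, h'⟩)
    · exact ⟨i, by omega, h'⟩
    · exact ⟨_, by omega, h'⟩
  · rintro ⟨i, hi, h'⟩
    by_cases hlo : i < lo
    · exact Or.inl ⟨i, hlo, h'⟩
    · refine Or.inr ⟨i - lo, by omega, ?_⟩
      rwa [Nat.add_sub_cancel' (by omega)]

theorem Strip_split_disj {K : Subgroup G} {b : G} {l lo : ℕ} (hf : Free K b l) (h : lo ≤ l) :
    Disjoint (Strip K b lo) {z | (b ^ lo)⁻¹ * z ∈ Strip K b (l - lo)} := by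
  have e : ∀ i z, (b ^ i)⁻¹ * ((b ^ lo)⁻¹ * z) = (b ^ (lo + i))⁻¹ * z := by
    intro i z
    rw [pow_add]
    exact Additive.ofMul.injective (by simp only [ofMul_mul, ofMul_inv, ofMul_pow]; abel)
  rw [Set.disjoint_left]
  rintro z ⟨i, hi, h1⟩ ⟨j, hj, h2⟩
  rw [e] at h2
  have := hf.row_unique (by omega) (by omega) h1 h2
  omega

/-- shifted version of `SHC` -/
theorem Kit.shc_shift {S A : Set G} {K : Subgroup G} {bip : Prop} {l0 : ℕ} (k : Kit S A K bip l0)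
    {b : G} (hbS : b ∈ S) (hbK : b ∉ K) {c : G → ZMod 2} {n lo : ℕ} (hn : n ≤ idx K b)
    (hlo : lo ≤ n) (hl : l0 ≤ n - lo) (hc : bip → ZS (cdef c) A K b n) {x y : G} {j : ℕ}
    (hx : (b ^ lo)⁻¹ * x ∈ K) (hj : lo ≤ j) (hjn : j < n) (hy : (b ^ j)⁻¹ * y ∈ K) (hxy : x ≠ y)
    (hcol : bip → c x ≠ c y) :
    EP (L (Adj1 A b)) {z | (b ^ lo)⁻¹ * z ∈ Strip K b (n - lo)} x y := by
  have e : ∀ i z, (b ^ (lo + i))⁻¹ * (b ^ lo * z) = (b ^ i)⁻¹ * z := by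
    intro i z
    rw [pow_add]
    exact Additive.ofMul.injective (by simp only [ofMul_mul, ofMul_inv, ofMul_pow]; abel)
  have h := k.shc b hbS hbK (fun z => c (b ^ lo * z)) (n - lo) hl (by omega) ?_ _ hx
    ((b ^ lo)⁻¹ * y) ⟨j - lo, by omega, ?_⟩ (by simpa using hxy) (by simpa using hcol)
  · simpa using h.trl (b ^ lo)
  · intro hb
    have hc := hc hb
    constructor
    · rintro z ⟨i, hi, hz⟩ a ha
      have := hc.row (b ^ lo * z) ⟨lo + i, by omega, by rwa [e]⟩ a ha
      simpa [cdef, mul_assoc] using this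
    · intro i hi z hz
      have := hc.col (lo + i) (by omega) (b ^ lo * z) (by rwa [e])
      simpa [cdef, mul_assoc] using this
  · rw [← e]; simpa [Nat.add_sub_cancel' hj] using hy

theorem full_strip {S A : Set G} {K : Subgroup G} {bip : Prop} {l0 : ℕ} (k : Kit S A K bip l0)
    (hS : Sy S) {b : G} (hbS : b ∈ S) (hbK : b ∉ K) {c : G → ZMod 2} (hl : l0 ≤ idx K b)
    (hc : bip → ZS (cdef c) A K b (idx K b)) {x y : G} (hx : x ∈ K) (hy : y ∈ ext K b) (hxy : x ≠ y)
    (hcol : bip → c x ≠ c y) : EP (L S) (ext K b : Set G) x y := by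
  have := k.shc b hbS hbK c _ hl le_rfl hc x hx y (by rw [Strip_full]; exact hy) hxy hcol
  rw [Strip_full] at this
  exact this.monoL (Adj1_subS k.sub hbS hS)

theorem ext_three {K : Subgroup G} {A : Set G} (hK : RE K A) {b : G} (hb : b ∉ K) (w : G) :
    ∃ z ∈ ext K b, z ≠ 1 ∧ z ≠ w := by
  obtain ⟨a, ha⟩ := hK.ne
  have ha' := hK.sub ha
  by_cases h : w = a
  · refine ⟨b, mem_ext K b, fun h => hb (h ▸ K.one_mem), fun h' => hb ?_⟩
    rw [h', h]; exact ha'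
  · exact ⟨a, le_ext K b ha', fun h => hK.one (h ▸ ha), fun h' => h h'.symm⟩

theorem hc_nonbip {S A : Set G} {K : Subgroup G} {bip : Prop} {l0 : ℕ} (k : Kit S A K bip l0)
    (hS : Sy S) {b : G} (hbS : b ∈ S) (hbK : b ∉ K) (hl : l0 ≤ 2) (hb : ¬ bip) :
    HCn S (ext K b) :=
  ⟨ext_three k.re hbK, fun y hy h1 => full_strip k hS hbS hbK (c := 0) (hl.trans (idx_two hbK))
    (fun h => absurd h hb) K.one_mem hy (Ne.symm h1) (fun h => absurd h hb)⟩

theorem hc_bad_out {S A : Set G} {K : Subgroup G} {bip : Prop} {l0 : ℕ} (k : Kit S A K bip l0)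
    (hS : Sy S) {b : G} (hbS : b ∈ S) (hbK : b ∉ K) {c : G → ZMod 2}
    (hc : ZS (cdef c) A K b (idx K b)) {t0 y : G} {i0 i : ℕ} (ht0 : t0 ∈ S)
    (hi0 : 1 ≤ i0) (hi0n : i0 < idx K b) (hti : (b ^ i0)⁻¹ * t0 ∈ K) (htc : c t0 = c 1)
    (hi : 1 ≤ i) (hin : i < idx K b) (hyi : (b ^ i)⁻¹ * y ∈ K) (hyc : c y = c 1)
    (hl : l0 + min i0 i ≤ idx K b) : EP (L S) (ext K b : Set G) 1 y := by
  obtain ⟨a, ha⟩ := k.re.ne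
  have haK := k.re.sub ha
  have hca : c a = c 1 + 1 := by
    have := cdef_zero.1 (hc.row 1 ⟨0, by omega, by simp⟩ a ha)
    simpa using this
  have hcat : c (a * t0) = c 1 + 1 := by
    have := col_strip k.re hc a haK i0 hi0n t0 hti
    rw [this, hca, htc]; grind
  have hne : a * t0 ≠ y := by
    intro h; rw [h] at hcat; grind
  have hrow : (b ^ i0)⁻¹ * (a * t0) ∈ K := by rw [mul_comm a, row_mul haK]; exact hti
  have hsub := Adj1_subS k.sub hbS hS
  have key : EP (L S) {z | (b ^ (min i0 i))⁻¹ * z ∈ Strip K b (idx K b - min i0 i)} (a * t0) y := by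
    rcases le_total i0 i with h | h
    · have := k.shc_shift hbS hbK (c := c) (n := idx K b) (lo := min i0 i) le_rfl (by omega) (by omega) (fun _ => hc)
        (x := a * t0) (y := y) (j := i) (by rw [min_eq_left h]; exact hrow) (by omega) hin hyi hne
        (fun _ => by rw [hcat, hyc]; simp)
      exact this.monoL hsub
    · have := k.shc_shift hbS hbK (c := c) (n := idx K b) (lo := min i0 i) le_rfl (by omega) (by omega) (fun _ => hc)
        (x := y) (y := a * t0) (j := i0) (by rw [min_eq_right h]; exact hyi) (by omega) hi0n hrow hne.symm
        (fun _ => by rw [hcat, hyc]; simp)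
      exact (this.monoL hsub).reverse (L_symm hS)
  obtain ⟨lo', hlo'⟩ : ∃ lo', min i0 i = lo' + 1 := ⟨min i0 i - 1, by omega⟩
  have h1 := fat k.re k.sub hbS (hS _ hbS) lo' ((free_idx K b).mono (by omega)) a ha
  rw [← hlo'] at h1
  have := h1.append (L_right a ht0) key (Strip_split_disj (free_idx K b) (by omega))
  rwa [Strip_split K b (by omega), Strip_full] at this

theorem hc_bad_in {S A : Set G} {K : Subgroup G} {bip : Prop} {l0 : ℕ} (k : Kit S A K bip l0)
    (hS : Sy S) {b : G} (hbS : b ∈ S) (hbK : b ∉ K) {c : G → ZMod 2}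
    (hc : ZS (cdef c) A K b (idx K b)) {t0 y : G} {i0 : ℕ} (ht0 : t0 ∈ S)
    (hi0 : 1 ≤ i0) (hi0n : i0 < idx K b) (hti : (b ^ i0)⁻¹ * t0 ∈ K) (htc : c t0 = c 1)
    (hy : y ∈ K) (hy1 : y ≠ 1) (hyc : c y = c 1)
    (hl : l0 + 1 ≤ idx K b) : EP (L S) (ext K b : Set G) 1 y := by
  obtain ⟨a, ha⟩ := k.re.ne
  have haK := k.re.sub ha
  have hsub := Adj1_subS k.sub hbS hS
  have hrowc : ∀ z ∈ K, ∀ a ∈ A, c (z * a) = c z + 1 := fun z hz a ha =>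
    cdef_zero.1 (hc.row z ⟨0, by omega, by simpa using hz⟩ a ha)
  have hca : c a = c 1 + 1 := by
    have := hrowc 1 K.one_mem a ha
    simpa using this
  obtain ⟨U1, U2, y', e, hd, p1, hr, p2⟩ := (k.re.path a ha).split hy hy1
  have hU1 : ∀ w ∈ U1, w ∈ K := fun w hw => by
    have : w ∈ (K : Set G) := e ▸ Or.inl hw
    exact this
  have hU2 : ∀ w ∈ U2, w ∈ K := fun w hw => by
    have : w ∈ (K : Set G) := e ▸ Or.inr hw
    exact this
  have hy' := hU1 _ p1.mem_right
  have hcy' : c y' = c 1 + 1 := by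
    have := hrowc y' hy' _ hr
    rw [mul_inv_cancel_left] at this
    grind
  have hcyt : c (y' * t0) = c 1 + 1 := by
    have := col_strip k.re hc y' hy' i0 hi0n t0 hti
    rw [this, hcy', htc]; grind
  have hcab : c (a * b) = c 1 := by
    have := cdef_zero.1 (hc.col 0 (by have := idx_two hbK; omega) a (by simpa using haK))
    grind
  have h3 := k.shc_shift hbS hbK (c := c) (n := idx K b) (lo := 1) le_rfl (by omega) (by omega) (fun _ => hc)
    (x := a * b) (y := y' * t0) (j := i0) (by rw [row_succ (i := 0)]; simpa using haK) hi0 hi0n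
    (by rw [mul_comm y', row_mul hy']; exact hti) (by intro h; rw [h] at hcab; grind)
    (fun _ => by rw [hcyt, hcab]; simp)
  have h3 := (h3.monoL hsub).reverse (L_symm hS)
  have hdisj := Strip_split_disj (free_idx K b) (lo := 1) (by omega)
  rw [Strip_one, Set.disjoint_left] at hdisj
  have h4 := h3.append (z := a) (by
    have := L_right (A := S) (a * b) (hS _ hbS); simpa using this)
    ((p2.monoL k.sub).reverse (L_symm hS)) (by
      rw [Set.disjoint_right]; intro z hz; exact hdisj (hU2 z hz))
  have h5 := (p1.monoL k.sub).append (L_right y' ht0) h4 (by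
    rw [Set.disjoint_union_right]
    exact ⟨by rw [Set.disjoint_left]; intro z hz; exact hdisj (hU1 z hz), hd⟩)
  refine h5.congr ?_
  rw [← Strip_full, ← Strip_split K b (lo := 1) (l := idx K b) (by omega), Strip_one, e]
  ext z; simp only [Set.mem_union]; tauto

theorem ext_top {K : Subgroup G} {b t0 : G} (ht : t0 ∈ ext K b) (hbt : b ∈ ext K t0) :
    ext K t0 = ext K b := by
  apply le_antisymm
  · exact sup_le (le_ext K b) (by rwa [Subgroup.zpowers_le])
  · exact sup_le (le_ext K t0) (by rwa [Subgroup.zpowers_le])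

/-- `y` and `t0` in the same row, which generates -/
theorem hc_bad_top {S A : Set G} {K : Subgroup G} {l0 : ℕ} (k : Kit S A K True l0)
    (hS : Sy S) {b : G} (hbS : b ∈ S) (hbK : b ∉ K) {c : G → ZMod 2}
    (hc : ZS (cdef c) A K b (idx K b)) {t0 y : G} (ht0 : t0 ∈ S)
    (hti : (b ^ (idx K b - 1))⁻¹ * t0 ∈ K) (htc : c t0 = c 1)
    (hyi : (b ^ (idx K b - 1))⁻¹ * y ∈ K) (hyc : c y = c 1) (hl : l0 ≤ 2) :
    EP (L S) (ext K b : Set G) 1 y := by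
  have hn := idx_two hbK
  have ht : t0 ∈ ext K b := mem_ext_iff.2 ⟨_, by omega, hti⟩
  have hbt0 : b * t0 ∈ K := by
    have h1 : b ^ idx K b ∈ K := (pow_mem_iff K b _).2 (dvd_refl _)
    have h2 := K.mul_mem h1 hti
    have e : b ^ idx K b = b * b ^ (idx K b - 1) := by rw [← pow_succ']; congr 1; omega
    rw [e] at h2
    simpa [mul_assoc] using h2
  have htK : t0 ∉ K := fun h => hbK (by simpa using K.mul_mem hbt0 (K.inv_mem h))
  have he : ext K t0 = ext K b := by
    apply ext_top ht
    have := (ext K t0).mul_mem (le_ext K t0 hbt0) ((ext K t0).inv_mem (mem_ext K t0))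
    simpa using this
  have hky : t0⁻¹ * y ∈ K := by
    have := K.mul_mem (K.inv_mem hti) hyi
    simpa [mul_assoc] using this
  have hrowc : ∀ z ∈ K, ∀ a ∈ A, cdef c z (z * a) = 0 := fun z hz a ha =>
    hc.row z ⟨0, by omega, by simpa using hz⟩ a ha
  have hm := idx_two htK
  obtain ⟨φ, hφ, hz⟩ := rowGauge (S := S) (Fl.cdef S c) k.re.sub k.sub ht0 htK hrowc (idx K t0 - 1)
    (by rw [Nat.sub_add_cancel (by omega)]; exact free_idx K t0)
  rw [Nat.sub_add_cancel (by omega)] at hz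
  have e1 : gau (cdef c) φ = cdef (fun z => c z + φ z) := by
    funext x y; simp only [gau, cdef]; ring
  rw [e1] at hz
  rw [← he]
  have hk1 : c (t0⁻¹ * y) = c 1 := by
    have := col_strip k.re hc _ hky _ (by omega) t0 hti
    rw [mul_comm _ t0, mul_inv_cancel_left, hyc, htc] at this
    grind
  have hcy := cdef_zero.1 (hz.col 0 (by omega) (t0⁻¹ * y) (by simpa using hky))
  simp only [mul_comm (t0⁻¹ * y) t0, mul_inv_cancel_left, hφ _ hky, hk1, hφ 1 K.one_mem] at hcy
  refine full_strip k hS ht0 htK (hl.trans hm) (fun _ => hz) K.one_mem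
    (he ▸ mem_ext_iff.2 ⟨_, by omega, hyi⟩) ?_ ?_
  · rintro rfl
    exact htK (by simpa using K.inv_mem hky)
  · intro _
    rw [hφ 1 K.one_mem, hcy]; simp

end grp
end HamSp


/-! Part 6 -/
set_option linter.unusedSectionVars false
set_option linter.unusedSimpArgs false
set_option linter.unusedVariables false

namespace HamSp

theorem gridR3 {R : ℤ × ℤ → ℤ × ℤ → Prop} (m : ℤ) (hR : ∀ p q, GR m p q → R p q) (d k : ℤ)
    (hR' : ∀ j, R (1, j) (0, j - k)) (hk : 0 < k) (hkd : k < d) (hd : d + 1 < m)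
    (hpar : Odd (d - k)) :
    EP R {p : ℤ × ℤ | (0 ≤ p.1 ∧ p.1 < 2) ∧ 0 ≤ p.2 ∧ p.2 < m} (0, 0) (0, d) := by
  obtain ⟨j, hj⟩ := hpar
  have h1 := (gridBack m hR d hd (by omega)).append (hR _ (1, 0) (by simp [GR]))
    (hsegZ m hR 1 0 0 le_rfl) (by rw [Set.disjoint_left]; rintro ⟨a, b⟩; simp; omega)
  have h2 : EP R {p : ℤ × ℤ | p = (0, 0) ∨ p = (1, 0) ∨ (p.1 = 0 ∨ p.1 = 1) ∧ d + 1 ≤ p.2 ∧ p.2 ≤ m - 1 ∨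
      (p.1 = 0 ∨ p.1 = 1) ∧ 1 ≤ p.2 ∧ p.2 ≤ 2 * j} (0, 0) (1, 2 * j) := by
    by_cases hj0 : j = 0
    · subst hj0
      refine h1.congr ?_
      ext ⟨a, b⟩; simp; omega
    · obtain ⟨i, rfl⟩ : ∃ i : ℕ, j = i + 1 := by
        obtain ⟨i, hi⟩ := Int.eq_ofNat_of_zero_le (show 0 ≤ j - 1 by omega)
        exact ⟨i, by omega⟩
      have := h1.append (hR (1, 0) (1, 1) (by simp [GR])) (zz m hR 1 0 1 (by simp) i)
        (by rw [Set.disjoint_left]; rintro ⟨a, b⟩; simp; omega)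
      rw [show (1 : ℤ) + 2 * i + 1 = 2 * (i + 1) by ring] at this
      refine this.congr ?_
      ext ⟨a, b⟩; simp; omega
  have h3 := h2.append (hR _ (1, 2 * j + 1) (by simp [GR])) (hsegZ m hR 1 (2 * j + 1) d (by omega))
    (by rw [Set.disjoint_left]; rintro ⟨a, b⟩; simp; omega)
  have hj' := hR' d
  rw [hj] at hj'
  have h4 := h3.append hj' (hsegZ m hR 0 (2 * j + 1) d (by omega))
    (by rw [Set.disjoint_left]; rintro ⟨a, b⟩; simp; omega)
  refine h4.congr ?_
  ext ⟨a, b⟩; simp; omega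

section grp
variable {G : Type*} [CommGroup G] [Finite G]

theorem hc_bad_cyc_aux {S : Set G} (hS : Sy S) {s b : G} (hs : s ∈ S) (hb : b ∈ S)
    (hf : Free (Subgroup.zpowers s) b 2) {d k : ℤ} (ht : b * s ^ k ∈ S)
    (hk : 0 < k) (hkd : k < d) (hd : d + 1 < orderOf s) (hpar : Odd (d - k)) :
    EP (L S) (Strip (Subgroup.zpowers s) b 2) 1 (s ^ d) := by
  have hL := cy_L (b := b) (s := s) (B := S) hs (hS _ hs) hb (hS _ hb)
  have := gridmap (l := 2) (R := fun p q => L S (cy b s p) (cy b s q)) (fun _ _ h => h) hf 0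
    (by simpa using gridR3 (orderOf s) hL d k (by
      intro j
      have := hS _ ht
      have e : (cy b s (1, j))⁻¹ * cy b s (0, j - k) = (b * s ^ k)⁻¹ := by
        simp only [cy, zpow_sub, zpow_one, zpow_zero, one_mul]
        exact Additive.ofMul.injective (by simp only [ofMul_mul, ofMul_inv, ofMul_zpow]; abel)
      show _ ∈ S
      rwa [e]) hk hkd hd hpar)
  simpa [cy] using this

theorem hc_bad_cyc {S : Set G} (hS : Sy S) {s b : G} (hs : s ∈ S) (hb : b ∈ S)
    (hf : Free (Subgroup.zpowers s) b 2) {d k : ℤ} (ht : b * s ^ k ∈ S) (hm : Even (orderOf s))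
    (hk : 0 < k) (hkm : k < orderOf s) (hd0 : 0 < d) (hd : d < orderOf s) (ho : Odd k) (he : Even d) :
    EP (L S) (Strip (Subgroup.zpowers s) b 2) 1 (s ^ d) := by
  obtain ⟨r, hr⟩ := he
  obtain ⟨j, hj⟩ := ho
  obtain ⟨q, hq⟩ := hm
  by_cases hkd : k < d
  · exact hc_bad_cyc_aux hS hs hb hf ht hk hkd (by omega) ⟨r - j - 1, by omega⟩
  · have hinv : ∀ i : ℤ, s⁻¹ ^ ((orderOf s : ℤ) - i) = s ^ i := by
      intro i
      rw [inv_zpow', neg_sub, zpow_sub, zpow_natCast, pow_orderOf_eq_one]; simp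
    have := hc_bad_cyc_aux (s := s⁻¹) (d := orderOf s - d) (k := orderOf s - k) hS (hS _ hs) hb
      (by simpa using hf) (by rwa [hinv]) (by omega) (by omega) (by simp; omega)
      ⟨k - r - j - 1, by omega⟩
    rwa [hinv, Subgroup.zpowers_inv] at this

theorem RE.induct {K : Subgroup G} {A : Set G} (hK : RE K A) {P : G → Prop} (h1 : P 1)
    (hs : ∀ z ∈ K, ∀ a ∈ A, P z → P (z * a)) : ∀ z ∈ K, P z := by
  intro z hz
  by_cases hz1 : z = 1
  · rwa [hz1]
  have aux : ∀ {U : Set G} {x y : G}, EP (L A) U x y → U ⊆ K → P x → P y := by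
    intro U x y h
    induction h with
    | single x => exact fun _ h => h
    | @cons U x y z hx hr hp ih =>
      intro hU hPx
      apply ih (fun w hw => hU (by simp [hw]))
      have := hs x (hU (by simp)) _ hr hPx
      simpa using this
  obtain ⟨a, ha⟩ := hK.ne
  obtain ⟨U1, U2, y', e, hd, p1, hr, p2⟩ := (hK.path a ha).split hz hz1
  have hU1 : U1 ⊆ K := by rw [e]; exact Set.subset_union_left
  have := hs y' (hU1 p1.mem_right) _ hr (aux p1 hU1 h1)
  simpa using this

theorem col_unique {K : Subgroup G} {A : Set G} (hK : RE K A) {c c' : G → ZMod 2}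
    (hc : ∀ z ∈ K, ∀ a ∈ A, c (z * a) = c z + 1) (hc' : ∀ z ∈ K, ∀ a ∈ A, c' (z * a) = c' z + 1) :
    ∀ z ∈ K, c z + c 1 = c' z + c' 1 := by
  refine hK.induct (P := fun z => c z + c 1 = c' z + c' 1) ?_ ?_
  · grind
  · intro z hz a ha h
    rw [hc z hz a ha, hc' z hz a ha]; grind

theorem shc_from {A : Set G} {K : Subgroup G} (hK : RE K A) {b : G} {l0 : ℕ} (hl0 : 1 ≤ l0)
    {bip : Prop} {c : G → ZMod 2}
    (hz : l0 = 1 → ¬ bip → ∀ x ∈ K, ∀ w ∈ K, ∃ z ∈ K, z ≠ w ∧ EP (L (Adj1 A b)) K x z)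
    (ih : (bip → ZS (cdef c) A K b l0) → SHC (Adj1 A b) K b l0 bip c) (l : ℕ) (hl : l0 ≤ l)
    (hf : Free K b l) (hc : bip → ZS (cdef c) A K b l) :
    SHC (Adj1 A b) K b l bip c := by
  induction l, hl using Nat.le_induction with
  | base => exact ih hc
  | succ l hl ih' =>
    refine shc_step hK (by omega) hf hc (fun h => hz (by omega)) (ih' (hf.mono (by omega)) ?_)
    exact fun h => (hc h).mono (by omega)

theorem kit_cyc {S : Set G} (hS : Sy S) {s : G} (hs : s ∈ S) (hm : 3 ≤ orderOf s) :
    Kit S {s, s⁻¹} (Subgroup.zpowers s) (Even (orderOf s)) 2 where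
  re := RE_single (by rintro rfl; simp at hm)
  sub := by rintro a (h | h) <;> subst h; exacts [hs, hS _ hs]
  pos := by omega
  shc := by
    intro b hbS hbK c l hl hlb hc
    refine shc_from (RE_single (by rintro rfl; simp at hm)) (by omega) (by omega) (fun hc => ?_) l hl
      ((free_idx _ _).mono hlb) hc
    exact shc_cyc2 hm ((free_idx _ _).mono (idx_two hbK)) (by
      rcases Nat.even_or_odd (orderOf s) with h | h
      · exact Or.inr h
      · exact Or.inl h) hc

theorem EP.restrict {S U : Set G} {K : Subgroup G} {x y : G} (h : EP (L S) U x y) (hU : U ⊆ K) :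
    EP (L (S ∩ K)) U x y :=
  h.mono (fun a ha b hb hr => ⟨hr, K.mul_mem (K.inv_mem (hU ha)) (hU hb)⟩)

theorem re_n {S : Set G} (hS : Sy S) (h1 : (1 : G) ∉ S) {K : Subgroup G} (h : HCn S K) :
    RE K (S ∩ K) where
  sub := Set.inter_subset_right
  symm := fun a ha => ⟨hS _ ha.1, K.inv_mem ha.2⟩
  ne := by
    obtain ⟨z, hz, hz1, _⟩ := h.1 1
    obtain ⟨z', V, e, hV, hr, hp⟩ := (EP.restrict (h.2 z hz hz1) subset_rfl).first (Ne.symm hz1)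
    exact ⟨_, hr⟩
  one := fun h => h1 h.1
  path := fun a ha => EP.restrict (h.2 a ha.2 (fun h => h1 (h ▸ ha.1))) subset_rfl

theorem re_b {S : Set G} (hS : Sy S) (h1 : (1 : G) ∉ S) {K : Subgroup G} {c : G → ZMod 2} (h : HCb S K c)
    (hne : (S ∩ K).Nonempty) :
    RE K (S ∩ K) where
  sub := Set.inter_subset_right
  symm := fun a ha => ⟨hS _ ha.1, K.inv_mem ha.2⟩
  ne := hne
  one := fun h => h1 h.1
  path := fun a ha => EP.restrict (h.2 a ha.2 (by
    have := h.1 1 K.one_mem a ha.1 ha.2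
    rw [one_mul] at this
    rw [this]; simp)) subset_rfl

theorem trl_in {B : Set G} {K : Subgroup G} {x y : G} (hx : x ∈ K)
    (h : EP (L B) (K : Set G) 1 (x⁻¹ * y)) : EP (L B) (K : Set G) x y := by
  have := h.trl x
  rwa [coset_eq K hx, mul_one, mul_inv_cancel_left] at this

theorem kit_n {S : Set G} (hS : Sy S) (h1 : (1 : G) ∉ S) {K : Subgroup G} (h : HCn S K) :
    Kit S (S ∩ K) K False 1 where
  re := re_n hS h1 h
  sub := Set.inter_subset_left
  pos := le_rfl
  shc := by
    intro b hbS hbK c l hl hlb hc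
    have key : ∀ x ∈ K, ∀ y ∈ K, x ≠ y → EP (L (Adj1 (S ∩ K) b)) (K : Set G) x y := by
      intro x hx y hy hxy
      have := h.2 (x⁻¹ * y) (K.mul_mem (K.inv_mem hx) hy) (by
        intro h; rw [inv_mul_eq_one] at h; exact hxy h)
      exact trl_in hx ((EP.restrict this subset_rfl).monoL (Adj1_sub _ _))
    refine shc_from (re_n hS h1 h) le_rfl (fun _ _ x hx w hw => ?_) (fun _ => ?_) l hl
      ((free_idx _ _).mono hlb) hc
    · obtain ⟨z, hz, hz1, hz2⟩ := h.1 (x⁻¹ * w)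
      refine ⟨x * z, K.mul_mem hx hz, ?_, key _ hx _ (K.mul_mem hx hz) ?_⟩
      · rintro rfl; simp at hz2
      · intro h; exact hz1 (by simpa using h.symm)
    · intro x hx y hy hxy _
      rw [Strip_one] at hy ⊢
      exact key x hx y hy hxy

theorem kit_b {S : Set G} (hS : Sy S) (h1 : (1 : G) ∉ S) {K : Subgroup G} {c0 : G → ZMod 2} (h : HCb S K c0)
    (hne : (S ∩ K).Nonempty) : Kit S (S ∩ K) K True 1 where
  re := re_b hS h1 h hne
  sub := Set.inter_subset_left
  pos := le_rfl
  shc := by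
    intro b hbS hbK c l hl hlb hc
    have hre := re_b hS h1 h hne
    refine shc_from hre le_rfl (fun _ h => absurd trivial h) (fun hc => ?_) l hl
      ((free_idx _ _).mono hlb) hc
    · intro x hx y hy hxy hcol
      rw [Strip_one] at hy ⊢
      have hcol := hcol trivial
      have hrow : ∀ z ∈ K, ∀ a ∈ S ∩ K, c (z * a) = c z + 1 := fun z hz a ha =>
        cdef_zero.1 ((hc trivial).row z (by rw [Strip_one]; exact hz) a ha)
      have hm := K.mul_mem (K.inv_mem hx) hy
      have e1 := col_sub (B := S) hre hrow x hx _ hm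
      rw [mul_inv_cancel_left] at e1
      have e2 := col_unique hre hrow (fun z hz a ha => h.1 z hz a ha.1 ha.2) _ hm
      have e3 : c0 (x⁻¹ * y) ≠ c0 1 := by
        rw [zmod2_ne] at *
        grind
      exact trl_in hx ((EP.restrict (h.2 _ hm e3) subset_rfl).monoL (Adj1_sub _ _))

/-- the alternatives for the current subgroup -/
def KitAlt (S A : Set G) (K : Subgroup G) (bip : Prop) (l0 : ℕ) : Prop :=
  Kit S A K bip l0 ∧ (l0 = 1 ∨ (l0 = 2 ∧ ∃ s, K = Subgroup.zpowers s ∧ A = {s, s⁻¹} ∧ Even (orderOf s)))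

theorem hc_bip_bad {S A : Set G} {K : Subgroup G} {l0 : ℕ} (k : KitAlt S A K True l0)
    (hS : Sy S) {b : G} (hbS : b ∈ S) (hbK : b ∉ K) {c : G → ZMod 2}
    (hc : ZS (cdef c) A K b (idx K b)) {t0 : G} (ht0 : t0 ∈ S) (htE : t0 ∈ ext K b)
    (htK : t0 ∉ K) (htc : c t0 = c 1) : HCn S (ext K b) := by
  obtain ⟨k, halt⟩ := k
  have hl2 : l0 ≤ 2 := by rcases halt with h | ⟨h, _⟩ <;> omega
  have hn := idx_two hbK
  refine ⟨ext_three k.re hbK, fun y hy hy1 => ?_⟩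
  by_cases hcy : c y = c 1
  swap
  · exact full_strip k hS hbS hbK (hl2.trans hn) (fun _ => hc) K.one_mem hy hy1.symm
      (fun _ => Ne.symm hcy)
  obtain ⟨i0, hi0, hti⟩ := mem_ext_iff.1 htE
  obtain ⟨i, hi, hyi⟩ := mem_ext_iff.1 hy
  have hi0' : i0 ≠ 0 := by rintro rfl; exact htK (by simpa using hti)
  by_cases hiz : i = 0
  · subst hiz
    have hyK : y ∈ K := by simpa using hyi
    by_cases hln : l0 + 1 ≤ idx K b
    · exact hc_bad_in k hS hbS hbK hc ht0 (by omega) hi0 hti htc hyK hy1 hcy hln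
    · obtain ⟨h2, s, hKs, hA, hev⟩ : (l0 = 2 ∧ ∃ s, K = Subgroup.zpowers s ∧ A = {s, s⁻¹} ∧ Even (orderOf s)) := by
        rcases halt with h | h
        · omega
        · exact h
      have hn2 : idx K b = 2 := by omega
      have hi01 : i0 = 1 := by omega
      subst hi01
      have hsS : s ∈ S := k.sub (by rw [hA]; simp)
      rw [← Strip_full, hn2, hKs]
      rw [hn2] at hc
      have hrowc : ∀ z ∈ Strip K b 2, c (z * s) = c z + 1 := fun z hz =>
        cdef_zero.1 (hc.row z hz s (by rw [hA]; simp))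
      have hrow : ∀ z, z ∈ Strip K b 2 → z * s ∈ Strip K b 2 := by
        rintro z ⟨j, hj, h⟩
        exact ⟨j, hj, (row_mul (by rw [hKs]; exact Subgroup.mem_zpowers s)).2 h⟩
      have hb1 : c b = c 1 + 1 := by
        have := cdef_zero.1 (hc.col 0 (by omega) 1 (by simp)); simpa using this
      have h1S : (1 : G) ∈ Strip K b 2 := ⟨0, by omega, by simp⟩
      have hbS' : b ∈ Strip K b 2 := ⟨1, by omega, by simp⟩
      have hpow : ∀ z ∈ K, ∃ j : ℕ, j < orderOf s ∧ z = s ^ j := by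
        intro z hz
        classical
        rw [hKs] at hz
        obtain ⟨j, hj⟩ := (mem_zpowers_iff_mem_range_orderOf).1 hz |> Finset.mem_image.1
        exact ⟨j, by simpa using hj.1, hj.2.symm⟩
      obtain ⟨d, hd, rfl⟩ := hpow y hyK
      obtain ⟨e, he, hte⟩ := hpow _ hti
      have hte' : t0 = b * s ^ e := by rw [← hte]; simp
      have c1 := (col_zpow _ hrow hrowc 1 h1S d).2
      have c2 := (col_zpow _ hrow hrowc b hbS' e).2
      rw [one_mul] at c1
      rw [← hte', hb1] at c2
      have hde : (d : ZMod 2) = 0 := by grind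
      have hee : (e : ZMod 2) = 1 := by grind
      rw [ZMod.natCast_eq_zero_iff_even] at hde
      rw [ZMod.natCast_eq_one_iff_odd] at hee
      have hd0 : d ≠ 0 := by rintro rfl; simp at hy1
      have := hc_bad_cyc hS (d := d) (k := e) hsS hbS (by rw [← hKs, ← hn2]; exact free_idx _ _)
        (by rw [zpow_natCast, ← hte']; exact ht0) hev (by have := hee.pos; omega) (by omega) (by omega)
        (by omega) (by exact_mod_cast hee) (by exact_mod_cast hde)
      simpa using this
  · by_cases hlo : l0 + min i0 i ≤ idx K b
    · exact hc_bad_out k hS hbS hbK hc ht0 (by omega) hi0 hti htc (by omega) hi hyi hcy hlo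
    · have e1 : i0 = idx K b - 1 := by omega
      have e2 : i = idx K b - 1 := by omega
      subst e1
      rw [e2] at hyi
      exact hc_bad_top k hS hbS hbK hc ht0 hti htc hyi hcy hl2

/-- translation invariance on the extension when the wrap is good -/
theorem col_ext {S A : Set G} {K : Subgroup G} (hK : RE K A) {b : G} (hbK : b ∉ K) {c : G → ZMod 2}
    (hc : ZS (cdef c) A K b (idx K b))
    (hw : ∀ z, (b ^ (idx K b - 1))⁻¹ * z ∈ K → c (z * b) = c z + 1) :
    ∀ z ∈ ext K b, ∀ a ∈ Adj1 A b, c (z * a) = c z + 1 := by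
  have hb : ∀ z ∈ ext K b, c (z * b) = c z + 1 := by
    intro z hz
    obtain ⟨i, hi, h⟩ := mem_ext_iff.1 hz
    by_cases hi' : i + 1 < idx K b
    · exact cdef_zero.1 (hc.col i hi' z h)
    · have : i = idx K b - 1 := by omega
      exact hw z (this ▸ h)
  rintro z hz a (h | h | h)
  · exact cdef_zero.1 (hc.row z (by rw [Strip_full]; exact hz) a h)
  · rw [h]; exact hb z hz
  · rw [Set.mem_singleton_iff] at h
    have := hb (z * b⁻¹) ((ext K b).mul_mem hz ((ext K b).inv_mem (mem_ext K b)))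
    rw [inv_mul_cancel_right] at this
    rw [h, this]; grind

theorem hc_bip_good {S A : Set G} {K : Subgroup G} {l0 : ℕ} (k : KitAlt S A K True l0)
    (hS : Sy S) {b : G} (hbS : b ∈ S) (hbK : b ∉ K) {c : G → ZMod 2}
    (hc : ZS (cdef c) A K b (idx K b))
    (hw : ∀ z, (b ^ (idx K b - 1))⁻¹ * z ∈ K → c (z * b) = c z + 1)
    (hg : ∀ t ∈ S, t ∈ ext K b → c t ≠ c 1) : HCb S (ext K b) c := by
  obtain ⟨k, halt⟩ := k
  have hl2 : l0 ≤ 2 := by rcases halt with h | ⟨h, _⟩ <;> omega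
  have hn := idx_two hbK
  refine ⟨fun z hz t ht htE => ?_, fun y hy hcy => ?_⟩
  · have := col_sub (B := S) (RE_step k.re hbK) (col_ext (S := S) k.re hbK hc hw) z hz t htE
    have h2 := zmod2_ne.1 (hg t ht htE)
    grind
  · exact full_strip k hS hbS hbK (hl2.trans hn) (fun _ => hc) K.one_mem hy
      (by rintro rfl; exact hcy rfl) (fun _ => Ne.symm hcy)

end grp
end HamSp


/-! Part 7 -/
set_option linter.unusedSectionVars false
set_option linter.unusedSimpArgs false
set_option linter.unusedVariables false

namespace HamSp
section gen
variable {α : Type*} {R R' : α → α → Prop} {f g : α → α → ZMod 2} {U V W : Set α}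
  {x y z w : α} {v v' : ZMod 2}

theorem HP.gauge (h : HP R f U x y v) (φ : α → ZMod 2) :
    HP R (fun a b => f a b + φ a + φ b) U x y (v + φ x + φ y) := by
  induction h with
  | single x =>
    have : (0 : ZMod 2) + φ x + φ x = 0 := by grind
    rw [this]; exact .single x
  | @cons U x y z v h1 h2 h3 ih =>
    have := HP.cons h1 h2 ih
    refine this.congr rfl (by grind)

theorem HP.addc (h : HP R f U x y v) (e : ZMod 2) :
    U.Finite ∧ HP R (fun a b => f a b + e) U x y (v + e * (U.ncard + 1)) := by
  induction h with
  | single x =>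
    refine ⟨Set.finite_singleton x, ?_⟩
    rw [Set.ncard_singleton]
    have : (0 : ZMod 2) + e * ((1 : ℕ) + 1) = 0 := by push_cast; grind
    rw [this]; exact .single x
  | @cons U x y z v h1 h2 h3 ih =>
    refine ⟨ih.1.insert x, ?_⟩
    have := HP.cons h1 h2 ih.2
    refine this.congr rfl ?_
    rw [Set.ncard_insert_of_notMem h1 ih.1]; push_cast; grind

theorem HP.monoR (h : HP R f U x y v) (hR : ∀ a b, R a b → R' a b) : HP R' f U x y v := by
  induction h with
  | single x => exact .single x
  | cons h1 h2 h3 ih => exact .cons h1 (hR _ _ h2) ih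

theorem EP.toHPQ (h : EP (fun a b => R a b ∧ f a b = 0) U x y) : HP R f U x y 0 := by
  have := h.toHP_zero (f := f) (fun a _ b _ h => h.2)
  exact this.monoR (fun a b h => h.1)

theorem HP.trichot (h : HP R f U x y v) : x = y ∨ ∃ z V u, U = insert x V ∧ x ∉ V ∧ R x z ∧
    HP R f V z y u ∧ v = f x z + u := by
  cases h with
  | single x => left; rfl
  | cons h1 h2 h3 => right; exact ⟨_, _, _, rfl, h1, h2, h3, rfl⟩

end gen
section grp
variable {G : Type*} [CommGroup G] [Finite G]

/-- values of Hamilton cycles -/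
def Ham (S : Set G) (f : G → G → ZMod 2) (v : ZMod 2) : Prop :=
  ∃ x y u, HP (L S) f Set.univ x y u ∧ L S y x ∧ v = u + f y x

structure Good (S : Set G) (f : G → G → ZMod 2) : Prop where
  symm : ∀ x y, f x y = f y x
  flat : Fl S f
  eq : ∃ v, (Even (Nat.card G) → v = 0) ∧ ∀ w, Ham S f w → w = v

theorem Ham.gau {S : Set G} {f : G → G → ZMod 2} {v : ZMod 2} {φ : G → ZMod 2} (h : Ham S (gau f φ) v) :
    Ham S f v := by
  obtain ⟨x, y, u, h1, h2, h3⟩ := h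
  have := h1.gauge φ
  have e : (fun a b => HamSp.gau f φ a b + φ a + φ b) = f := by
    funext a b; simp only [HamSp.gau]; grind
  rw [e] at this
  refine ⟨x, y, _, this, h2, ?_⟩
  rw [h3]; simp only [HamSp.gau]; grind

theorem Ham.const {S : Set G} {f : G → G → ZMod 2} {v e : ZMod 2} (h : Ham S (fun a b => f a b + e) v) :
    Ham S f (v + e * Nat.card G) := by
  obtain ⟨x, y, u, h1, h2, h3⟩ := h
  have := (h1.addc e).2
  have e' : (fun a b => f a b + e + e) = f := by
    funext a b; grind
  rw [e'] at this
  refine ⟨x, y, _, this, h2, ?_⟩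
  rw [h3, Set.ncard_univ]; grind

theorem Good.gau {S : Set G} {f : G → G → ZMod 2} (h : Good S f) (φ : G → ZMod 2) :
    Good S (gau f φ) where
  symm := by intro x y; simp only [HamSp.gau]; rw [h.symm x y]; ring
  flat := h.flat.gau φ
  eq := by
    obtain ⟨v, h1, h2⟩ := h.eq
    exact ⟨v, h1, fun w hw => h2 w hw.gau⟩

theorem Good.const {S : Set G} {f : G → G → ZMod 2} (h : Good S f) (e : ZMod 2) :
    Good S (fun x y => f x y + e) where
  symm := by intro x y; rw [h.symm x y]
  flat := h.flat.add (Fl.const S e)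
  eq := by
    obtain ⟨v, h1, h2⟩ := h.eq
    refine ⟨v + e * Nat.card G, fun he => ?_, fun w hw => ?_⟩
    · rw [h1 he, (ZMod.natCast_eq_zero_iff_even).2 he]; simp
    · have := h2 _ hw.const
      grind

/-- equivalence modulo coboundaries and constants -/
def Eqv (f F : G → G → ZMod 2) : Prop := ∃ φ : G → ZMod 2, ∃ e : ZMod 2, F = fun x y => f x y + φ x + φ y + e

theorem Eqv.refl (f : G → G → ZMod 2) : Eqv f f := ⟨0, 0, by funext x y; simp⟩

theorem Eqv.trans {f F F' : G → G → ZMod 2} (h : Eqv f F) (h' : Eqv F F') : Eqv f F' := by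
  obtain ⟨φ, e, rfl⟩ := h
  obtain ⟨ψ, e', rfl⟩ := h'
  exact ⟨fun x => φ x + ψ x, e + e', by funext x y; ring⟩

theorem Eqv.gau (f : G → G → ZMod 2) (φ : G → ZMod 2) : Eqv f (gau f φ) :=
  ⟨φ, 0, by funext x y; simp [HamSp.gau]⟩

theorem Eqv.cdef (f : G → G → ZMod 2) (c : G → ZMod 2) (e : ZMod 2) :
    Eqv f (fun x y => f x y + e * cdef c x y) :=
  ⟨fun x => e * c x, e, by funext x y; simp only [HamSp.cdef]; ring⟩

theorem Good.eqv {S : Set G} {f F : G → G → ZMod 2} (h : Good S f) (h' : Eqv f F) : Good S F := by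
  obtain ⟨φ, e, rfl⟩ := h'
  exact (h.gau φ).const e

theorem Good.ham {S : Set G} {f : G → G → ZMod 2} (h : Good S f) {v v' : ZMod 2} (h1 : Ham S f v)
    (h2 : Ham S f v') : v = v' := by
  obtain ⟨u, _, h3⟩ := h.eq
  rw [h3 v h1, h3 v' h2]

/-- two Hamilton paths of a bridgeable set have the same value -/
theorem Good.br {S U : Set G} {f : G → G → ZMod 2} (h : Good S f) (hS : Sy S) {x y : G} {v v' : ZMod 2}
    (hxy : L S y x)
    (hb : Br S U x y) (h1 : HP (L S) f U x y v) (h2 : HP (L S) f U x y v') : v = v' := by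
  rcases hb with hb | ⟨p, q, hb, hp, hq⟩
  · have e : U = Set.univ := Set.compl_empty_iff.1 hb
    subst e
    have := h.ham ⟨x, y, v, h1, hxy, rfl⟩ ⟨x, y, v', h2, hxy, rfl⟩
    exact add_right_cancel this
  · obtain ⟨w, hw⟩ := hb.toHP f
    have hw := hw.reverse (L_symm hS) h.symm
    have hd : Disjoint U Uᶜ := disjoint_compl_right
    have k1 := (h1.append (L_symm hS _ _ hq) hw hd).congr (Set.union_compl_self U) rfl
    have k2 := (h2.append (L_symm hS _ _ hq) hw hd).congr (Set.union_compl_self U) rfl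
    have := h.ham ⟨x, p, _, k1, L_symm hS _ _ hp, rfl⟩ ⟨x, p, _, k2, L_symm hS _ _ hp, rfl⟩
    grind

/-- zero edges -/
def Qz (S : Set G) (f : G → G → ZMod 2) (x y : G) : Prop := L S x y ∧ f x y = 0

theorem Qz_symm {S : Set G} (hS : Sy S) {f : G → G → ZMod 2} (hf : ∀ x y, f x y = f y x) (x y : G)
    (h : Qz S f x y) : Qz S f y x := ⟨L_symm hS _ _ h.1, by rw [hf]; exact h.2⟩

theorem close {S T : Set G} {f : G → G → ZMod 2} (h : Good S f) (hS : Sy S)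
    (hgen : Subgroup.closure S = ⊤) {K : Subgroup G} (hT : RE K T) (hTS : T ⊆ S) {V : Set G} {a t : G}
    (ha : a ∈ T) (hV : (K : Set G) = insert 1 V) (h1V : 1 ∉ V) (hp : EP (Qz S f) V a t)
    (ht : t ∈ S) (hz : EP (Qz S f) (K : Set G) 1 a) : f 1 t = 0 := by
  have h1 := hz.toHPQ
  have h2 := (hp.reverse (Qz_symm hS h.symm)).toHPQ
  have h3 := HP.cons (x := (1 : G)) h1V (by simpa [L] using ht) h2
  rw [← hV] at h3
  have := h.br hS (by simpa [L] using hS _ (hTS ha)) (br_all hS hgen K T hT hTS a ha) h3 h1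
  simpa using this

theorem Good.trl {S : Set G} {f : G → G → ZMod 2} (h : Good S f) (g : G) :
    Good S (fun x y => f (g * x) (g * y)) where
  symm := fun x y => h.symm _ _
  flat := by
    intro x s hs t ht h1 h2
    have := h.flat (g * x) s hs t ht h1 h2
    simpa only [mul_assoc] using this
  eq := by
    obtain ⟨v, h1, h2⟩ := h.eq
    refine ⟨v, h1, ?_⟩
    rintro w ⟨x, y, u, k1, k2, rfl⟩
    apply h2
    have := k1.map (Q := L S) (f' := f) (fun z => g * z) (by intro a _ b _ h; simpa using h)
      (fun a _ b _ h => (L_mul g a b).2 h) (fun _ _ _ _ _ => rfl)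
    refine ⟨g * x, g * y, u, this.congr ?_ rfl, (L_mul _ _ _).2 k2, rfl⟩
    simp only [Set.image_univ]
    exact (Group.mulLeft_bijective g).surjective.range_eq

theorem close_all {S T : Set G} {f : G → G → ZMod 2} (h : Good S f) (hS : Sy S)
    (hgen : Subgroup.closure S = ⊤) {K : Subgroup G} (hT : RE K T) (hTS : T ⊆ S)
    (hz : ∀ z ∈ K, ∀ a ∈ T, f z (z * a) = 0) {t : G} (ht : t ∈ S) (ht1 : t ≠ 1)
    (hp : EP (L T) (K : Set G) 1 t) : ∀ z ∈ K, f z (z * t) = 0 := by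
  intro g hg
  have h' := h.trl g
  have toQ : ∀ {U : Set G} {x y : G}, U ⊆ K → EP (L T) U x y →
      EP (Qz S (fun x y => f (g * x) (g * y))) U x y := by
    intro U x y hU h
    refine h.mono (fun a ha b hb hr => ⟨L_mono hTS _ _ hr, ?_⟩)
    have := hz (g * a) (K.mul_mem hg (hU ha)) _ hr
    simpa [mul_assoc] using this
  obtain ⟨a, V, e, h1, hr, hp'⟩ := hp.first ht1.symm
  have ha : a ∈ T := by simpa [L] using hr
  have := close h' hS hgen hT hTS ha e h1 (toQ (by rw [e]; exact Set.subset_insert _ _) hp') ht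
    (toQ subset_rfl (hT.path a ha))
  simpa using this

theorem HCn.mono {S T : Set G} {K : Subgroup G} (h : HCn T K) (hTS : T ⊆ S) : HCn S K :=
  ⟨h.1, fun y hy h1 => (h.2 y hy h1).monoL hTS⟩

/-- the induction state -/
def State (S : Set G) (K : Subgroup G) (F : G → G → ZMod 2) : Prop :=
  (HCn S K ∨ ∃ c, HCb S K c ∧ (S ∩ K).Nonempty) ∧ ∀ z ∈ K, ∀ t ∈ S, t ∈ K → F z (z * t) = 0

theorem fin_n {S T : Set G} {f : G → G → ZMod 2} (h : Good S f) (hS : Sy S) (h1 : (1 : G) ∉ S)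
    (hgen : Subgroup.closure S = ⊤) {K : Subgroup G} (hTS : T ⊆ S) (hT : Sy T) (hn : HCn T K)
    (hz : ∀ z ∈ K, ∀ a ∈ T, a ∈ K → f z (z * a) = 0) : State S K f := by
  refine ⟨Or.inl (hn.mono hTS), fun z hzK t ht htK => ?_⟩
  have ht1 : t ≠ 1 := fun h => h1 (h ▸ ht)
  exact close_all h hS hgen (re_n hT (fun h => h1 (hTS h)) hn) (fun a ha => hTS ha.1)
    (fun z hz' a ha => hz z hz' a ha.1 ha.2) ht ht1 (EP.restrict (hn.2 t htK ht1) subset_rfl) z hzK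

theorem Kit.mono {S T A : Set G} {K : Subgroup G} {bip : Prop} {l0 : ℕ} (k : Kit S A K bip l0)
    (hT : T ⊆ S) (hA : A ⊆ T) : Kit T A K bip l0 :=
  ⟨k.re, hA, k.pos, fun b hb => k.shc b (hT hb)⟩

theorem shift_zero {S A : Set G} {K : Subgroup G} (hA : A ⊆ K) {b : G} {F : G → G → ZMod 2}
    (hF : ∀ x y, F x y = F y x) {n lo : ℕ} (hn : n = idx K b) (hz : ZS F A K b n) (hlo : 1 ≤ lo) (hlon : lo ≤ n)
    {x y : G} (hx : (b ^ lo)⁻¹ * x ∈ Strip K b (n - lo)) (hy : (b ^ lo)⁻¹ * y ∈ Strip K b (n - lo))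
    (hr : L (Adj1 A b) x y) : F x y = 0 := by
  have e : ∀ i z, (b ^ i)⁻¹ * ((b ^ lo)⁻¹ * z) = (b ^ (lo + i))⁻¹ * z := by
    intro i z
    rw [pow_add]
    exact Additive.ofMul.injective (by simp only [ofMul_mul, ofMul_inv, ofMul_pow]; abel)
  have key : ∀ x, (b ^ lo)⁻¹ * x ∈ Strip K b (n - lo) → (b ^ lo)⁻¹ * (x * b) ∈ Strip K b (n - lo) →
      F x (x * b) = 0 := by
    rintro x ⟨i, hi, h1⟩ ⟨j, hj, h2⟩
    rw [e] at h1 h2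
    by_cases h : lo + i + 1 < n
    · exact hz.col _ h x h1
    · exfalso
      have h3 := row_succ.2 h1
      have : lo + i + 1 = idx K b := by omega
      rw [this] at h3
      have h4 : b ^ idx K b ∈ K := (pow_mem_iff K b _).2 (dvd_refl _)
      have h5 : (b ^ 0)⁻¹ * (x * b) ∈ K := by simpa using K.mul_mem h4 h3
      have := (free_idx K b).row_unique (by omega) (by omega) h2 h5
      omega
  rcases hr with h | h | h
  · obtain ⟨i, hi, h1⟩ := hx
    rw [e] at h1
    have := hz.row x ⟨_, by omega, h1⟩ _ h
    simpa using this
  · have h' : y = x * b := inv_mul_eq_iff_eq_mul.1 h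
    subst h'; exact key x hx hy
  · rw [Set.mem_singleton_iff] at h
    have h' : x = y * b := by rw [inv_mul_eq_iff_eq_mul] at h; rw [h]; simp
    subst h'; rw [hF]; exact key y hy hx

/-- zero Hamilton path of the extension avoiding wrap edges -/
theorem zfat {S A : Set G} {K : Subgroup G} (hK : RE K A) (hAS : A ⊆ S) (hS : Sy S) {b : G} (hbS : b ∈ S)
    (hbK : b ∉ K) {F : G → G → ZMod 2} (hF : ∀ x y, F x y = F y x) (hz : ZS F A K b (idx K b)) {a : G}
    (ha : a ∈ A) : EP (Qz S F) (ext K b : Set G) 1 a := by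
  have hn := idx_two hbK
  obtain ⟨c, V, e, h1V, hr, hV⟩ := (hK.path a ha).first (fun h => hK.one (h ▸ ha))
  have hc : c ∈ A := by simpa [L] using hr
  have h2 := (fat hK (Adj1_sub A b) (mem_Adj1 A b) (inv_mem_Adj1 A b) (idx K b - 2)
    ((free_idx K b).mono (by omega)) c hc).trl b
  have hlen : idx K b - 2 + 1 = idx K b - 1 := by omega
  rw [hlen] at h2
  have hsub := Adj1_subS hAS hbS hS
  have h3 : EP (Qz S F) {z | b⁻¹ * z ∈ Strip K b (idx K b - 1)} (b * 1) (b * c) :=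
    h2.mono (fun x hx y hy hr => ⟨L_mono hsub _ _ hr,
      shift_zero (S := S) hK.sub hF rfl hz (lo := 1) le_rfl (by omega) (by simpa using hx) (by simpa using hy) hr⟩)
  have hVK : V ⊆ K := by rw [e]; exact Set.subset_insert _ _
  have h4 : EP (Qz S F) V c a := hV.mono (fun x hx y hy hr => ⟨L_mono hAS _ _ hr, by
    have := hz.row x ⟨0, by omega, by simpa using hVK hx⟩ _ hr
    simpa using this⟩)
  have hd := Strip_disj (K := K) (b := b) (l := idx K b - 1) (by
    rw [Nat.sub_add_cancel (by omega)]; exact free_idx K b)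
  have hss := Strip_succ K b (idx K b - 1)
  rw [Nat.sub_add_cancel (by omega), Strip_full] at hss
  rw [mul_one] at h3
  have h5 := h3.append (z := c) ⟨by
      have := L_right (A := S) (b * c) (hS _ hbS)
      rwa [mul_comm b c, mul_inv_cancel_right, mul_comm c b] at this, by
      have := hz.col 0 (by omega) c (by simpa using hK.sub hc)
      rw [hF, mul_comm b c]; exact this⟩ h4
    (hd.symm.mono_right hVK)
  have h6 := EP.cons (x := (1 : G)) (R := Qz S F) ?_ ⟨by simpa [L] using hbS, ?_⟩ h5
  · refine h6.congr ?_
    rw [hss, e]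
    ext z; simp only [Set.mem_insert_iff, Set.mem_union]; tauto
  · rintro (h | h)
    · exact Set.disjoint_left.1 hd K.one_mem h
    · exact h1V h
  · have := hz.col 0 (by omega) 1 (by simp)
    simpa using this

end grp
end HamSp


/-! Part 8 -/
set_option linter.unusedSectionVars false
set_option linter.unusedSimpArgs false
set_option linter.unusedVariables false
namespace HamSp
section grp
variable {G : Type*} [CommGroup G] [Finite G]

theorem inv_row (K : Subgroup G) (b : G) : (b ^ (idx K b - 1))⁻¹ * b⁻¹ ∈ K := by
  have h := (pow_mem_iff K b (idx K b)).2 dvd_rfl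
  have h1 := K.inv_mem h
  have h2 := idx_pos K b
  rw [← mul_inv_rev, ← pow_succ']
  rwa [Nat.sub_add_cancel h2]

theorem row_wrap {K : Subgroup G} {b z : G} : (b ^ (idx K b - 1))⁻¹ * z ∈ K ↔ z * b ∈ K := by
  have h := inv_row K b
  constructor
  · intro h1
    have := K.mul_mem (K.inv_mem h) h1
    convert this using 1
    exact Additive.ofMul.injective (by simp only [ofMul_mul, ofMul_inv, ofMul_pow, ofMul_zpow]; abel)
  · intro h1
    have := K.mul_mem h h1
    convert this using 1
    exact Additive.ofMul.injective (by simp only [ofMul_mul, ofMul_inv, ofMul_pow, ofMul_zpow]; abel)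

theorem ne_of_K {K : Subgroup G} {a b : G} (ha : a ∈ K) (hb : b ∉ K) : b ≠ a ∧ b ≠ a⁻¹ :=
  ⟨fun h => hb (h ▸ ha), fun h => hb (h ▸ K.inv_mem ha)⟩

theorem wrap_const {S A : Set G} {F : G → G → ZMod 2} (hF : Fl S F) {K : Subgroup G} {b : G}
    (hK : RE K A) (hAS : A ⊆ S) (hbS : b ∈ S) (hbK : b ∉ K) (hz : ZS F A K b (idx K b)) :
    ∀ z, z * b ∈ K → F z (z * b) = F b⁻¹ 1 := by
  have key : ∀ w ∈ K, F (b⁻¹ * w) (b⁻¹ * w * b) = F b⁻¹ 1 := by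
    apply hK.induct (P := fun w => F (b⁻¹ * w) (b⁻¹ * w * b) = F b⁻¹ 1)
    · simp
    · intro z hzK a ha ih
      have h1 := hF (b⁻¹ * z) a (hAS ha) b hbS (ne_of_K (hK.sub ha) hbK).1 (ne_of_K (hK.sub ha) hbK).2
      have hr : (b ^ (idx K b - 1))⁻¹ * (b⁻¹ * z) ∈ K := row_wrap.2 (by simpa using hzK)
      have h2 := hz.row (b⁻¹ * z) ⟨_, Nat.sub_lt (idx_pos K b) one_pos, hr⟩ a ha
      have h3 := hz.row (b⁻¹ * z * b) ⟨0, idx_pos K b, by simpa using hzK⟩ a ha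
      rw [h2, h3] at h1
      rw [← mul_assoc b⁻¹ z a, ← ih]
      grind
  intro z hzK
  have := key (z * b) hzK
  simpa [mul_comm z b] using this

theorem wrap_core {S A : Set G} {F : G → G → ZMod 2} (h : Good S F) (hS : Sy S)
    (hgen : Subgroup.closure S = ⊤) {K : Subgroup G} {b : G}
    (hK : RE K A) (hAS : A ⊆ S) (hbS : b ∈ S) (hbK : b ∉ K) (hz : ZS F A K b (idx K b))
    {z : G} (hzK : z ∈ K) (hz1 : z ≠ 1) (hp : EP (L A) (K : Set G) 1 z)
    (hq : EP (Qz S F) {z | (b ^ 1)⁻¹ * z ∈ Strip K b (idx K b - 1)} (z * b) b⁻¹) :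
    F 1 b⁻¹ = 0 := by
  obtain ⟨q, V, hV, h1V, hq1, hqp⟩ := hp.first hz1.symm
  have hqA : q ∈ A := by simpa [L] using hq1
  have hn := idx_two hbK
  have hVK : V ⊆ K := by rw [hV]; exact Set.subset_insert _ _
  have hA0 : ∀ x ∈ K, ∀ a ∈ A, F x (x * a) = 0 := fun x hx a ha =>
    hz.row x ⟨0, by omega, by simpa using hx⟩ a ha
  have hqp' : EP (Qz S F) V q z := hqp.mono (fun x hx y hy hl => ⟨hAS hl, by
    have := hA0 x (hVK hx) _ hl; simpa using this⟩)
  have hd := Strip_split_disj (free_idx K b) (lo := 1) (by omega)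
  have hs := Strip_split K b (l := idx K b) (lo := 1) (by omega)
  rw [Strip_one] at hd hs
  have hp2 := hqp'.append ⟨L_right z hbS, hz.col 0 (by omega) z (by simpa using hzK)⟩ hq
    (hd.mono_left hVK)
  refine close h hS hgen (RE_step hK hbK) (Adj1_subS hAS hbS hS) (V := V ∪ {z | (b ^ 1)⁻¹ * z ∈ Strip K b (idx K b - 1)})
    (Adj1_sub A b hqA) ?_ ?_ hp2 (hS _ hbS) (zfat hK hAS hS hbS hbK h.symm hz hqA)
  · rw [← Strip_full, ← hs, hV, Set.insert_union]
  · rintro (h1 | h1)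
    · exact h1V h1
    · exact Set.disjoint_left.1 hd K.one_mem h1

theorem wrap_main {S A : Set G} {F : G → G → ZMod 2} (h : Good S F) (hS : Sy S)
    (hgen : Subgroup.closure S = ⊤) {K : Subgroup G} {b : G} {bip : Prop} {l0 : ℕ}
    (k : Kit S A K bip l0) (hbS : b ∈ S) (hbK : b ∉ K) (hz : ZS F A K b (idx K b))
    {c : G → ZMod 2} (hc : bip → ZS (cdef c) A K b (idx K b)) (hl : l0 ≤ idx K b - 1)
    {z : G} (hzK : z ∈ K) (hz1 : z ≠ 1) (hp : EP (L A) (K : Set G) 1 z) (hzb : z * b ≠ b⁻¹)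
    (hcol : bip → c (z * b) ≠ c b⁻¹) :
    F 1 b⁻¹ = 0 := by
  have hn := idx_two hbK
  have h1 := k.shc_shift hbS hbK (n := idx K b) (lo := 1) le_rfl (by omega) hl hc (x := z * b) (y := b⁻¹)
    (j := idx K b - 1) (by simpa [mul_comm z b] using hzK) (by omega) (by omega) (inv_row K b) hzb hcol
  refine wrap_core h hS hgen k.re k.sub hbS hbK hz hzK hz1 hp (h1.mono ?_)
  intro x hx y hy hl
  exact ⟨Adj1_subS k.sub hbS hS hl, shift_zero (S := S) k.re.sub h.symm rfl hz le_rfl (by omega) hx hy hl⟩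

theorem wrap_cyc {S : Set G} {F : G → G → ZMod 2} (h : Good S F) (hS : Sy S)
    (hgen : Subgroup.closure S = ⊤) {s b : G} (hs1 : s ≠ 1)
    (hsS : s ∈ S) (hbS : b ∈ S) (hbK : b ∉ Subgroup.zpowers s)
    (hz : ZS F {s, s⁻¹} (Subgroup.zpowers s) b 2) (hi : idx (Subgroup.zpowers s) b = 2)
    {k : ℕ} (hk : 2 * k < orderOf s) (hbk : b⁻¹ = b * s ^ (2 * k)) : F 1 b⁻¹ = 0 := by
  have hK := RE_single hs1
  have hAS : ({s, s⁻¹} : Set G) ⊆ S := by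
    rintro x (rfl | rfl)
    · exact hsS
    · exact hS _ hsS
  have hf := free_idx (Subgroup.zpowers s) b
  rw [hi] at hf
  have hm : 0 < orderOf s := orderOf_pos s
  have gp : ∀ j : ℕ, 2 * j < orderOf s → EP (Qz (Adj1 {s, s⁻¹} b) F) (ext (Subgroup.zpowers s) b : Set G) 1 (b * s ^ (2 * j)) := by
    intro j hj
    have h1 := gridL1 (orderOf s) (fun p q h => h) j (by exact_mod_cast hj)
    have h2 := h1.map (Q := Qz (Adj1 {s, s⁻¹} b) F) (cy b s) (by
      have := cy_inj hf 0
      simpa using this) ?_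
    · have h3 := h2.congr (V := (ext (Subgroup.zpowers s) b : Set G)) (by
        have := cy_image b s 2 0
        rw [← Strip_full, hi, ← this]; simp)
      simpa [cy, zpow_mul, pow_mul] using h3
    · intro p hp q hq hpq
      refine ⟨cy_L (Adj1_sub _ _ (by simp)) (Adj1_sub _ _ (by simp)) (mem_Adj1 _ _) (inv_mem_Adj1 _ _) p q hpq, ?_⟩
      have hrow : ∀ p : ℤ × ℤ, (0 ≤ p.1 ∧ p.1 < 2) → cy b s p ∈ Strip (Subgroup.zpowers s) b 2 := by
        intro p hp
        refine ⟨p.1.toNat, by omega, ?_⟩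
        have : (b ^ p.1.toNat)= b ^ p.1 := by rw [← zpow_natCast]; congr 1; omega
        rw [this, cy]; simp
      have hsm := zpow_natCast s (orderOf s)
      rw [pow_orderOf_eq_one] at hsm
      rcases hpq with ⟨h1, h2⟩ | ⟨h1, h2⟩
      · have hstep : ∀ p q : ℤ × ℤ, (0 ≤ p.1 ∧ p.1 < 2) → p.1 = q.1 → (q.2 = p.2 + 1 ∨ q.2 = p.2 + (orderOf s - 1)) → F (cy b s p) (cy b s q) = 0 := by
          intro p q hp h1 h2
          rcases h2 with h2 | h2
          · have := hz.row _ (hrow p hp) s (by simp)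
            convert this using 2
            rw [cy, cy, h1, h2, zpow_add, zpow_one, mul_assoc]
          · have := hz.row _ (hrow p hp) s⁻¹ (by simp)
            convert this using 2
            rw [cy, cy, h1, h2, zpow_add, zpow_sub, hsm, zpow_one, mul_assoc, one_mul]
        rcases h2 with h2 | h2 | h2 | h2
        · exact hstep p q hp.1 h1 (.inl h2)
        · rw [h.symm]; exact hstep q p hq.1 h1.symm (.inl h2)
        · exact hstep p q hp.1 h1 (.inr h2)
        · rw [h.symm]; exact hstep q p hq.1 h1.symm (.inr h2)
      · have hstep : ∀ p q : ℤ × ℤ, (0 ≤ p.1 ∧ p.1 < 2) → (0 ≤ q.1 ∧ q.1 < 2) → p.2 = q.2 → q.1 = p.1 + 1 → F (cy b s p) (cy b s q) = 0 := by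
          intro p q hp hq h1 h2
          have hp0 : p.1 = 0 := by omega
          have := hz.col 0 (by omega) (cy b s p) (by simp [cy, hp0])
          convert this using 2
          rw [cy, cy, ← h1, h2, hp0]; simp [mul_comm]
        rcases h2 with h2 | h2
        · exact hstep p q hp.1 hq.1 h1 h2
        · rw [h.symm]; exact hstep q p hq.1 hp.1 h1.symm h2
  have gp' : ∀ j : ℕ, 2 * j < orderOf s → EP (Qz S F) (ext (Subgroup.zpowers s) b : Set G) 1 (b * s ^ (2 * j)) :=
    fun j hj => (gp j hj).mono (fun x _ y _ hl => ⟨Adj1_subS hAS hbS hS hl.1, hl.2⟩)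
  have hp := gp k hk
  rw [← hbk] at hp
  have hb1 : (1 : G) ≠ b⁻¹ := by
    intro h1
    exact hbK (by have : b = 1 := by simpa using h1.symm
                  rw [this]; exact Subgroup.one_mem _)
  obtain ⟨q, V, hV, h1V, hq, hqp⟩ := hp.first hb1
  have hqA : q ∈ Adj1 {s, s⁻¹} b := by simpa [L] using hq.1
  have hqp' : EP (Qz S F) V q b⁻¹ := hqp.mono (fun x _ y _ hl => ⟨Adj1_subS hAS hbS hS hl.1, hl.2⟩)
  by_cases hqb : q = b⁻¹
  · rw [← hqb]; exact hq.2
  refine close h hS hgen (RE_step hK hbK) (Adj1_subS hAS hbS hS) hqA hV h1V hqp' (hS _ hbS) ?_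
  rcases hqA with hqA | hqA
  · exact zfat hK hAS hS hbS hbK h.symm (hi ▸ hz) hqA
  · have : q = b := by rcases hqA with h | h; exact h; exact absurd h hqb
    have := gp' 0 (by simpa using hm)
    simp_all

end grp
end HamSp


/-! Part 9 -/
set_option linter.unusedSectionVars false
set_option linter.unusedSimpArgs false
set_option linter.unusedVariables false
namespace HamSp
section grp
variable {G : Type*} [CommGroup G] [Finite G]

theorem ext_zero {A : Set G} {F : G → G → ZMod 2} (hs : ∀ x y, F x y = F y x) {K : Subgroup G} {b : G}
    (hz : ZS F A K b (idx K b)) (hw : ∀ z, z * b ∈ K → F z (z * b) = 0) :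
    ∀ z ∈ ext K b, ∀ a ∈ Adj1 A b, F z (z * a) = 0 := by
  have hb : ∀ z ∈ ext K b, F z (z * b) = 0 := by
    intro z hzK
    obtain ⟨i, hi, hzi⟩ := mem_ext_iff.1 hzK
    by_cases h : i + 1 < idx K b
    · exact hz.col i h z hzi
    · have : i = idx K b - 1 := by omega
      subst this
      exact hw z (row_wrap.1 hzi)
  intro z hzK a ha
  rcases ha with ha | rfl | rfl
  · exact hz.row z (by rw [Strip_full]; exact hzK) a ha
  · exact hb z hzK
  · have := hb (z * b⁻¹) ((ext K b).mul_mem hzK ((ext K b).inv_mem (mem_ext K b)))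
    rw [hs]; simpa using this

theorem cyc_exp {s b : G} (hi : idx (Subgroup.zpowers s) b = 2) :
    ∃ k < orderOf s, b⁻¹ = b * s ^ k := by
  classical
  have h := inv_row (Subgroup.zpowers s) b
  rw [hi] at h
  rw [mem_zpowers_iff_mem_range_orderOf] at h
  simp only [Finset.mem_image, Finset.mem_range] at h
  obtain ⟨k, hk, h⟩ := h
  refine ⟨k, hk, ?_⟩
  rw [h]; simp

theorem step_n {S A : Set G} {F : G → G → ZMod 2} (h : Good S F) (hS : Sy S) (h1 : (1 : G) ∉ S)
    (hgen : Subgroup.closure S = ⊤) {K : Subgroup G} {b : G} {l0 : ℕ}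
    (k : Kit S A K False l0)
    (hl : (l0 = 1 ∧ ∀ w : G, ∃ z ∈ K, z ≠ 1 ∧ z ≠ w) ∨
      (l0 = 2 ∧ ∃ s, K = Subgroup.zpowers s ∧ A = {s, s⁻¹} ∧ s ≠ 1 ∧ Odd (orderOf s)))
    (hbS : b ∈ S) (hbK : b ∉ K) (h0 : ∀ z ∈ K, ∀ a ∈ A, F z (z * a) = 0) :
    ∃ F', Eqv F F' ∧ State S (ext K b) F' := by
  have hn := idx_two hbK
  obtain ⟨φ, hφ, hZ⟩ := rowGauge h.flat k.re.sub k.sub hbS hbK h0 (idx K b - 1)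
    (by rw [Nat.sub_add_cancel (idx_pos K b)]; exact free_idx K b)
  rw [Nat.sub_add_cancel (idx_pos K b)] at hZ
  refine ⟨gau F φ, Eqv.gau F φ, ?_⟩
  have hG := h.gau φ
  set F1 := gau F φ with hF1
  have hw0 : F1 1 b⁻¹ = 0 := by
    rcases hl with ⟨rfl, h3⟩ | ⟨rfl, s, rfl, rfl, hs1, ho⟩
    · obtain ⟨z, hzK, hz1, hzw⟩ := h3 (b⁻¹ * b⁻¹)
      have hp := k.shc b hbS hbK 0 1 le_rfl (by omega) (fun h => h.elim) 1 K.one_mem z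
        (by rw [Strip_one]; exact hzK) hz1.symm (fun h => h.elim)
      rw [Strip_one] at hp
      have hp' := (hp.restrict (K := K) le_rfl).monoL (B := A) (by
        rintro x ⟨hx | rfl | rfl, hxK⟩
        · exact hx
        · exact absurd hxK hbK
        · exact absurd (by simpa using K.inv_mem hxK) hbK)
      exact wrap_main hG hS hgen k hbS hbK hZ (c := 0) (fun h => h.elim) (by omega) hzK hz1 hp'
        (fun h => hzw (eq_mul_inv_of_mul_eq h)) (fun h => h.elim)
    · by_cases hi : idx (Subgroup.zpowers s) b = 2
      · obtain ⟨j, hj, hbj⟩ := cyc_exp hi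
        have hsS : s ∈ S := k.sub (by simp)
        rw [hi] at hZ
        rcases Nat.even_or_odd' j with ⟨j', rfl | rfl⟩
        · exact wrap_cyc hG hS hgen hs1 hsS hbS hbK hZ hi hj hbj
        · obtain ⟨m', hm'⟩ := ho
          refine wrap_cyc hG hS hgen (s := s⁻¹) (k := m' - j') (by simpa using hs1) (hS _ hsS) hbS (by rw [Subgroup.zpowers_inv]; exact hbK)
            ?_ (by rw [Subgroup.zpowers_inv]; exact hi) (by rw [orderOf_inv]; omega) ?_
          · rw [Subgroup.zpowers_inv, inv_inv, Set.pair_comm]; exact hZ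
          · rw [hbj]; congr 1
            rw [inv_pow, eq_inv_iff_mul_eq_one, ← pow_add, show 2 * j' + 1 + 2 * (m' - j') = orderOf s by omega, pow_orderOf_eq_one]
      · refine wrap_main hG hS hgen k hbS hbK hZ (c := 0) (fun h => h.elim) (by omega) (z := s) (by simp) hs1
          (k.re.path s (by simp)) (fun h => ?_) (fun h => h.elim)
        have : b ^ 2 ∈ Subgroup.zpowers s := by
          have : b ^ 2 = s⁻¹ := by
            rw [pow_two, eq_inv_iff_mul_eq_one, mul_assoc, mul_comm b s, h]; simp
          rw [this]; simp
        rw [pow_mem_iff] at this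
        have := Nat.le_of_dvd (by norm_num) this
        omega
  have hw : ∀ z, z * b ∈ K → F1 z (z * b) = 0 := by
    intro z hzK
    rw [wrap_const hG.flat k.re k.sub hbS hbK hZ z hzK, hG.symm, hw0]
  have hz := ext_zero hG.symm hZ hw
  have hT := Adj1_subS k.sub hbS hS
  have hn2 := hc_nonbip (k.mono hT (Adj1_sub A b)) (Adj1_symm k.re.symm b) (mem_Adj1 A b) hbK
    (by rcases hl with h | h <;> omega) (fun h => h)
  exact fin_n hG hS h1 hgen hT (Adj1_symm k.re.symm b) hn2 (fun z hz' a ha _ => hz z hz' a ha)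

theorem KitAlt.mono {S T A : Set G} {K : Subgroup G} {bip : Prop} {l0 : ℕ} (k : KitAlt S A K bip l0)
    (hT : T ⊆ S) (hA : A ⊆ T) : KitAlt T A K bip l0 := ⟨k.1.mono hT hA, k.2⟩

theorem cdef_symm (c : G → ZMod 2) (x y : G) : cdef c x y = cdef c y x := by
  unfold cdef; ring

/-- adding a multiple of a colour defect preserves strip zeros -/
theorem ZS.addc {A : Set G} {F : G → G → ZMod 2} {c : G → ZMod 2} {K : Subgroup G} {b : G} {n : ℕ}
    (h : ZS F A K b n) (hc : ZS (cdef c) A K b n) (e : ZMod 2) :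
    ZS (fun x y => F x y + e * cdef c x y) A K b n where
  row z hz a ha := by simp [h.row z hz a ha, hc.row z hz a ha]
  col i hi z hz := by simp [h.col i hi z hz, hc.col i hi z hz]

theorem step_b {S A : Set G} {F : G → G → ZMod 2} (h : Good S F) (hS : Sy S) (h1 : (1 : G) ∉ S)
    (hgen : Subgroup.closure S = ⊤) {K : Subgroup G} {b : G} {l0 : ℕ}
    (k : KitAlt S A K True l0) {c0 : G → ZMod 2} (hc0 : ∀ z ∈ K, ∀ t ∈ S, t ∈ K → c0 (z * t) = c0 z + 1)
    (hbS : b ∈ S) (hbK : b ∉ K) (h0 : ∀ z ∈ K, ∀ a ∈ A, F z (z * a) = 0) :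
    ∃ F', Eqv F F' ∧ State S (ext K b) F' := by
  have hn := idx_two hbK
  have kk := k.1
  have hT := Adj1_subS kk.sub hbS hS
  have hTs := Adj1_symm kk.re.symm b
  obtain ⟨φ, hφ, hZ⟩ := rowGauge h.flat kk.re.sub kk.sub hbS hbK h0 (idx K b - 1)
    (by rw [Nat.sub_add_cancel (idx_pos K b)]; exact free_idx K b)
  rw [Nat.sub_add_cancel (idx_pos K b)] at hZ
  have hG := h.gau φ
  have hE := Eqv.gau F φ
  set F1 := gau F φ with hF1
  obtain ⟨ψ, hψ, hC⟩ := rowGauge (Fl.cdef S c0) kk.re.sub kk.sub hbS hbK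
    (fun z hz a ha => cdef_zero.2 (hc0 z hz a (kk.sub ha) (kk.re.sub ha))) (idx K b - 1)
    (by rw [Nat.sub_add_cancel (idx_pos K b)]; exact free_idx K b)
  rw [Nat.sub_add_cancel (idx_pos K b)] at hC
  obtain ⟨c, hc⟩ : ∃ c, gau (cdef c0) ψ = cdef c := ⟨fun x => c0 x + ψ x, by
    funext x y; simp only [gau, cdef]; ring⟩
  have hcK : ∀ z ∈ K, c z + c 1 = c0 z + c0 1 := by
    intro z hz
    have := congrFun (congrFun hc 1) z
    simp only [gau, cdef, hψ 1 K.one_mem, hψ z hz] at this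
    grind
  rw [hc] at hC
  have hcc : ∀ z, z * b ∈ K → cdef c z (z * b) = cdef c b⁻¹ 1 :=
    wrap_const (Fl.cdef S c) kk.re kk.sub hbS hbK hC
  -- badness
  by_cases hwc : cdef c b⁻¹ 1 = 0
  · have hcw : ∀ z, (b ^ (idx K b - 1))⁻¹ * z ∈ K → c (z * b) = c z + 1 := fun z hz =>
      cdef_zero.1 (by rw [hcc z (row_wrap.1 hz), hwc])
    have hcb : c b⁻¹ = c 1 + 1 := by
      have := cdef_zero.1 hwc; rw [this]; grind
    have hcE := col_ext (S := S) kk.re hbK hC hcw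
    have hc1b : c b = c 1 + 1 := by
      have := hcE 1 (Subgroup.one_mem _) b (mem_Adj1 A b); simpa using this
    obtain ⟨a, ha⟩ := kk.re.ne
    have ha1 : a ≠ 1 := fun h => kk.re.one (h ▸ ha)
    have hw0 : F1 1 b⁻¹ = 0 := by
      by_cases hln : l0 ≤ idx K b - 1
      · have e1 : c (a * b) ≠ c b⁻¹ := by
          have e2 := hcE a (le_ext K b (kk.re.sub ha)) b (mem_Adj1 A b)
          have e3 := hcE 1 (Subgroup.one_mem _) a (Adj1_sub A b ha)
          rw [one_mul] at e3
          rw [e2, e3, hcb]; grind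
        exact wrap_main hG hS hgen kk hbS hbK hZ (fun _ => hC) hln (kk.re.sub ha) ha1
          (kk.re.path a ha) (fun h => e1 (by rw [h])) (fun _ => e1)
      · rcases k.2 with rfl | ⟨rfl, s, rfl, rfl, he⟩
        · omega
        · have hi : idx (Subgroup.zpowers s) b = 2 := by omega
          obtain ⟨j, hj, hbj⟩ := cyc_exp hi
          have hs1 : s ≠ 1 := fun h => kk.re.one (by simp [h])
          have hsS : s ∈ S := kk.sub (by simp)
          have hcp := col_zpow (s := s) (c := c) (fun z => z ∈ ext (Subgroup.zpowers s) b)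
            (fun z hz => Subgroup.mul_mem _ hz (le_ext _ _ (by simp)))
            (fun z hz => hcE z hz s (Adj1_sub _ _ (by simp))) b (mem_ext _ _) j
          have hje : (j : ZMod 2) = 0 := by
            have := hcp.2
            rw [← hbj, hcb, hc1b] at this
            grind
          have hje' : Even j := by
            rw [← ZMod.natCast_eq_zero_iff_even]; exact hje
          obtain ⟨j', rfl⟩ := even_iff_exists_two_mul.1 hje'
          exact wrap_cyc hG hS hgen hs1 hsS hbS hbK (hi ▸ hZ) hi hj hbj
    have hw : ∀ z, z * b ∈ K → F1 z (z * b) = 0 := by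
      intro z hzK
      rw [wrap_const hG.flat kk.re kk.sub hbS hbK hZ z hzK, hG.symm, hw0]
    have hz := ext_zero hG.symm hZ hw
    by_cases hbad : ∃ t ∈ S, t ∈ ext K b ∧ c t = c 1
    · obtain ⟨t0, ht0, htE, htc⟩ := hbad
      have htK : t0 ∉ K := by
        intro hK
        have e1 := hc0 1 K.one_mem t0 ht0 hK
        have e2 := hcK t0 hK
        rw [one_mul] at e1
        rw [htc, e1] at e2
        grind
      refine ⟨fun x y => F1 x y + F1 1 t0 * cdef c x y, hE.trans (Eqv.cdef F1 c _), ?_⟩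
      have hG2 := hG.eqv (Eqv.cdef F1 c (F1 1 t0))
      set F2 : G → G → ZMod 2 := fun x y => F1 x y + F1 1 t0 * cdef c x y with hF2
      have hz2 : ∀ z ∈ ext K b, ∀ a ∈ Adj1 A b, F2 z (z * a) = 0 := by
        intro z hzE a ha
        simp [hF2, hz z hzE a ha, cdef_zero.2 (hcE z hzE a ha)]
      have ht1 : F2 1 t0 = 0 := by
        simp only [hF2, cdef, htc]; grind
      have hRE := RE_step kk.re hbK
      have htT : ∀ z ∈ ext K b, F2 z (z * t0) = 0 := by
        apply hRE.induct (P := fun z => F2 z (z * t0) = 0)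
        · simpa using ht1
        · intro z hzE a ha ih
          by_cases hta : t0 = a
          · exact hz2 _ ((ext K b).mul_mem hzE (hRE.sub ha)) _ (hta ▸ ha)
          by_cases hta' : t0 = a⁻¹
          · exact hz2 _ ((ext K b).mul_mem hzE (hRE.sub ha)) _ (hta' ▸ hRE.symm a ha)
          have := hG2.flat z a (hT ha) t0 ht0 hta hta'
          rw [hz2 z hzE a ha, hz2 _ ((ext K b).mul_mem hzE htE) a ha, ih] at this
          simpa using this
      have hTT : Adj1 (Adj1 A b) t0 ⊆ S := Adj1_subS hT ht0 hS
      have hTTs := Adj1_symm hTs t0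
      have hn2 := hc_bip_bad (k.mono hTT ((Adj1_sub A b).trans (Adj1_sub _ _))) hTTs (Adj1_sub _ _ (mem_Adj1 A b)) hbK hC
        (mem_Adj1 _ t0) htE htK htc
      refine fin_n hG2 hS h1 hgen hTT hTTs hn2 ?_
      intro z hzE a ha _
      rcases ha with ha | rfl | rfl
      · exact hz2 z hzE a ha
      · exact htT z hzE
      · have := htT (z * t0⁻¹) ((ext K b).mul_mem hzE ((ext K b).inv_mem htE))
        rw [hG2.symm]; simpa using this
    · push Not at hbad
      have hB := hc_bip_good k hS hbS hbK hC hcw hbad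
      refine ⟨F1, hE, .inr ⟨c, hB, ⟨b, hbS, mem_ext K b⟩⟩, ?_⟩
      intro z hzE t ht htE
      have htn1 : t ≠ 1 := fun h => h1 (h ▸ ht)
      have hp := full_strip (kk.mono hT (Adj1_sub A b)) hTs (mem_Adj1 A b) hbK
        (by rcases k.2 with h | h <;> omega) (fun _ => hC) K.one_mem htE htn1.symm (fun _ => (hbad t ht htE).symm)
      exact close_all hG hS hgen (RE_step kk.re hbK) hT hz ht htn1 hp z hzE
  · -- bad wrap
    have hw1 : cdef c b⁻¹ 1 = 1 := by simpa using zmod2_ne.1 hwc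
    refine ⟨fun x y => F1 x y + F1 b⁻¹ 1 * cdef c x y, hE.trans (Eqv.cdef F1 c _), ?_⟩
    have hG2 := hG.eqv (Eqv.cdef F1 c (F1 b⁻¹ 1))
    have hZ2 := hZ.addc hC (F1 b⁻¹ 1)
    set F2 : G → G → ZMod 2 := fun x y => F1 x y + F1 b⁻¹ 1 * cdef c x y with hF2
    have hw : ∀ z, z * b ∈ K → F2 z (z * b) = 0 := by
      intro z hzK
      rw [wrap_const hG2.flat kk.re kk.sub hbS hbK hZ2 z hzK]
      simp only [hF2, hw1]; grind
    have hz := ext_zero hG2.symm hZ2 hw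
    have hcb : c b⁻¹ = c 1 := by simp only [cdef] at hw1; grind
    have hn2 := hc_bip_bad (k.mono hT (Adj1_sub A b)) hTs (mem_Adj1 A b) hbK hC
        (inv_mem_Adj1 A b) (Subgroup.inv_mem _ (mem_ext K b)) (fun h => hbK (by simpa using K.inv_mem h)) hcb
    exact fin_n hG2 hS h1 hgen hT hTs hn2 (fun z hz' a ha _ => hz z hz' a ha)

theorem State.step {S : Set G} {F : G → G → ZMod 2} (h : Good S F) (hS : Sy S) (h1 : (1 : G) ∉ S)
    (hgen : Subgroup.closure S = ⊤) {K : Subgroup G} {b : G} (hs : State S K F)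
    (hbS : b ∈ S) (hbK : b ∉ K) : ∃ F', Eqv F F' ∧ State S (ext K b) F' := by
  have h0 : ∀ z ∈ K, ∀ a ∈ S ∩ K, F z (z * a) = 0 := fun z hz a ha => hs.2 z hz a ha.1 ha.2
  rcases hs.1 with hn | ⟨c, hc, hne⟩
  · exact step_n h hS h1 hgen (kit_n hS h1 hn) (.inl ⟨rfl, hn.1⟩) hbS hbK h0
  · exact step_b h hS h1 hgen ⟨kit_b hS h1 hc hne, .inl rfl⟩ hc.1 hbS hbK h0

theorem State.finish {S : Set G} {F : G → G → ZMod 2} (h : Good S F) (hS : Sy S) (h1 : (1 : G) ∉ S)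
    (hgen : Subgroup.closure S = ⊤) {K : Subgroup G} (hs : State S K F) :
    ∃ F', Eqv F F' ∧ State S ⊤ F' := by
  obtain ⟨n, hn⟩ : ∃ n, n = (⊤ : Subgroup G).index + K.index := ⟨_, rfl⟩
  induction n using Nat.strong_induction_on generalizing K F with
  | _ n ih =>
    by_cases hK : K = ⊤
    · subst hK; exact ⟨F, Eqv.refl F, hs⟩
    · obtain ⟨b, hbS, hbK⟩ := exists_not_mem hgen hK
      obtain ⟨F', hE, hF'⟩ := hs.step h hS h1 hgen hbS hbK
      have hlt : K < ext K b := lt_of_le_of_ne (le_ext K b) (fun e => hbK (e ▸ mem_ext K b))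
      have hidx := Subgroup.index_strictAnti hlt
      obtain ⟨F'', hE', hF''⟩ := ih ((⊤ : Subgroup G).index + (ext K b).index) (by omega) (h.eqv hE) hF' rfl
      exact ⟨F'', hE.trans hE', hF''⟩

end grp
end HamSp


/-! Part 10 -/
set_option linter.unusedSectionVars false
set_option linter.unusedSimpArgs false
set_option linter.unusedVariables false
namespace HamSp
section grp
variable {G : Type*} [CommGroup G] [Finite G]

theorem exp_fun (s : G) (g : ℕ → ZMod 2) : ∃ φ : G → ZMod 2, ∀ j < orderOf s, φ (s ^ j) = g j := by
  refine ⟨fun x => g (Function.invFunOn (fun n : ℕ => s ^ n) (Set.Iio (orderOf s)) x), ?_⟩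
  intro j hj
  have := (pow_injOn_Iio_orderOf (x := s)).leftInvOn_invFunOn
  exact congrArg g (this (show j ∈ Set.Iio (orderOf s) from hj))

theorem exp_ex {s z : G} (hz : z ∈ Subgroup.zpowers s) : ∃ j < orderOf s, z = s ^ j := by
  classical
  rw [mem_zpowers_iff_mem_range_orderOf] at hz
  simp only [Finset.mem_image, Finset.mem_range] at hz
  obtain ⟨k, hk, h⟩ := hz
  exact ⟨k, hk, h.symm⟩

theorem cyc_gauge (s : G) (F : G → G → ZMod 2) :
    ∃ φ, ∀ j, j + 1 < orderOf s → gau F φ (s ^ j) (s ^ (j + 1)) = 0 := by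
  obtain ⟨φ, hφ⟩ := exp_fun s (fun j => ∑ i ∈ Finset.range j, F (s ^ i) (s ^ (i + 1)))
  refine ⟨φ, fun j hj => ?_⟩
  rw [gau, hφ j (by omega), hφ (j + 1) hj, Finset.sum_range_succ]
  grind

theorem pow_last (s : G) : s ^ (orderOf s - 1) * s = 1 := by
  rw [← pow_succ, Nat.sub_add_cancel (orderOf_pos s), pow_orderOf_eq_one]

/-- all s-edges zero from nonwrap zero and wrap zero -/
theorem cyc_zero {s : G} {F : G → G → ZMod 2} (hs : ∀ x y, F x y = F y x)
    (h : ∀ j, j + 1 < orderOf s → F (s ^ j) (s ^ (j + 1)) = 0)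
    (hw : F (s ^ (orderOf s - 1)) 1 = 0) :
    ∀ z ∈ Subgroup.zpowers s, ∀ a ∈ ({s, s⁻¹} : Set G), F z (z * a) = 0 := by
  have h1 : ∀ z ∈ Subgroup.zpowers s, F z (z * s) = 0 := by
    intro z hz
    obtain ⟨j, hj, rfl⟩ := exp_ex hz
    by_cases hj' : j + 1 < orderOf s
    · rw [← pow_succ]; exact h j hj'
    · have : j = orderOf s - 1 := by omega
      rw [this, pow_last]; exact hw
  intro z hz a ha
  rcases ha with rfl | rfl
  · exact h1 z hz
  · have := h1 (z * s⁻¹) (Subgroup.mul_mem _ hz (by simp))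
    rw [hs]; simpa using this

theorem base_odd {S : Set G} {F : G → G → ZMod 2} (h : Good S F) (s : G)
    (ho : Odd (orderOf s)) :
    ∃ F', Eqv F F' ∧ ∀ z ∈ Subgroup.zpowers s, ∀ a ∈ ({s, s⁻¹} : Set G), F' z (z * a) = 0 := by
  obtain ⟨φ, hφ⟩ := cyc_gauge s F
  obtain ⟨c, hc⟩ := exp_fun s (fun j => (j : ZMod 2))
  have hE := (Eqv.gau F φ).trans (Eqv.cdef (gau F φ) c (gau F φ (s ^ (orderOf s - 1)) 1))
  refine ⟨_, hE, ?_⟩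
  have hG := h.eqv hE
  have hm := orderOf_pos s
  have hc1 : c 1 = 0 := by have := hc 0 hm; simpa using this
  refine cyc_zero hG.symm ?_ ?_
  · intro j hj
    simp only [hφ j hj, cdef, hc j (by omega), hc (j + 1) hj, Nat.cast_add, Nat.cast_one]
    grind
  · simp only [cdef, hc _ (Nat.sub_lt hm one_pos), hc1]
    obtain ⟨k, hk⟩ := ho
    rw [hk]
    have : ((2 * k + 1 - 1 : ℕ) : ZMod 2) = 0 := by
      simp only [Nat.add_sub_cancel, Nat.cast_mul]
      have : ((2 : ℕ) : ZMod 2) = 0 := rfl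
      rw [this, zero_mul]
    rw [this]
    grind

theorem disj_img {α β : Type*} {f : α → β} {W U V : Set α} (hf : Set.InjOn f W) (hU : U ⊆ W) (hV : V ⊆ W)
    (h : Disjoint U V) : Disjoint (f '' U) (f '' V) := by
  rw [Set.disjoint_left]
  rintro _ ⟨a, ha, rfl⟩ ⟨b, hb, hab⟩
  have := hf (hV hb) (hU ha) hab
  subst this
  exact Set.disjoint_left.1 h ha hb

theorem base_even {S : Set G} {F : G → G → ZMod 2} (h : Good S F) (hS : Sy S)
    (hgen : Subgroup.closure S = ⊤) {s b : G} (hsS : s ∈ S)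
    (hbS : b ∈ S) (hbK : b ∉ Subgroup.zpowers s) (he : Even (orderOf s)) (hm : 3 ≤ orderOf s) :
    ∃ F', Eqv F F' ∧ ∀ z ∈ Subgroup.zpowers s, ∀ a ∈ ({s, s⁻¹} : Set G), F' z (z * a) = 0 := by
  obtain ⟨φ, hφ⟩ := cyc_gauge s F
  have hn := idx_two hbK
  have hf : Free (Subgroup.zpowers s) b 2 := (free_idx _ b).mono hn
  obtain ⟨ψ, hψ, hZ⟩ := rowGauge (h.gau φ).flat (A := ∅) (K := Subgroup.zpowers s) (by simp) (by simp) hbS hbK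
    (by simp) 1 hf
  have hE : Eqv F (gau (gau F φ) ψ) := (Eqv.gau F φ).trans (Eqv.gau _ ψ)
  refine ⟨_, hE, ?_⟩
  have hG := h.eqv hE
  have hφ' : ∀ j, j + 1 < orderOf s → gau (gau F φ) ψ (s ^ j) (s ^ (j + 1)) = 0 := by
    intro j hj
    rw [gau, hφ j hj, hψ _ (by simp), hψ _ (by simp)]; rfl
  set F1 := gau (gau F φ) ψ with hF1
  refine cyc_zero hG.symm hφ' ?_
  have hcol : ∀ z ∈ Subgroup.zpowers s, F1 z (z * b) = 0 := fun z hz => hZ.col 0 (by omega) z (by simpa using hz)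
  have hrow : ∀ z ∈ Subgroup.zpowers s, F1 (z * b) (z * b * s) = F1 z (z * s) := by
    intro z hz
    have := hG.flat z s hsS b hbS (ne_of_K (by simp) hbK).1 (ne_of_K (by simp) hbK).2
    rw [hcol z hz, hcol (z * s) (Subgroup.mul_mem _ hz (by simp))] at this
    grind
  have hq : ∀ p q : ℤ × ℤ, (0 ≤ p.1 ∧ p.1 < 2) ∧ 0 ≤ p.2 ∧ p.2 < orderOf s →
      (0 ≤ q.1 ∧ q.1 < 2) ∧ 0 ≤ q.2 ∧ q.2 < orderOf s → GR 0 p q → Qz S F1 (cy b s p) (cy b s q) := by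
    have h1 : ∀ p q : ℤ × ℤ, (0 ≤ p.1 ∧ p.1 < 2) ∧ 0 ≤ p.2 ∧ p.2 < orderOf s →
      (0 ≤ q.1 ∧ q.1 < 2) ∧ 0 ≤ q.2 ∧ q.2 < orderOf s → ((q.1 = p.1 ∧ q.2 = p.2 + 1) ∨ (q.1 = p.1 + 1 ∧ q.2 = p.2)) →
        Qz S F1 (cy b s p) (cy b s q) := by
      rintro ⟨i, j⟩ ⟨i', j'⟩ hp hq hc
      simp only at hc
      rcases hc with ⟨rfl, rfl⟩ | ⟨rfl, rfl⟩
      · have e : cy b s (i', j + 1) = cy b s (i', j) * s := by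
          simp only [cy, zpow_add, zpow_one, mul_assoc]
        refine ⟨by rw [e]; exact L_right _ hsS, ?_⟩
        simp only at hp hq
        have e0 : F1 (s ^ j) (s ^ j * s) = 0 := by
          have := hφ' j.toNat (by omega)
          rw [pow_succ, ← zpow_natCast, Int.toNat_of_nonneg hp.2.1] at this
          exact this
        obtain rfl | rfl : i' = 0 ∨ i' = 1 := by omega
        · rw [e]; simpa [cy] using e0
        · rw [e]
          have := hrow (s ^ j) (by simp)
          simp only [cy, zpow_one]
          rw [mul_comm b, this, e0]
      · simp only at hp hq
        obtain rfl : i = 0 := by omega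
        have e : cy b s (0 + 1, j') = cy b s (0, j') * b := by simp [cy, mul_comm]
        rw [e]
        refine ⟨L_right _ hbS, ?_⟩
        have := hcol (s ^ j') (by simp)
        simpa [cy] using this
    intro p q hp hq hpq
    have : ((q.1 = p.1 ∧ q.2 = p.2 + 1) ∨ (q.1 = p.1 + 1 ∧ q.2 = p.2)) ∨
      ((p.1 = q.1 ∧ p.2 = q.2 + 1) ∨ (p.1 = q.1 + 1 ∧ p.2 = q.2)) := by
      rcases hpq with h | h <;> omega
    rcases this with h2 | h2
    · exact h1 p q hp hq h2
    · exact Qz_symm hS hG.symm _ _ (h1 q p hq hp h2)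
  have hinj := cy_inj hf 0
  simp only [zero_add] at hinj
  have him := cy_image b s 2 0
  simp only [zero_add] at him
  obtain ⟨r, hr⟩ := he
  set m : ℤ := (orderOf s : ℤ) with hmdef
  have hm3 : (3 : ℤ) ≤ m := by omega
  set W : Set (ℤ × ℤ) := {p | (0 ≤ p.1 ∧ p.1 < (2 : ℕ)) ∧ 0 ≤ p.2 ∧ p.2 < m} with hW
  -- map a grid path into the group
  have mp : ∀ {U : Set (ℤ × ℤ)} {p q : ℤ × ℤ}, U ⊆ W → EP (GR 0) U p q → EP (Qz S F1) (cy b s '' U) (cy b s p) (cy b s q) := by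
    intro U p q hU hp
    exact hp.map _ (hinj.mono hU) (fun a ha b hb hab => hq a b (by simpa [hW] using hU ha) (by simpa [hW] using hU hb) hab)
  -- H path
  have H1 := (hsegZ 0 (fun p q h => h) 1 1 (m - 1) (by omega)).append (R := GR 0) (z := (0, m - 1)) (by simp [GR])
    (hsegR 0 (fun p q h => h) 0 0 (m - 1) (by omega)) (by
      rw [Set.disjoint_left]; rintro ⟨a, b⟩; simp; omega)
  have H2 := H1.append (z := (1, 0)) (w := (1, 0)) (by simp [GR]) (EP.single _) (by
      rw [Set.disjoint_left]; rintro ⟨a, b⟩; simp; omega)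
  have H3 := (H2.congr (V := W) (by ext ⟨a, b⟩; simp [hW]; omega))
  have H4 := (mp le_rfl H3).toHPQ
  -- Z path
  have Z0 := zz 0 (fun p q h => h) 0 1 2 (by omega) (r - 2)
  have hr2 : 2 ≤ r := by omega
  have Z1 := ((EP.single (R := GR 0) (1, 1)).append (z := (0, 1)) (by simp [GR]) (EP.single _) (by simp)).append
    (by simp [GR]) Z0 (by rw [Set.disjoint_left]; rintro ⟨a, b⟩; simp; omega)
  have Z2 := (EP.single (R := GR 0) (0, 0)).append (z := (1, 0)) (by simp [GR]) (EP.single _) (by simp)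
  have e1 : (2 + 2 * ((r - 2 : ℕ) : ℤ) + 1) = m - 1 := by omega
  rw [e1] at Z1
  have Z1' := (mp (by rintro ⟨a, b⟩; simp [hW]; omega) Z1).toHPQ
  have Z2' := (mp (by rintro ⟨a, b⟩; simp [hW]; omega) Z2).toHPQ
  have elast : cy b s (0, m - 1) * s = cy b s (0, 0) := by
    simp only [cy, zpow_sub, hmdef, zpow_natCast, pow_orderOf_eq_one]; simp
  have Z3 := Z1'.append (by rw [← elast]; exact L_right _ hsS) Z2' (by
    refine disj_img hinj (by rintro ⟨a, b⟩; simp [hW]; omega) (by rintro ⟨a, b⟩; simp [hW]; omega) ?_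
    rw [Set.disjoint_left]; rintro ⟨a, b⟩; simp; omega)
  rw [← Set.image_union] at Z3
  have Z4 := Z3.congr (V := cy b s '' W) (by congr 1; ext ⟨a, b⟩; simp [hW]; omega) rfl
  rw [him] at Z4 H4
  have hbr := br_strip hS hgen (RE_single (s := s) (by rintro rfl; simp at hm)) (A := {s, s⁻¹}) (by
    rintro x (rfl | rfl)
    · exact hsS
    · exact hS _ hsS) hbS hbK 2 (by omega) hf (a := s) (by simp)
  have c1 : cy b s (1, 1) = b ^ (2 - 1) * s := by simp [cy]
  have c0 : cy b s (1, 0) = b ^ (2 - 1) := by simp [cy]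
  rw [c1, c0] at Z4 H4
  have := hG.br hS (L_symm hS _ _ (L_right _ hsS)) hbr (Z4.reverse (L_symm hS) hG.symm) (H4.reverse (L_symm hS) hG.symm)
  have e2 : cy b s (0, m - 1) = s ^ (orderOf s - 1) := by
    have : m - 1 = ((orderOf s - 1 : ℕ) : ℤ) := by omega
    rw [this]; simp [cy]
  have e3 : cy b s (0, 0) = 1 := by simp [cy]
  rw [e2, e3] at this
  simpa using this

end grp
end HamSp


/-! Part 11 -/
set_option linter.unusedSectionVars false
set_option linter.unusedSimpArgs false
set_option linter.unusedVariables false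
namespace HamSp
section grp
variable {G : Type*} [CommGroup G] [Finite G]

theorem seg {S : Set G} (F : G → G → ZMod 2) {t : G} (ht : t ∈ S) (n : ℕ) (hn : n < orderOf t) :
    HP (L S) F {z | ∃ j ≤ n, z = t ^ j} 1 (t ^ n) (∑ i ∈ Finset.range n, F (t ^ i) (t ^ (i + 1))) := by
  induction n with
  | zero =>
    have h := (HP.single (R := L S) (f := F) (1 : G)).congr (V := {z | ∃ j ≤ 0, z = t ^ j}) (by ext z; simp) rfl
    rw [pow_zero, Finset.sum_range_zero]; exact h
  | succ n ih =>
    have h1 := (ih (by omega)).append (z := t ^ (n + 1)) (by rw [pow_succ]; exact L_right _ ht) (HP.single _) (by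
      rw [Set.disjoint_left]
      rintro z ⟨j, hj, rfl⟩ h2
      have := pow_injOn_Iio_orderOf (x := t) (show j < orderOf t by omega) hn h2
      omega)
    refine h1.congr ?_ (by rw [Finset.sum_range_succ, add_zero])
    ext z
    simp only [Set.mem_union, Set.mem_ofPred_eq, Set.mem_singleton_iff]
    constructor
    · rintro (⟨j, hj, rfl⟩ | rfl)
      · exact ⟨j, by omega, rfl⟩
      · exact ⟨n + 1, le_rfl, rfl⟩
    · rintro ⟨j, hj, rfl⟩
      by_cases h : j ≤ n
      · exact .inl ⟨j, h, rfl⟩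
      · exact .inr (by congr 1; omega)

theorem ham_gen {S : Set G} (F : G → G → ZMod 2) {t : G} (ht : t ∈ S) (htop : Subgroup.zpowers t = ⊤) :
    Ham S F (∑ i ∈ Finset.range (orderOf t - 1), F (t ^ i) (t ^ (i + 1)) + F (t ^ (orderOf t - 1)) 1) := by
  have hp := orderOf_pos t
  have h1 := seg F ht (orderOf t - 1) (by omega)
  refine ⟨1, t ^ (orderOf t - 1), _, h1.congr ?_ rfl, ?_, rfl⟩
  · ext z
    simp only [Set.mem_ofPred_eq, Set.mem_univ, iff_true]
    obtain ⟨j, hj, rfl⟩ := exp_ex (s := t) (z := z) (by rw [htop]; trivial)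
    exact ⟨j, by omega, rfl⟩
  · have := L_right (A := S) (t ^ (orderOf t - 1)) ht
    rwa [pow_last] at this

theorem ham_gen_const {S : Set G} {F : G → G → ZMod 2} {t : G} (ht : t ∈ S) (htop : Subgroup.zpowers t = ⊤)
    {h : ZMod 2} (hc : ∀ z, F z (z * t) = h) : Ham S F (orderOf t * h) := by
  have h1 := ham_gen F ht htop
  have hp := orderOf_pos t
  have : ∑ i ∈ Finset.range (orderOf t - 1), F (t ^ i) (t ^ (i + 1)) + F (t ^ (orderOf t - 1)) 1 = orderOf t * h := by
    rw [Finset.sum_congr rfl (fun i _ => by rw [pow_succ, hc])]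
    have h2 := hc (t ^ (orderOf t - 1))
    rw [pow_last] at h2
    rw [h2]
    simp only [Finset.sum_const, Finset.card_range, nsmul_eq_mul]
    obtain ⟨k, hk⟩ : ∃ k, orderOf t = k + 1 := ⟨orderOf t - 1, by omega⟩
    rw [hk]; simp; ring
  rwa [this] at h1

theorem flat_const {S : Set G} {F : G → G → ZMod 2} (hF : Fl S F) {s : G} (hs1 : s ≠ 1) (hsS : s ∈ S)
    (hS : Sy S) (htop : Subgroup.zpowers s = ⊤)
    (hz : ∀ z, ∀ a ∈ ({s, s⁻¹} : Set G), F z (z * a) = 0) {t : G} (ht : t ∈ S) (h1 : t ≠ s) (h2 : t ≠ s⁻¹) :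
    ∀ z, F z (z * t) = F 1 t := by
  have := (RE_single hs1).induct (P := fun z => F z (z * t) = F 1 t) (by simp) (by
    intro z _ a ha ih
    have haS : a ∈ S := by
      rcases ha with rfl | rfl
      · exact hsS
      · exact hS _ hsS
    have h3 := hF z a haS t ht (by rcases ha with rfl | rfl <;> assumption)
      (by rcases ha with rfl | rfl
          · assumption
          · simpa using h1)
    rw [hz z a ha, hz (z * t) a ha, ih] at h3
    grind)
  intro z
  exact this z (by rw [htop]; trivial)

theorem cyc_odd_all {S : Set G} {F : G → G → ZMod 2} (h : Good S F) (hS : Sy S) {s : G} (hs1 : s ≠ 1) (hsS : s ∈ S)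
    (hall : ∀ t ∈ S, Subgroup.zpowers t = ⊤) (ho : Odd (Nat.card G))
    (hz : ∀ z, ∀ a ∈ ({s, s⁻¹} : Set G), F z (z * a) = 0) : ∀ t ∈ S, ∀ z, F z (z * t) = 0 := by
  intro t ht z
  by_cases h1 : t = s
  · exact hz z t (by simp [h1])
  by_cases h2 : t = s⁻¹
  · exact hz z t (by simp [h2])
  have hc := flat_const h.flat hs1 hsS hS (hall s hsS) hz ht h1 h2
  have e1 := ham_gen_const ht (hall t ht) hc
  have e2 := ham_gen_const (h := 0) hsS (hall s hsS) (fun z => hz z s (by simp))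
  have := h.ham e1 e2
  have hot : (orderOf t : ZMod 2) = 1 := by
    have : orderOf t = Nat.card G := by
      rw [← Nat.card_zpowers, hall t ht, Subgroup.card_top]
    rw [this, ZMod.natCast_eq_one_iff_odd]; exact ho
  rw [hot] at this
  rw [hc z]; simpa using this

theorem grad_path {α : Type*} {R : α → α → Prop} {U : Set α} {x y : α} (h : EP R U x y) (φ : α → ZMod 2) :
    HP R (fun a b => φ a + φ b) U x y (φ x + φ y) := by
  have := (h.toHP_zero (f := fun _ _ => 0) (by simp)).gauge φ
  simpa using this

theorem comb_grid (k : ℕ) : EP (GR 0) {p : ℤ × ℤ | (0 ≤ p.1 ∧ p.1 < 2) ∧ 0 ≤ p.2 ∧ p.2 < 2 * k + 3} (0, 0) (1, 2 * k + 2) := by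
  have h1 := zz 0 (fun p q h => h) 0 1 0 (by omega) k
  have h2 := (h1.append (z := (0, 2 * (k : ℤ) + 2)) (by simp [GR]; try omega) (EP.single _) (by simp; try omega)).append
    (z := (1, 2 * (k : ℤ) + 2)) (by simp [GR]) (EP.single _) (by simp)
  refine h2.congr ?_
  ext ⟨a, b⟩; simp; omega

theorem cyc_even_all {S : Set G} {F : G → G → ZMod 2} (h : Good S F) (hS : Sy S) {s : G} (hsS : s ∈ S)
    (htop : Subgroup.zpowers s = ⊤) (he : Even (orderOf s)) (hm : 3 ≤ orderOf s)
    (hodd : ∀ k : ℕ, s ^ k ∈ S → Odd k) (hinv : ∀ t ∈ S, t * t ≠ 1) :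
    ∃ F', Eqv F F' ∧ ∀ z, ∀ t ∈ S, F' z (z * t) = 0 := by
  obtain ⟨φ, hφ⟩ := cyc_gauge s F
  refine ⟨_, Eqv.gau F φ, ?_⟩
  have hG := h.gau φ
  set F1 := gau F φ with hF1
  have hs1 : s ≠ 1 := by rintro rfl; simp at hm
  have hcard : Nat.card G = orderOf s := by
    rw [← Nat.card_zpowers, htop, Subgroup.card_top]
  obtain ⟨v, hv0, hv⟩ := hG.eq
  rw [hcard] at hv0
  have hv0 := hv0 he
  subst hv0
  have hz : ∀ z, ∀ a ∈ ({s, s⁻¹} : Set G), F1 z (z * a) = 0 := by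
    have := cyc_zero hG.symm hφ (by
      have := hv _ (ham_gen F1 hsS htop)
      rw [Finset.sum_eq_zero (fun i hi => hφ i (by simp at hi; omega))] at this
      simpa using this)
    intro z; exact this z (by rw [htop]; trivial)
  -- main: exponent k with 2k < m
  have main : ∀ k : ℕ, 2 * k < orderOf s → s ^ k ∈ S → ∀ z, F1 z (z * s ^ k) = 0 := by
    intro k hk hkS
    obtain ⟨k', hk'⟩ := hodd k hkS
    by_cases hk0 : k' = 0
    · subst hk0; subst hk'
      intro z; exact hz z _ (by simp)
    have hk1 : s ^ k ≠ s := by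
      intro h
      have := pow_injOn_Iio_orderOf (x := s) (show k < orderOf s by omega) (show 1 < orderOf s by omega) (by simpa using h)
      omega
    have hk2 : s ^ k ≠ s⁻¹ := by
      intro h
      have h3 : s ^ (k + 1) = 1 := by rw [pow_succ, h]; simp
      have := Nat.le_of_dvd (by omega) (orderOf_dvd_of_pow_eq_one h3)
      omega
    have hc := flat_const hG.flat hs1 hsS hS htop hz hkS hk1 hk2
    obtain ⟨kk, rfl⟩ : ∃ kk, k' = kk + 1 := ⟨k' - 1, by omega⟩
    set e := F1 1 (s ^ k) with he
    have hg := grad_path (comb_grid kk) (fun p => e * (p.1 : ZMod 2))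
    set m : ℤ := (orderOf s : ℤ) with hmdef
    have hsmod : ∀ a b : ℤ, 0 ≤ a → a < m → 0 ≤ b → b < m → s ^ a = s ^ b → a = b := by
      intro a b ha ha' hb hb' hab
      rw [zpow_eq_zpow_iff_modEq] at hab
      have := Int.ModEq.eq hab
      rwa [Int.emod_eq_of_lt ha ha', Int.emod_eq_of_lt hb hb'] at this
    have hg2 := hg.map (Q := L S) (f' := F1) (fun p : ℤ × ℤ => s ^ (k * p.1 + p.2)) (by
      rintro ⟨a, b⟩ hp ⟨a', b'⟩ hp' hpp
      simp only [Set.mem_ofPred_eq] at hp hp' hpp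
      obtain rfl | rfl : a = 0 ∨ a = 1 := by omega
      all_goals
        obtain rfl | rfl : a' = 0 ∨ a' = 1 := by omega
        all_goals
          have := hsmod _ _ (by omega) (by omega) (by omega) (by omega) hpp
          simp; omega) ?_ ?_
    rotate_left
    · rintro ⟨a, b⟩ hp ⟨a', b'⟩ hp' hpp
      simp only [GR] at hpp
      have hor : (a = a' ∧ (b' = b + 1 ∨ b = b' + 1)) ∨ (b = b' ∧ (a' = a + 1 ∨ a = a' + 1)) := by
        rcases hpp with h | h <;> omega
      rcases hor with ⟨rfl, rfl | rfl⟩ | ⟨rfl, rfl | rfl⟩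
      · rw [← add_assoc, zpow_add_one]; exact L_right _ hsS
      · rw [← add_assoc, zpow_add_one]; exact L_symm hS _ _ (L_right _ hsS)
      · have : s ^ ((k : ℤ) * (a + 1) + b) = s ^ ((k : ℤ) * a + b) * s ^ k := by
          rw [← zpow_natCast, ← zpow_add]; congr 1; ring
        simp only [this]; exact L_right _ hkS
      · have : s ^ ((k : ℤ) * (a' + 1) + b) = s ^ ((k : ℤ) * a' + b) * s ^ k := by
          rw [← zpow_natCast, ← zpow_add]; congr 1; ring
        simp only [this]; exact L_symm hS _ _ (L_right _ hkS)
    · rintro ⟨a, b⟩ hp ⟨a', b'⟩ hp' hpp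
      simp only [GR] at hpp
      have hor : (a = a' ∧ (b' = b + 1 ∨ b = b' + 1)) ∨ (b = b' ∧ (a' = a + 1 ∨ a = a' + 1)) := by
        rcases hpp with h | h <;> omega
      rcases hor with ⟨rfl, rfl | rfl⟩ | ⟨rfl, rfl | rfl⟩
      · simp only [← add_assoc, zpow_add_one]; rw [hz _ s (by simp)]; grind
      · simp only [← add_assoc, zpow_add_one]; rw [hG.symm, hz _ s (by simp)]; grind
      · have : s ^ ((k : ℤ) * (a + 1) + b) = s ^ ((k : ℤ) * a + b) * s ^ k := by
          rw [← zpow_natCast, ← zpow_add]; congr 1; ring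
        simp only [this, hc, Int.cast_add, Int.cast_one]; grind
      · have : s ^ ((k : ℤ) * (a' + 1) + b) = s ^ ((k : ℤ) * a' + b) * s ^ k := by
          rw [← zpow_natCast, ← zpow_add]; congr 1; ring
        simp only [this]; rw [hG.symm]; simp only [hc, Int.cast_add, Int.cast_one]; grind
    -- tail
    have ht := (hsegZ 0 (fun p q h => h) 0 (2 * k) (m - 1) (by omega)).map (Q := Qz S F1) (fun p : ℤ × ℤ => s ^ p.2) (by
      rintro ⟨a, b⟩ hp ⟨a', b'⟩ hp' hpp
      simp only [Set.mem_ofPred_eq] at hp hp' hpp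
      have := hsmod _ _ (by omega) (by omega) (by omega) (by omega) hpp
      simp; omega) (by
      rintro ⟨a, b⟩ hp ⟨a', b'⟩ hp' hpp
      simp only [Set.mem_ofPred_eq] at hp hp'
      have hor : b' = b + 1 ∨ b = b' + 1 := by
        simp only [GR] at hpp; omega
      rcases hor with rfl | rfl
      · rw [zpow_add_one]; exact ⟨L_right _ hsS, hz _ s (by simp)⟩
      · rw [zpow_add_one]; exact Qz_symm hS hG.symm _ _ ⟨L_right _ hsS, hz _ s (by simp)⟩)
    have hlink : s ^ ((k : ℤ) * 1 + (2 * kk + 2)) * s = s ^ (2 * (k : ℤ)) := by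
      rw [← zpow_add_one]; congr 1; omega
    have hfull := hg2.append (by simp only [← hlink]; exact L_right _ hsS) ht.toHPQ (by
      rw [Set.disjoint_left]
      rintro z ⟨⟨a, b⟩, hp, rfl⟩ ⟨⟨a', b'⟩, hp', hpp⟩
      simp only [Set.mem_ofPred_eq] at hp hp' hpp
      obtain rfl | rfl : a = 0 ∨ a = 1 := by omega
      all_goals
        have := hsmod _ _ (by omega) (by omega) (by omega) (by omega) hpp
        omega)
    have hham : Ham S F1 _ := ⟨_, _, _, hfull.congr (V := Set.univ) ?_ rfl, ?_, rfl⟩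
    · have e1 := hv _ hham
      have e2 : s ^ ((0 : ℤ × ℤ).2) = s ^ (m - 1) * s := by
        rw [← zpow_add_one]; simp [hmdef, pow_orderOf_eq_one]
      have e3 : F1 (s ^ (m - 1)) (s ^ ((k : ℤ) * 0 + 0)) = 0 := by
        have := hz (s ^ (m - 1)) s (by simp)
        rw [← e2] at this; simpa using this
      have e4 : F1 (s ^ ((k : ℤ) * 1 + (2 * kk + 2))) (s ^ (2 * (k : ℤ))) = 0 := by
        rw [← hlink]; exact hz _ s (by simp)
      simp only [e3, e4] at e1
      intro z
      rw [hc]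
      simpa using e1
    · rw [Set.eq_univ_iff_forall]
      intro z
      obtain ⟨j, hj, rfl⟩ := exp_ex (s := s) (z := z) (by rw [htop]; trivial)
      by_cases hj1 : j < k
      · exact .inl ⟨(0, j), by simp; omega, by simp⟩
      by_cases hj2 : j < 2 * k
      · exact .inl ⟨(1, j - k), by simp; omega, by simp⟩
      · exact .inr ⟨(0, j), by simp; omega, by simp⟩
    · have : s ^ ((k : ℤ) * 0 + 0) = s ^ (m - 1) * s := by
        rw [← zpow_add_one]; simp [hmdef, pow_orderOf_eq_one]
      simp only [this]
      exact L_right _ hsS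
  intro z t ht
  obtain ⟨k, hk, rfl⟩ := exp_ex (s := s) (z := t) (by rw [htop]; trivial)
  by_cases hk2 : 2 * k < orderOf s
  · exact main k hk2 ht z
  have hk3 : 2 * k ≠ orderOf s := by
    intro h3
    apply hinv _ ht
    rw [← pow_add, ← two_mul, h3, pow_orderOf_eq_one]
  have hi : (s ^ k)⁻¹ = s ^ (orderOf s - k) := by
    rw [inv_eq_iff_mul_eq_one, ← pow_add, show k + (orderOf s - k) = orderOf s by omega, pow_orderOf_eq_one]
  have := main (orderOf s - k) (by omega) (hi ▸ hS _ ht) (z * s ^ k)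
  rw [← hi, hG.symm] at this
  simpa using this

end grp
end HamSp


/-! Part 12 -/
set_option linter.unusedSectionVars false
set_option linter.unusedSimpArgs false
set_option linter.unusedVariables false
namespace HamSp
section grp
variable {G : Type*} [CommGroup G] [Finite G]

theorem base_two {S : Set G} {F : G → G → ZMod 2} (h : Good S F) (h1 : (1 : G) ∉ S) {s : G} (hs : s ∈ S)
    (hss : s * s = 1) : ∃ F', Eqv F F' ∧ State S (Subgroup.zpowers s) F' := by
  classical
  have hs1 : s ≠ 1 := fun h => h1 (h ▸ hs)
  have hmem : ∀ z ∈ Subgroup.zpowers s, z = 1 ∨ z = s := by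
    intro z hz
    obtain ⟨j, hj, rfl⟩ := exp_ex hz
    have : orderOf s ≤ 2 := orderOf_le_of_pow_eq_one (by norm_num) (by rw [pow_two, hss])
    obtain rfl | rfl : j = 0 ∨ j = 1 := by omega
    · simp
    · simp
  have hset : (Subgroup.zpowers s : Set G) = {1, s} := by
    ext z
    simp only [SetLike.mem_coe, Set.mem_insert_iff, Set.mem_singleton_iff]
    exact ⟨hmem z, by rintro (rfl | rfl) <;> simp⟩
  refine ⟨gau F (fun x => if x = s then F 1 s else 0), Eqv.gau F _, .inr ⟨fun x => if x = s then 1 else 0, ⟨?_, ?_⟩, s, hs, by simp⟩, ?_⟩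
  · intro z hz t ht htK
    obtain rfl : t = s := by
      rcases hmem t htK with rfl | rfl
      · exact absurd ht h1
      · rfl
    rcases hmem z hz with rfl | rfl
    · simp [Ne.symm hs1]
    · simp [hss, Ne.symm hs1]; grind
  · intro y hy hc
    rcases hmem y hy with rfl | rfl
    · simp at hc
    · rw [hset]
      exact EP.cons (by simpa using hs1.symm) (by simpa [L] using hs) (EP.single y)
  · intro z hz t ht htK
    obtain rfl : t = s := by
      rcases hmem t htK with rfl | rfl
      · exact absurd ht h1
      · rfl
    rcases hmem z hz with rfl | rfl
    · simp [gau, Ne.symm hs1]; grind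
    · have := h.symm z 1
      simp [gau, hss, Ne.symm hs1, this]; grind

theorem partII {S : Set G} {F : G → G → ZMod 2} (h : Good S F) (hS : Sy S) (h1 : (1 : G) ∉ S)
    (hgen : Subgroup.closure S = ⊤) (hne : S.Nonempty) :
    ∃ F', Eqv F F' ∧ ∀ z, ∀ t ∈ S, F' z (z * t) = 0 := by
  have fin : ∀ {K : Subgroup G} {F1 : G → G → ZMod 2}, Eqv F F1 → State S K F1 →
      ∃ F', Eqv F F' ∧ ∀ z, ∀ t ∈ S, F' z (z * t) = 0 := by
    intro K F1 hE hst
    obtain ⟨F', hE', hF'⟩ := hst.finish (h.eqv hE) hS h1 hgen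
    exact ⟨F', hE.trans hE', fun z t ht => hF'.2 z trivial t ht trivial⟩
  have hpair : ∀ s ∈ S, ({s, s⁻¹} : Set G) ⊆ S := by
    rintro s hs x (rfl | rfl)
    · exact hs
    · exact hS _ hs
  by_cases hinv : ∃ s ∈ S, s * s = 1
  · obtain ⟨s, hs, hss⟩ := hinv
    obtain ⟨F1, hE, hst⟩ := base_two h h1 hs hss
    exact fin hE hst
  push Not at hinv
  have hord : ∀ s ∈ S, 3 ≤ orderOf s := by
    intro s hs
    have e0 := orderOf_pos s
    by_contra hlt
    have : orderOf s ∣ 2 := by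
      obtain h | h : orderOf s = 1 ∨ orderOf s = 2 := by omega
      · simp [h]
      · simp [h]
    exact hinv s hs (by rw [← pow_two]; exact orderOf_dvd_iff_pow_eq_one.1 this)
  have hs1 : ∀ s ∈ S, s ≠ 1 := fun s hs h => h1 (h ▸ hs)
  by_cases hodd : ∃ s ∈ S, Odd (orderOf s) ∧ Subgroup.zpowers s ≠ ⊤
  · obtain ⟨s, hs, ho, hnt⟩ := hodd
    obtain ⟨b, hbS, hbK⟩ := exists_not_mem hgen hnt
    obtain ⟨F1, hE, hz⟩ := base_odd h s ho
    have k := kit_cyc hS hs (hord s hs)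
    have hev : Even (orderOf s) = False := by simpa using ho
    rw [hev] at k
    obtain ⟨F2, hE2, hst⟩ := step_n (h.eqv hE) hS h1 hgen k (.inr ⟨rfl, s, rfl, rfl, hs1 s hs, ho⟩) hbS hbK hz
    exact fin (hE.trans hE2) hst
  push Not at hodd
  by_cases hodd2 : ∃ s ∈ S, Odd (orderOf s)
  · obtain ⟨s, hs, ho⟩ := hodd2
    have htop := hodd s hs ho
    have hcard : Odd (Nat.card G) := by
      rw [← Subgroup.card_top, ← htop, Nat.card_zpowers]; exact ho
    obtain ⟨F1, hE, hz⟩ := base_odd h s ho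
    refine ⟨F1, hE, fun z t ht => ?_⟩
    refine cyc_odd_all (h.eqv hE) hS (hs1 s hs) hs (fun t ht => hodd t ht ?_) hcard (fun z => hz z (by rw [htop]; trivial)) t ht z
    exact hcard.of_dvd_nat (orderOf_dvd_natCard t)
  push Not at hodd2
  have heven : ∀ s ∈ S, Even (orderOf s) := fun s hs => by
    have := hodd2 s hs
    simpa using this
  obtain ⟨s, hs, hmin⟩ := (Set.toFinite S).exists_minimalFor orderOf S hne
  have hpow : ∀ k : ℕ, s ^ k ∈ S → Odd k := by
    intro k hk
    by_contra hke
    rw [Nat.not_odd_iff_even] at hke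
    obtain ⟨j, rfl⟩ := hke
    obtain ⟨m, hm⟩ := heven s hs
    have hp := orderOf_pos s
    have h2 : (s ^ (j + j)) ^ m = 1 := by
      rw [← pow_mul, show (j + j) * m = orderOf s * j by rw [hm]; ring, pow_mul, pow_orderOf_eq_one, one_pow]
    have h3 := orderOf_le_of_pow_eq_one (by omega) h2
    have h4 := hmin hk (by omega)
    omega
  by_cases htop : Subgroup.zpowers s = ⊤
  · exact cyc_even_all h hS hs htop (heven s hs) (hord s hs) hpow hinv
  · obtain ⟨b, hbS, hbK⟩ := exists_not_mem hgen htop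
    obtain ⟨F1, hE, hz⟩ := base_even h hS hgen hs hbS hbK (heven s hs) (hord s hs)
    have k := kit_cyc hS hs (hord s hs)
    have hev : Even (orderOf s) = True := by simpa using heven s hs
    rw [hev] at k
    obtain ⟨c, hc⟩ := exp_fun s (fun j => (j : ZMod 2))
    have hc' : ∀ j : ℕ, c (s ^ j) = j := by
      intro j
      rw [← pow_mod_orderOf, hc _ (Nat.mod_lt _ (orderOf_pos s))]
      have e := Nat.mod_add_div j (orderOf s)
      obtain ⟨m, hm⟩ := heven s hs
      have : ((j : ℕ) : ZMod 2) = ((j % orderOf s + orderOf s * (j / orderOf s) : ℕ) : ZMod 2) := by rw [e]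
      rw [this, Nat.cast_add, Nat.cast_mul, hm, Nat.cast_add]; grind
    obtain ⟨F2, hE2, hst⟩ := step_b (h.eqv hE) hS h1 hgen ⟨k, .inr ⟨rfl, s, rfl, rfl, heven s hs⟩⟩ (c0 := c) (by
      intro z hz t ht htK
      obtain ⟨i, _, rfl⟩ := exp_ex hz
      obtain ⟨j, _, rfl⟩ := exp_ex htK
      have ho := hpow j ht
      rw [← pow_add, hc', hc', Nat.cast_add, ZMod.natCast_eq_one_iff_odd.2 ho]) hbS hbK hz
    exact fin (hE.trans hE2) hst

end grp
end HamSp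


/-! Part 13 -/
set_option linter.unusedSectionVars false
set_option linter.unusedSimpArgs false
set_option linter.unusedVariables false
namespace HamSp
section grp
variable {G : Type*} [CommGroup G] [Finite G]

/-- symmetric labellings that vanish on every Hamilton cycle -/
structure Ann (S : Set G) (f : G → G → ZMod 2) : Prop where
  symm : ∀ x y, f x y = f y x
  ham : ∀ w, Ham S f w → w = 0

theorem Ann.trl {S : Set G} {f : G → G → ZMod 2} (h : Ann S f) (g : G) :
    Ann S (fun x y => f (g * x) (g * y)) where
  symm := fun x y => h.symm _ _
  ham := by
    rintro w ⟨x, y, u, k1, k2, rfl⟩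
    apply h.ham
    have := k1.map (Q := L S) (f' := f) (fun z => g * z) (by intro a _ b _ h; simpa using h)
      (fun a _ b _ h => (L_mul g a b).2 h) (fun _ _ _ _ _ => rfl)
    refine ⟨g * x, g * y, u, this.congr ?_ rfl, (L_mul _ _ _).2 k2, rfl⟩
    ext z
    simp only [Set.mem_image, Set.mem_univ, true_and, iff_true]
    exact ⟨g⁻¹ * z, by simp⟩

theorem Ann.br {S U : Set G} {f : G → G → ZMod 2} (h : Ann S f) (hS : Sy S) {x y : G} {v v' : ZMod 2}
    (hxy : L S y x)
    (hb : Br S U x y) (h1 : HP (L S) f U x y v) (h2 : HP (L S) f U x y v') : v = v' := by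
  have hh : ∀ {v v'}, Ham S f v → Ham S f v' → v = v' := fun a b => (h.ham _ a).trans (h.ham _ b).symm
  rcases hb with hb | ⟨p, q, hb, hp, hq⟩
  · have e : U = Set.univ := Set.compl_empty_iff.1 hb
    subst e
    have := hh ⟨x, y, v, h1, hxy, rfl⟩ ⟨x, y, v', h2, hxy, rfl⟩
    exact add_right_cancel this
  · obtain ⟨w, hw⟩ := hb.toHP f
    have hw := hw.reverse (L_symm hS) h.symm
    have hd : Disjoint U Uᶜ := disjoint_compl_right
    have k1 := (h1.append (L_symm hS _ _ hq) hw hd).congr (Set.union_compl_self U) rfl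
    have k2 := (h2.append (L_symm hS _ _ hq) hw hd).congr (Set.union_compl_self U) rfl
    have := hh ⟨x, p, _, k1, L_symm hS _ _ hp, rfl⟩ ⟨x, p, _, k2, L_symm hS _ _ hp, rfl⟩
    grind

/-- flatness of the square spanned by `s,t` -/
def K0 (S : Set G) (s t : G) : Prop :=
  ∀ f, Ann S f → ∀ g, f g (g * s) + f (g * t) (g * t * s) + f g (g * t) + f (g * s) (g * s * t) = 0

theorem K0.of_one {S : Set G} {s t : G}
    (h : ∀ f, Ann S f → f 1 s + f t (t * s) + f 1 t + f s (s * t) = 0) : K0 S s t := by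
  intro f hf g
  have := h _ (hf.trl g)
  simpa only [mul_one, mul_assoc] using this

theorem K0.swap {S : Set G} {s t : G} (h : K0 S s t) : K0 S t s := by
  intro f hf g
  have := h f hf g
  grind

theorem K0.inv {S : Set G} {s t : G} (h : K0 S s⁻¹ t) : K0 S s t := by
  intro f hf g
  have := h f hf (g * s)
  rw [show g * s * s⁻¹ = g by simp, show g * s * t * s⁻¹ = g * t by rw [mul_right_comm]; simp,
    show g * s * t = g * t * s from mul_right_comm _ _ _, hf.symm (g * s) g, hf.symm (g * t * s)] at this
  rw [show g * s * t = g * t * s from mul_right_comm _ _ _]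
  grind

theorem sw {S A B : Set G} (hS : Sy S) {s t x : G} (hs : s ∈ S) (ht : t ∈ S) (hd : Disjoint A B)
    (hu : A ∪ B = Set.univ) (hA : EP (L S) A (x * s) (x * t)) (hB : EP (L S) B (x * s * t) x) :
    K0 S s t := by
  have key : ∀ f, Ann S f → f x (x * s) + f (x * t) (x * t * s) + f x (x * t) + f (x * s) (x * s * t) = 0 := by
    intro f hf
    obtain ⟨u, hu1⟩ := hA.toHP f
    obtain ⟨v, hv⟩ := hB.toHP f
    have k1 := hu1.append (z := x * s * t) (by rw [mul_right_comm]; exact L_right _ hs) hv hd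
    have k2 := (hu1.reverse (L_symm hS) hf.symm).append (z := x * s * t) (L_right _ ht) hv hd
    have h1 := hf.ham _ ⟨_, _, _, k1.congr hu rfl, L_right _ hs, rfl⟩
    have h2 := hf.ham _ ⟨_, _, _, k2.congr hu rfl, L_right _ ht, rfl⟩
    rw [show x * t * s = x * s * t from mul_right_comm _ _ _]
    grind
  intro f hf g
  have := key _ (hf.trl (g * x⁻¹))
  simpa [mul_assoc] using this

/-- switch inside a subgroup, remaining vertices absorbed -/
theorem sw_sub {S T A B : Set G} (hS : Sy S) (hgen : Subgroup.closure S = ⊤) {K : Subgroup G} (hT : RE K T)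
    (hTS : T ⊆ S) {s t x : G} (hs : s ∈ S) (ht : t ∈ S) (hst : s ≠ t) (hd : Disjoint A B)
    (hu : A ∪ B = K) (hA : EP (L T) A (x * s) (x * t)) (hB : EP (L T) B (x * s * t) x) :
    K0 S s t := by
  have h1 := absorb hTS (br_all hS hgen K T hT hTS) (U := A) (by rw [← hu]; exact Set.subset_union_left) hA
    (by simpa using hst)
  have hBK : B ⊆ K := by rw [← hu]; exact Set.subset_union_right
  refine sw hS hs ht ?_ ?_ h1 (hB.monoL hTS)
  · rw [Set.disjoint_union_left]
    exact ⟨hd, Set.disjoint_left.2 fun z hz hz' => hz (hBK hz')⟩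
  · rw [Set.union_right_comm, hu, Set.union_compl_self]

theorem sw_sub' {S T A B : Set G} (hS : Sy S) (hgen : Subgroup.closure S = ⊤) {K : Subgroup G} (hT : RE K T)
    (hTS : T ⊆ S) {s t x : G} (hs : s ∈ S) (ht : t ∈ S) (hst : s * t ≠ 1) (hd : Disjoint A B)
    (hu : A ∪ B = K) (hA : EP (L T) A (x * s) (x * t)) (hB : EP (L T) B (x * s * t) x) :
    K0 S s t := by
  have h1 := absorb hTS (br_all hS hgen K T hT hTS) (U := B) (by rw [← hu]; exact Set.subset_union_right) hB
    (by rw [mul_assoc]; simpa using hst)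
  have hAK : A ⊆ K := by rw [← hu]; exact Set.subset_union_left
  refine sw hS hs ht ?_ ?_ (hA.monoL hTS) h1
  · rw [Set.disjoint_union_right]
    exact ⟨hd, Set.disjoint_left.2 fun z hz hz' => hz' (hAK hz)⟩
  · rw [← Set.union_assoc, hu, Set.union_compl_self]

theorem zpow_mem_iff (K : Subgroup G) (b : G) (i : ℤ) : b ^ i ∈ K ↔ (idx K b : ℤ) ∣ i := by
  rw [idx, orderOf_dvd_iff_zpow_eq_one, ← QuotientGroup.mk_zpow, QuotientGroup.eq_one_iff]

/-- windows -/
def Win (r0 n m : ℤ) (a : ℤ → ℤ) : Set (ℤ × ℤ) :=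
  {p | (r0 ≤ p.1 ∧ p.1 < r0 + n) ∧ a p.1 ≤ p.2 ∧ p.2 < a p.1 + m}

theorem small_dvd {n x : ℤ} (h : n ∣ x) (h1 : x < n) (h2 : -n < x) : x = 0 := by
  obtain ⟨q, rfl⟩ := h
  have : q = 0 := by
    by_contra hne
    rcases lt_or_gt_of_ne hne with h4 | h4
    · nlinarith
    · nlinarith
  rw [this]; simp

theorem win_inj {b s : G} (r0 : ℤ) (a : ℤ → ℤ) :
    Set.InjOn (cy b s) (Win r0 (idx (Subgroup.zpowers s) b) (orderOf s) a) := by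
  rintro ⟨i, k⟩ ⟨⟨hi, hi'⟩, hk, hk'⟩ ⟨j, k'⟩ ⟨⟨hj, hj'⟩, hk2, hk2'⟩ h
  simp only [cy] at *
  have hij : i = j := by
    have h1 : b ^ (i - j) ∈ Subgroup.zpowers s := by
      refine ⟨k' - k, ?_⟩
      simp only
      rw [zpow_sub, zpow_sub, mul_inv_eq_iff_eq_mul, mul_right_comm, h, mul_right_comm]
      simp
    rw [zpow_mem_iff] at h1
    have := small_dvd h1 (by omega) (by omega)
    omega
  subst hij
  rw [mul_right_inj, zpow_eq_zpow_iff_modEq] at h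
  have := small_dvd (Int.modEq_iff_dvd.1 h.symm) (by omega) (by omega)
  rw [show k = k' by omega]

theorem zwin {s z : G} (hz : z ∈ Subgroup.zpowers s) (c : ℤ) : ∃ k, c ≤ k ∧ k < c + orderOf s ∧ z = s ^ k := by
  obtain ⟨k, rfl⟩ := hz
  have hp : 0 < orderOf s := orderOf_pos s
  refine ⟨c + (k - c) % orderOf s, ?_, ?_, ?_⟩
  · have := Int.emod_nonneg (k - c) (by omega : (orderOf s : ℤ) ≠ 0); omega
  · have := Int.emod_lt_of_pos (k - c) (by omega : 0 < (orderOf s : ℤ)); omega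
  · simp only
    rw [zpow_add, zpow_mod_orderOf, ← zpow_add]; congr 1; ring

theorem win_image (b s : G) (r0 : ℤ) (a : ℤ → ℤ) :
    cy b s '' (Win r0 (idx (Subgroup.zpowers s) b) (orderOf s) a) = (ext (Subgroup.zpowers s) b : Set G) := by
  set n := idx (Subgroup.zpowers s) b with hn
  have hn0 : 0 < n := idx_pos _ _
  ext z
  constructor
  · rintro ⟨⟨i, k⟩, _, rfl⟩
    exact mul_mem (Subgroup.zpow_mem _ (mem_ext _ _) _)
      (le_ext _ _ (Subgroup.zpow_mem _ (Subgroup.mem_zpowers s) _))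
  · intro hz
    obtain ⟨i, hi, h⟩ := mem_ext_iff.1 hz
    have h2 : b ^ (-(r0 + ((i : ℤ) - r0) % n)) * z ∈ Subgroup.zpowers s := by
      have h3 : b ^ ((i : ℤ) - (r0 + ((i : ℤ) - r0) % n)) ∈ Subgroup.zpowers s := by
        rw [zpow_mem_iff, ← hn]
        refine ⟨((i : ℤ) - r0) / n, ?_⟩
        have := Int.emod_add_mul_ediv ((i : ℤ) - r0) n
        linarith
      have h4 := mul_mem h3 h
      rw [sub_eq_add_neg, zpow_add, zpow_natCast] at h4
      rwa [show b ^ i * b ^ (-(r0 + ((i : ℤ) - r0) % n)) * ((b ^ i)⁻¹ * z) =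
        b ^ (-(r0 + ((i : ℤ) - r0) % n)) * z by
          exact Additive.ofMul.injective (by simp only [ofMul_mul, ofMul_inv]; abel)] at h4
    set j := r0 + ((i : ℤ) - r0) % n with hj
    obtain ⟨k, hk, hk', h5⟩ := zwin h2 (a j)
    refine ⟨(j, k), ⟨⟨?_, ?_⟩, hk, hk'⟩, ?_⟩
    · have := Int.emod_nonneg ((i : ℤ) - r0) (by omega : (n : ℤ) ≠ 0); simp only; omega
    · have := Int.emod_lt_of_pos ((i : ℤ) - r0) (by omega : 0 < (n : ℤ)); simp only; omega
    · simp only [cy]; rw [← h5]; simp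

theorem GR_L {b s : G} {B : Set G} (hs : s ∈ B) (hs' : s⁻¹ ∈ B) (hb : b ∈ B) (hb' : b⁻¹ ∈ B)
    (p q : ℤ × ℤ) (h : GR 0 p q) : L B (cy b s p) (cy b s q) := by
  apply cy_L hs hs' hb hb'
  rcases h with ⟨h1, h2⟩ | h
  · left; refine ⟨h1, ?_⟩; omega
  · exact .inr h

theorem EP.win {R : ℤ × ℤ → ℤ × ℤ → Prop} {b s : G} {B : Set G} {r0 : ℤ} {a : ℤ → ℤ} {U : Set (ℤ × ℤ)}
    {p q : ℤ × ℤ} (h : EP R U p q)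
    (hR : ∀ p q, R p q → L B (cy b s p) (cy b s q))
    (hU : U ⊆ Win r0 (idx (Subgroup.zpowers s) b) (orderOf s) a) :
    EP (L B) (cy b s '' U) (cy b s p) (cy b s q) :=
  h.map _ ((win_inj r0 a).mono hU) fun _ _ _ _ h => hR _ _ h

theorem sw_grid {S B : Set G} (hS : Sy S) (hgen : Subgroup.closure S = ⊤) {R : ℤ × ℤ → ℤ × ℤ → Prop} {b s : G}
    (hBS : B ⊆ S) (hB : RE (ext (Subgroup.zpowers s) b) B)
    (hR : ∀ p q, R p q → L B (cy b s p) (cy b s q))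
    {r0 : ℤ} {a : ℤ → ℤ} {U V : Set (ℤ × ℤ)} {p q p' q' : ℤ × ℤ} (h1 : EP R U p q) (h2 : EP R V p' q')
    (hd : Disjoint U V) (hu : U ∪ V = Win r0 (idx (Subgroup.zpowers s) b) (orderOf s) a)
    {u v x : G} (hus : u ∈ S) (hvs : v ∈ S) (huv : u ≠ v) (e1 : cy b s p = x * u) (e2 : cy b s q = x * v)
    (e3 : cy b s p' = x * u * v) (e4 : cy b s q' = x) : K0 S u v := by
  have k1 : U ⊆ Win r0 (idx (Subgroup.zpowers s) b) (orderOf s) a := by rw [← hu]; exact Set.subset_union_left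
  have k2 : V ⊆ Win r0 (idx (Subgroup.zpowers s) b) (orderOf s) a := by rw [← hu]; exact Set.subset_union_right
  have g1 := h1.win hR k1
  have g2 := h2.win hR k2
  rw [e1, e2] at g1
  rw [e3, e4] at g2
  refine sw_sub hS hgen hB hBS hus hvs huv (disj_img (win_inj r0 a) k1 k2 hd) ?_ g1 g2
  rw [← Set.image_union, hu, win_image]

end grp
end HamSp


/-! Part 14 -/
set_option linter.unusedSectionVars false
set_option linter.unusedSimpArgs false
set_option linter.unusedVariables false
namespace HamSp
section grp
variable {G : Type*} [CommGroup G] [Finite G]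

theorem flat_A1 {S : Set G} (hS : Sy S) (h1 : (1 : G) ∉ S) (hgen : Subgroup.closure S = ⊤) {s t : G}
    (hs : s ∈ S) (ht : t ∈ S) (hts : t ≠ s) (hts' : t ≠ s⁻¹) (htK : t ∈ Subgroup.zpowers s) : K0 S s t := by
  have hs1 : s ≠ 1 := fun h => h1 (h ▸ hs)
  obtain ⟨k, hk, rfl⟩ := exp_ex htK
  have hk0 : k ≠ 0 := by rintro rfl; exact h1 (by simpa using ht)
  have hk1 : k ≠ 1 := by rintro rfl; simp at hts
  have hkm : k + 1 ≠ orderOf s := by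
    intro h
    apply hts'
    rw [eq_inv_iff_mul_eq_one, ← pow_succ, h, pow_orderOf_eq_one]
  have hT : ({s, s⁻¹} : Set G) ⊆ S := by
    rintro z (rfl | rfl); exacts [hs, hS _ hs]
  have e1 := (seg (S := {s, s⁻¹}) (fun _ _ => 0) (t := s) (by simp) (k - 1) (by omega)).toEP.trl s
  have e2 := (seg (S := {s, s⁻¹}) (fun _ _ => 0) (t := s) (by simp) (orderOf s - k - 1) (by omega)).toEP.trl (s ^ (k + 1))
  rw [mul_one, ← pow_succ', show k - 1 + 1 = k by omega] at e1
  rw [mul_one, ← pow_add, show k + 1 + (orderOf s - k - 1) = orderOf s by omega, pow_orderOf_eq_one] at e2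
  refine sw_sub (x := 1) hS hgen (RE_single hs1) hT hs ht (Ne.symm hts) ?_ ?_ (by rw [one_mul, one_mul]; exact e1)
    (by rw [one_mul, ← pow_succ']; exact e2)
  · rw [Set.disjoint_left]
    rintro z ⟨j, hj, h2⟩ ⟨i, hi, h3⟩
    rw [inv_mul_eq_iff_eq_mul] at h2 h3
    rw [← pow_succ'] at h2
    rw [← pow_add, h2] at h3
    by_cases h4 : k + 1 + i = orderOf s
    · rw [h4, pow_orderOf_eq_one] at h3
      have := orderOf_le_of_pow_eq_one (by omega) h3
      omega
    · have := pow_injOn_Iio_orderOf (x := s) (show j + 1 < orderOf s by omega) (show k + 1 + i < orderOf s by omega) h3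
      omega
  · ext z
    constructor
    · rintro (⟨j, hj, h2⟩ | ⟨i, hi, h3⟩)
      · rw [inv_mul_eq_iff_eq_mul] at h2
        rw [h2, ← pow_succ']; exact Subgroup.npow_mem_zpowers _ _
      · rw [inv_mul_eq_iff_eq_mul] at h3
        rw [h3, ← pow_add]; exact Subgroup.npow_mem_zpowers _ _
    · intro hz
      obtain ⟨j, hj, rfl⟩ := exp_ex hz
      by_cases h : j = 0
      · right
        refine ⟨orderOf s - k - 1, le_rfl, ?_⟩
        rw [inv_mul_eq_iff_eq_mul, ← pow_add, show k + 1 + (orderOf s - k - 1) = orderOf s by omega, pow_orderOf_eq_one, h, pow_zero]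
      · by_cases h' : j ≤ k
        · left
          refine ⟨j - 1, by omega, ?_⟩
          rw [inv_mul_eq_iff_eq_mul, ← pow_succ']; congr 1; omega
        · right
          refine ⟨j - k - 1, by omega, ?_⟩
          rw [inv_mul_eq_iff_eq_mul, ← pow_add]; congr 1; omega

theorem snk {R : ℤ × ℤ → ℤ × ℤ → Prop} (hR : ∀ p q, GR 0 p q → R p q) (i a c x y : ℤ) (hac : a ≤ c)
    (hxy : (x = a ∧ y = c) ∨ (x = c ∧ y = a)) (k : ℕ) :
    EP R {p : ℤ × ℤ | (i ≤ p.1 ∧ p.1 ≤ i + 2 * k) ∧ a ≤ p.2 ∧ p.2 ≤ c} (i, x) (i + 2 * k, y) := by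
  have hrow : ∀ (j : ℤ) (x y : ℤ), (x = a ∧ y = c) ∨ (x = c ∧ y = a) →
      EP R {p : ℤ × ℤ | p.1 = j ∧ a ≤ p.2 ∧ p.2 ≤ c} (j, x) (j, y) := by
    rintro j x y (⟨rfl, rfl⟩ | ⟨rfl, rfl⟩)
    · exact hsegZ 0 hR _ _ _ hac
    · exact hsegR 0 hR _ _ _ hac
  induction k with
  | zero =>
    have := hrow i x y hxy
    simp only [Nat.cast_zero, mul_zero, add_zero]
    refine this.congr ?_
    ext ⟨a, b⟩; simp; omega
  | succ k ih =>
    have h1 := ih.append (hR (i + 2 * k, y) (i + 2 * k + 1, y) (by right; simp))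
      (hrow _ y x (by omega)) (by rw [Set.disjoint_left]; rintro ⟨a, b⟩; simp; omega)
    have h2 := h1.append (hR (i + 2 * k + 1, x) (i + 2 * (k + 1 : ℕ), x) (by right; simp; omega))
      (hrow _ x y hxy) (by rw [Set.disjoint_left]; rintro ⟨a, b⟩; simp; omega)
    refine h2.congr ?_
    ext ⟨a, b⟩; simp; omega

theorem st_RE {S : Set G} (hS : Sy S) (h1 : (1 : G) ∉ S) {s t : G} (hs : s ∈ S) (ht : t ∈ S)
    (htK : t ∉ Subgroup.zpowers s) :
    RE (ext (Subgroup.zpowers s) t) (Adj1 {s, s⁻¹} t) ∧ Adj1 {s, s⁻¹} t ⊆ S := by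
  have hs1 : s ≠ 1 := fun h => h1 (h ▸ hs)
  refine ⟨RE_step (RE_single hs1) htK, Adj1_subS ?_ ht hS⟩
  rintro z (rfl | rfl); exacts [hs, hS _ hs]

theorem st_R {s t : G} (p q : ℤ × ℤ) (h : GR 0 p q) : L (Adj1 {s, s⁻¹} t) (cy t s p) (cy t s q) :=
  GR_L (by simp [Adj1]) (by simp [Adj1]) (by simp [Adj1]) (by simp [Adj1]) p q h

theorem flat_odd {S : Set G} (hS : Sy S) (h1 : (1 : G) ∉ S) (hgen : Subgroup.closure S = ⊤) {s t : G}
    (hs : s ∈ S) (ht : t ∈ S) (htK : t ∉ Subgroup.zpowers s) (hm : 3 ≤ orderOf s)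
    (ho : Odd (idx (Subgroup.zpowers s) t)) : K0 S s t := by
  obtain ⟨hRE, hsub⟩ := st_RE hS h1 hs ht htK
  have hn2 := idx_two htK
  set n := idx (Subgroup.zpowers s) t with hn
  obtain ⟨j, hj⟩ := ho
  obtain ⟨r, hr, hr'⟩ := exp_ex ((pow_mem_iff (Subgroup.zpowers s) t n).2 (by rw [← hn]))
  set m := orderOf s with hmd
  have hst : s ≠ t := by rintro rfl; exact htK (Subgroup.mem_zpowers _)
  obtain ⟨j, rfl⟩ : ∃ j', j = j' + 1 := ⟨j - 1, by omega⟩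
  obtain ⟨Q, hQ⟩ : ∃ Q : ℤ, (r = 0 ∧ Q = 1) ∨ (r ≠ 0 ∧ Q = 0) := by
    by_cases h : r = 0
    · exact ⟨1, .inl ⟨h, rfl⟩⟩
    · exact ⟨0, .inr ⟨h, rfl⟩⟩
  have b1 := hsegZ (R := GR 0) 0 (fun _ _ h => h) 1 1 2 (by omega)
  have b2 := snk (R := GR 0) (fun _ _ h => h) 2 (Q + 1) 2 2 (Q + 1) (by omega) (by omega) j
  have b3 := hsegZ (R := GR 0) 0 (fun _ _ h => h) n (Q + 1) (m - r) (by omega)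
  have a1 := hsegR (R := GR 0) 0 (fun _ _ h => h) 1 3 m (by omega)
  have a2 := snk (R := GR 0) (fun _ _ h => h) 2 3 (m + Q) 3 (m + Q) (by omega) (by omega) j
  have a3 := hsegR (R := GR 0) 0 (fun _ _ h => h) n (m - r + 1) (m + Q) (by omega)
  have b12 := b1.append (by right; simp) b2 (by rw [Set.disjoint_left]; rintro ⟨a, b⟩; simp; omega)
  have bb := b12.append (by right; simp; omega) b3 (by rw [Set.disjoint_left]; rintro ⟨a, b⟩; simp; omega)
  have a12 := a1.append (by right; simp) a2 (by rw [Set.disjoint_left]; rintro ⟨a, b⟩; simp; omega)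
  have aa := a12.append (by right; simp; omega) a3 (by rw [Set.disjoint_left]; rintro ⟨a, b⟩; simp; omega)
  refine sw_grid hS hgen hsub hRE (R := GR 0) st_R (r0 := 1) (a := fun i => if i = 1 then 1 else Q + 1)
    (aa.reverse (GR_symm 0)) bb ?_ ?_ hs ht hst (x := 1) ?_ ?_ ?_ ?_
  · rw [Set.disjoint_left]; rintro ⟨a, b⟩; simp; omega
  · rw [← hn, ← hmd]
    ext ⟨a, b⟩
    simp only [Win, Set.mem_union, Set.mem_ofPred_eq]
    split_ifs with h <;> omega
  · simp only [cy, one_mul]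
    rw [zpow_natCast, hr', ← zpow_natCast, ← zpow_add, show (r : ℤ) + (m - r + 1) = m + 1 by ring, zpow_add]
    simp [hmd, pow_orderOf_eq_one]
  · simp [cy, hmd, pow_orderOf_eq_one]
  · simp [cy, mul_comm]
  · simp only [cy, one_mul]
    rw [zpow_natCast, hr', ← zpow_natCast, ← zpow_add, show (r : ℤ) + (m - r) = m by ring]
    simp [hmd, pow_orderOf_eq_one]

end grp
end HamSp


/-! Part 15 -/
set_option linter.unusedSectionVars false
set_option linter.unusedSimpArgs false
set_option linter.unusedVariables false
namespace HamSp
section grp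
variable {G : Type*} [CommGroup G] [Finite G]

theorem front {s t : G} (hm : 3 ≤ orderOf s) (hf : Free (Subgroup.zpowers s) t 2) :
    ∃ U V : Set G, EP (L (Adj1 {s, s⁻¹} t)) U s t ∧ EP (L (Adj1 {s, s⁻¹} t)) V (s * t) (s ^ (orderOf s - 2) * t) ∧
      Disjoint U V ∧ 1 ∉ U ∧ 1 ∉ V ∧ U ∪ V ∪ {1} = Strip (Subgroup.zpowers s) t 2 := by
  set m := orderOf s with hmd
  have a1 := hsegZ (R := GR 0) 0 (fun _ _ h => h) 0 1 (m - 1) (by omega)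
  have a2 := hsegZ (R := GR 0) 0 (fun _ _ h => h) 1 (m - 1) m (by omega)
  have aa := a1.append (by right; simp) a2 (by rw [Set.disjoint_left]; rintro ⟨a, b⟩; simp; omega)
  have bb := hsegZ (R := GR 0) 0 (fun _ _ h => h) 1 1 (m - 2) (by omega)
  have hinj := cy_inj hf 1
  have him := cy_image t s 2 1
  rw [← hmd] at hinj him
  set W : Set (ℤ × ℤ) := {p : ℤ × ℤ | (0 ≤ p.1 ∧ p.1 < (2 : ℕ)) ∧ 1 ≤ p.2 ∧ p.2 < 1 + (m : ℤ)} with hW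
  have ha : {p : ℤ × ℤ | p.1 = 0 ∧ 1 ≤ p.2 ∧ p.2 ≤ (m : ℤ) - 1} ∪ {p : ℤ × ℤ | p.1 = 1 ∧ (m : ℤ) - 1 ≤ p.2 ∧ p.2 ≤ m} ⊆ W := by
    rintro ⟨a, b⟩; simp [hW]; omega
  have hb : {p : ℤ × ℤ | p.1 = 1 ∧ 1 ≤ p.2 ∧ p.2 ≤ (m : ℤ) - 2} ⊆ W := by
    rintro ⟨a, b⟩; simp [hW]; omega
  have h1 : cy t s (0, m) = 1 := by simp [cy, hmd, pow_orderOf_eq_one]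
  have h1W : ((0, m) : ℤ × ℤ) ∈ W := by simp [hW]; omega
  have A := aa.map (Q := L (Adj1 {s, s⁻¹} t)) (cy t s) (hinj.mono ha) fun _ _ _ _ h => st_R _ _ h
  have B := bb.map (Q := L (Adj1 {s, s⁻¹} t)) (cy t s) (hinj.mono hb) fun _ _ _ _ h => st_R _ _ h
  refine ⟨_, _, ?_, ?_, disj_img hinj ha hb ?_, ?_, ?_, ?_⟩
  · convert A using 1 <;> simp [cy, hmd, pow_orderOf_eq_one]
  · convert B using 1
    · simp [cy, mul_comm]
    · simp only [cy, zpow_one]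
      rw [mul_comm, ← zpow_natCast, Nat.cast_sub (by omega)]; rfl
  · rw [Set.disjoint_left]; rintro ⟨a, b⟩; simp; omega
  · rintro ⟨p, hp, h⟩
    rw [← h1] at h
    have := hinj (ha hp) h1W h
    subst this
    simp at hp
  · rintro ⟨p, hp, h⟩
    rw [← h1] at h
    have := hinj (hb hp) h1W h
    subst this
    simp at hp
  · rw [← him, ← h1, ← Set.image_singleton, ← Set.image_union, ← Set.image_union]
    congr 1
    ext ⟨a, b⟩; simp [hW]; omega

theorem sw_front {S : Set G} (hS : Sy S) (h1 : (1 : G) ∉ S) {s t : G}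
    (hs : s ∈ S) (ht : t ∈ S) (htK : t ∉ Subgroup.zpowers s) (hm : 3 ≤ orderOf s) {p q : G}
    (hp : EP (L S) (Strip (Subgroup.zpowers s) t 2)ᶜ p q) (h2 : L S (s ^ (orderOf s - 2) * t) p) (h3 : L S q 1) :
    K0 S s t := by
  obtain ⟨hRE, hsub⟩ := st_RE hS h1 hs ht htK
  have hf : Free (Subgroup.zpowers s) t 2 := by
    intro i hi hi'
    obtain rfl : i = 1 := by omega
    simpa using htK
  obtain ⟨U, V, hU, hV, hd, u1, v1, hun⟩ := front hm hf
  have hVs : V ⊆ Strip (Subgroup.zpowers s) t 2 := by rw [← hun]; intro z hz; exact .inl (.inr hz)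
  have hUs : U ⊆ Strip (Subgroup.zpowers s) t 2 := by rw [← hun]; intro z hz; exact .inl (.inl hz)
  have h1s : 1 ∈ Strip (Subgroup.zpowers s) t 2 := by rw [← hun]; exact .inr rfl
  have k1 := (hV.monoL hsub).append h2 hp (Set.disjoint_left.2 fun z hz hz' => hz' (hVs hz))
  have k2 := k1.append h3 (EP.single 1) (by
    rw [Set.disjoint_singleton_right]
    rintro (h | h)
    · exact v1 h
    · exact h h1s)
  refine sw hS hs ht (x := 1) ?_ ?_ (by simpa using hU.monoL hsub) (by rw [one_mul]; exact k2)
  · rw [Set.disjoint_union_right, Set.disjoint_union_right]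
    refine ⟨⟨hd, Set.disjoint_left.2 fun z hz hz' => hz' (hUs hz)⟩, ?_⟩
    rw [Set.disjoint_singleton_right]; exact u1
  · rw [Set.union_right_comm V, ← Set.union_assoc, ← Set.union_assoc, hun, Set.union_compl_self]

theorem flat_A2 {S : Set G} (hS : Sy S) (h1 : (1 : G) ∉ S) (hgen : Subgroup.closure S = ⊤) {s t u : G}
    (hs : s ∈ S) (ht : t ∈ S) (htK : t ∉ Subgroup.zpowers s) (hm : 3 ≤ orderOf s)
    (hi : idx (Subgroup.zpowers s) t = 2) (hu : u ∈ S) (huL : u ∉ ext (Subgroup.zpowers s) t) :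
    K0 S s t := by
  obtain ⟨hRE, hsub⟩ := st_RE hS h1 hs ht htK
  have hf : Free (Subgroup.zpowers s) t 2 := hi ▸ free_idx _ _
  have hst : Strip (Subgroup.zpowers s) t 2 = (ext (Subgroup.zpowers s) t : Set G) := by
    rw [← Strip_full, hi]
  have e := shc_cyc2_aux (s := s⁻¹) (b := t) (by rw [orderOf_inv]; exact hm) (by rw [Subgroup.zpowers_inv]; exact hf)
    1 2 (by omega) (by rw [orderOf_inv]; omega) (.inr ⟨rfl, by decide⟩)
  rw [Subgroup.zpowers_inv, inv_inv, Set.pair_comm, hst] at e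
  have he : t ^ (1 : ℤ) * s⁻¹ ^ (2 : ℤ) = s ^ (orderOf s - 2) * t := by
    rw [zpow_one, mul_comm, show s⁻¹ ^ (2 : ℤ) = s ^ (orderOf s - 2) from ?_]
    rw [inv_zpow, inv_eq_iff_mul_eq_one, ← zpow_natCast, ← zpow_add, Nat.cast_sub (by omega)]
    simp [pow_orderOf_eq_one]
  rw [he] at e
  set L0 := ext (Subgroup.zpowers s) t with hL0
  set y := s ^ (orderOf s - 2) * t with hy
  have hy1 : (1 : G) ≠ y := by
    intro h
    apply htK
    rw [hy, eq_comm, mul_eq_one_iff_eq_inv'] at h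
    rw [h]; exact Subgroup.inv_mem _ (Subgroup.npow_mem_zpowers _ _)
  obtain ⟨a, V, hV, hV1, ha, hp⟩ := e.first hy1
  have haT : a ∈ Adj1 {s, s⁻¹} t := by simpa [L] using ha
  have hfu : Free L0 u 2 := by
    intro i hi hi'
    obtain rfl : i = 1 := by omega
    simpa using huL
  have hbr := br_strip hS hgen hRE hsub hu huL 2 (by omega) hfu haT
  simp only [Nat.add_one_sub_one, pow_one] at hbr
  have hp2 := (hp.trl u).monoL hsub
  -- combine
  have key : EP (L S) (L0 : Set G)ᶜ u (u * y) := by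
    have hcos : ∀ z, u⁻¹ * z ∈ L0 → z ∉ L0 := by
      intro z hz hz'
      apply huL
      have := mul_mem hz' (inv_mem hz)
      simpa using this
    have hcov : (L0 : Set G)ᶜ = insert u ((Strip L0 u 2)ᶜ ∪ {z | u⁻¹ * z ∈ V}) := by
      have hmem : ∀ z, z ∈ L0 ↔ z = 1 ∨ z ∈ V := by
        intro z
        rw [← SetLike.mem_coe, hV]; rfl
      ext z
      simp only [Set.mem_compl_iff, SetLike.mem_coe, Set.mem_insert_iff, Set.mem_union, Set.mem_ofPred_eq]
      have h2 : z ∈ Strip L0 u 2 ↔ z ∈ L0 ∨ u⁻¹ * z ∈ L0 := by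
        constructor
        · rintro ⟨i, hi, h⟩
          rcases (by omega : i = 0 ∨ i = 1) with rfl | rfl
          · left; simpa using h
          · right; simpa using h
        · rintro (h | h)
          · exact ⟨0, by omega, by simpa using h⟩
          · exact ⟨1, by omega, by simpa using h⟩
      rw [h2]
      have h3 := hcos z
      have h4 := hmem (u⁻¹ * z)
      rw [inv_mul_eq_one, eq_comm] at h4
      tauto
    have hu0 : u ∉ (Strip L0 u 2)ᶜ ∪ {z | u⁻¹ * z ∈ V} := by
      rintro (h | h)
      · exact h ⟨1, by omega, by simp⟩
      · exact hV1 (by simpa using h)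
    rw [hcov]
    rcases hbr with hb | ⟨p, q, hb, k1, k2⟩
    · rw [hb, Set.empty_union] at hu0 ⊢
      exact EP.cons hu0 (L_right _ (hsub haT)) hp2
    · refine EP.cons hu0 k1 (hb.append k2 hp2 ?_)
      rw [Set.disjoint_left]
      intro z hz hz'
      apply hz
      refine ⟨1, by omega, ?_⟩
      rw [pow_one, ← SetLike.mem_coe, hV]
      exact .inr hz'
  refine sw_front hS h1 hs ht htK hm (p := u * y) (q := u) ?_ ?_ ?_
  · rw [hst]; exact key.reverse (L_symm hS)
  · rw [mul_comm u]; exact L_right _ hu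
  · simpa [L] using hS _ hu

theorem grid_col {s t : G} (he : Even (orderOf s)) : ∃ c : G → ZMod 2, ∀ i < idx (Subgroup.zpowers s) t, ∀ k : ℤ,
    c (t ^ i * s ^ k) = i + k := by
  classical
  set W := Win 0 (idx (Subgroup.zpowers s) t) (orderOf s) (fun _ => 0) with hW
  refine ⟨fun z => ((Function.invFunOn (cy t s) W z).1 : ZMod 2) + ((Function.invFunOn (cy t s) W z).2 : ZMod 2), ?_⟩
  intro i hi k
  have hp : 0 < orderOf s := orderOf_pos s
  have h := (win_inj (b := t) (s := s) 0 (fun _ => 0)).leftInvOn_invFunOn (show ((i : ℤ), k % orderOf s) ∈ W by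
    refine ⟨⟨by simp, by simpa using hi⟩, ?_, ?_⟩
    · exact Int.emod_nonneg _ (by omega)
    · simpa using Int.emod_lt_of_pos k (by omega))
  simp only [cy, zpow_natCast, zpow_mod_orderOf] at h
  rw [← hW] at h
  simp only [cy] at *
  rw [h]
  simp only [Int.cast_natCast, add_right_inj]
  rw [ZMod.intCast_eq_intCast_iff']
  obtain ⟨j, hj⟩ := he
  rw [Int.emod_emod_of_dvd]
  exact ⟨j, by push_cast [hj]; ring⟩

theorem grid_col_ZS {s t : G} {c : G → ZMod 2} (hc : ∀ i < idx (Subgroup.zpowers s) t, ∀ k : ℤ,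
    c (t ^ i * s ^ k) = i + k) : ZS (cdef c) {s, s⁻¹} (Subgroup.zpowers s) t (idx (Subgroup.zpowers s) t) where
  row := by
    rintro z ⟨i, hi, k, hk⟩ a ha
    simp only at hk
    obtain rfl : z = t ^ i * s ^ k := by rw [hk]; simp
    rw [cdef_zero]
    rcases ha with rfl | rfl
    · rw [mul_assoc, ← zpow_add_one, hc i hi, hc i hi]; push_cast; ring
    · rw [mul_assoc, ← zpow_sub_one, hc i hi, hc i hi]; push_cast; grind
  col := by
    rintro i hi z ⟨k, hk⟩
    simp only at hk
    obtain rfl : z = t ^ i * s ^ k := by rw [hk]; simp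
    rw [cdef_zero, mul_right_comm, ← pow_succ, hc _ hi, hc i (by omega)]; push_cast; ring

theorem flat_ev4 {S : Set G} (hS : Sy S) (h1 : (1 : G) ∉ S) (hgen : Subgroup.closure S = ⊤) {s t : G}
    (hs : s ∈ S) (ht : t ∈ S) (htK : t ∉ Subgroup.zpowers s) (hm : 3 ≤ orderOf s)
    (hev : Even (idx (Subgroup.zpowers s) t)) (h4 : 4 ≤ idx (Subgroup.zpowers s) t)
    {r : ℕ} (hr : t ^ (idx (Subgroup.zpowers s) t) = s ^ r) (hr' : Even (orderOf s) → Even r) : K0 S s t := by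
  obtain ⟨hRE, hsub⟩ := st_RE hS h1 hs ht htK
  set n := idx (Subgroup.zpowers s) t with hn
  have k := kit_cyc hS hs hm
  have hxr : (t ^ 2)⁻¹ * (t ^ 2 * s ^ ((orderOf s : ℤ) - 2)) ∈ Subgroup.zpowers s := by simp
  have hyr : (t ^ (n - 1))⁻¹ * t⁻¹ ∈ Subgroup.zpowers s := inv_row _ _
  have hye : t⁻¹ = t ^ (n - 1) * s ^ (-(r : ℤ)) := by
    rw [zpow_neg, zpow_natCast, ← hr, eq_mul_inv_iff_mul_eq, inv_mul_eq_iff_eq_mul, ← pow_succ']; congr 1; omega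
  have hne : t ^ 2 * s ^ ((orderOf s : ℤ) - 2) ≠ t⁻¹ := by
    intro h
    rw [← h] at hyr
    have := (free_idx (Subgroup.zpowers s) t).row_unique (by omega) (by omega) hxr hyr
    omega
  have path : EP (L (Adj1 {s, s⁻¹} t)) {z | (t ^ 2)⁻¹ * z ∈ Strip (Subgroup.zpowers s) t (n - 2)}
      (t ^ 2 * s ^ ((orderOf s : ℤ) - 2)) t⁻¹ := by
    by_cases he : Even (orderOf s)
    · obtain ⟨c, hc⟩ := grid_col (t := t) he
      refine k.shc_shift ht htK (c := c) (n := n) le_rfl (by omega) (by omega) (fun _ => grid_col_ZS hc) hxr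
        (j := n - 1) (by omega) (by omega) hyr hne (fun _ => ?_)
      rw [hye, hc 2 (by omega), hc (n - 1) (by omega)]
      have e1 : Even ((2 : ℕ) + ((orderOf s : ℤ) - 2)) := by
        obtain ⟨j, hj⟩ := he; exact ⟨j, by push_cast; omega⟩
      have e2 : ¬ Even (((n - 1 : ℕ) : ℤ) + -(r : ℤ)) := by
        obtain ⟨j, hj⟩ := hr' he
        obtain ⟨i, hi⟩ := hev
        rw [Int.not_even_iff_odd]
        exact ⟨i - j - 1, by omega⟩
      rw [← ZMod.intCast_eq_zero_iff_even] at e1 e2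
      push_cast at e1 e2 ⊢
      rw [e1]
      exact fun h => e2 h.symm
    · exact k.shc_shift ht htK (c := fun _ => 0) (n := n) le_rfl (by omega) (by omega) (fun h => absurd h he) hxr
        (j := n - 1) (by omega) (by omega) hyr hne (fun h => absurd h he)
  have hsp := Strip_split (Subgroup.zpowers s) t (l := n) (lo := 2) (by omega)
  have hsd := Strip_split_disj (free_idx (Subgroup.zpowers s) t) (lo := 2) (by omega)
  rw [← hn] at hsd
  rw [Strip_full] at hsp
  have ab := absorb hsub (br_all hS hgen _ _ hRE hsub) (by rw [← hsp]; exact Set.subset_union_right) path hne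
  refine sw_front hS h1 hs ht htK hm (ab.congr ?_) ?_ ?_
  · rw [← hsp, Set.compl_union]
    ext z
    have : z ∈ Strip (Subgroup.zpowers s) t 2 → z ∉ {z | (t ^ 2)⁻¹ * z ∈ Strip (Subgroup.zpowers s) t (n - 2)} := fun h => Set.disjoint_left.1 hsd h
    simp only [Set.mem_union, Set.mem_inter_iff, Set.mem_compl_iff]
    tauto
  · have : t ^ 2 * s ^ ((orderOf s : ℤ) - 2) = s ^ (orderOf s - 2) * t * t := by
      rw [← zpow_natCast s, Nat.cast_sub (by omega), pow_two, mul_comm, mul_assoc]; rfl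
    rw [this]; exact L_right _ ht
  · simpa [L] using ht

end grp
end HamSp


/-! Part 16 -/
set_option linter.unusedSectionVars false
set_option linter.unusedSimpArgs false
set_option linter.unusedVariables false
namespace HamSp
section grp
variable {G : Type*} [CommGroup G] [Finite G]

theorem sum_cyc (g : ℕ → ZMod 2) (m : ℕ) (h : g m = g 0) :
    ∑ i ∈ Finset.range m, g (i + 1) = ∑ i ∈ Finset.range m, g i := by
  have h1 := Finset.sum_range_succ g m
  have h2 := Finset.sum_range_succ' g m
  rw [h1, h] at h2
  exact (add_right_cancel h2).symm

/-- sum of the two row cycles -/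
noncomputable def rs (s t : G) (f : G → G → ZMod 2) : ZMod 2 :=
  ∑ i ∈ Finset.range (orderOf s), (f (s ^ i) (s ^ i * s) + f (t * s ^ i) (t * s ^ i * s))

theorem rs_trl (s t : G) (f : G → G → ZMod 2) : rs s t (fun x y => f (s * x) (s * y)) = rs s t f := by
  rw [rs, rs]
  rw [← sum_cyc (fun i => f (s ^ i) (s ^ i * s) + f (t * s ^ i) (t * s ^ i * s)) _ (by simp [pow_orderOf_eq_one])]
  refine Finset.sum_congr rfl fun i _ => ?_
  rw [pow_succ' s i, mul_assoc, mul_left_comm t s, mul_assoc]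
  simp only [mul_assoc]

theorem two_rows {s t : G} (hi : idx (Subgroup.zpowers s) t = 2) (htop : ext (Subgroup.zpowers s) t = ⊤) :
    ∀ z : G, z ∈ Subgroup.zpowers s ∨ t⁻¹ * z ∈ Subgroup.zpowers s := by
  intro z
  have : z ∈ ext (Subgroup.zpowers s) t := by rw [htop]; trivial
  obtain ⟨i, h, h'⟩ := mem_ext_iff.1 this
  rcases (by omega : i = 0 ∨ i = 1) with rfl | rfl
  · left; simpa using h'
  · right; simpa using h'

theorem hi_one {S : Set G} (hS : Sy S) {s t : G} (hs : s ∈ S) (ht : t ∈ S)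
    (htK : t ∉ Subgroup.zpowers s) (hi : idx (Subgroup.zpowers s) t = 2)
    (htop : ext (Subgroup.zpowers s) t = ⊤) {f : G → G → ZMod 2} (hf : Ann S f) :
    f s⁻¹ 1 + f (t * s⁻¹) t + f s⁻¹ (s⁻¹ * t) + f 1 t = rs s t f := by
  have hp : 0 < orderOf s := orderOf_pos s
  have k1 := seg f hs (orderOf s - 1) (by omega)
  have k2 := (seg (fun x y => f (t * x) (t * y)) hs (orderOf s - 1) (by omega)).map (Q := L S) (f' := f) (fun z => t * z)
    (by intro a _ b _ h; simpa using h) (fun a _ b _ h => (L_mul t a b).2 h) (fun _ _ _ _ _ => rfl)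
  have hset : {z | ∃ j ≤ orderOf s - 1, z = s ^ j} = (Subgroup.zpowers s : Set G) := by
    ext z
    constructor
    · rintro ⟨j, _, rfl⟩; exact Subgroup.npow_mem_zpowers _ _
    · intro hz
      obtain ⟨j, hj, rfl⟩ := exp_ex hz
      exact ⟨j, by omega, rfl⟩
  have hlast : s ^ (orderOf s - 1) = s⁻¹ := by
    rw [eq_inv_iff_mul_eq_one]; exact pow_last s
  have hlast' : s ^ (orderOf s - 1) * s = 1 := pow_last s
  rw [hset] at k1 k2
  have k3 := k1.append (z := t * s ^ (orderOf s - 1)) (by rw [mul_comm]; exact L_right _ ht)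
    (k2.reverse (L_symm hS) hf.symm) (by
      rw [Set.disjoint_left]
      rintro z hz ⟨y, hy, rfl⟩
      apply htK
      have := mul_mem hz (inv_mem hy)
      simpa using this)
  have h4 := hf.ham _ ⟨_, _, _, k3.congr (by
    ext z
    simp only [Set.mem_union, SetLike.mem_coe, Set.mem_image, Set.mem_univ, iff_true]
    rcases two_rows hi htop z with h | h
    · exact .inl h
    · exact .inr ⟨_, h, by simp⟩) rfl, by simpa [L] using hS _ ht, rfl⟩
  rw [rs, show orderOf s = orderOf s - 1 + 1 by omega, Finset.sum_range_succ, Finset.sum_add_distrib]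
  have e1 : ∀ i, s ^ i * s = s ^ (i + 1) := fun i => (pow_succ _ _).symm
  simp only [mul_assoc, e1, mul_one] at h4 ⊢
  simp only [Nat.add_one_sub_one, show orderOf s - 1 + 1 = orderOf s by omega, pow_orderOf_eq_one, hlast, mul_one] at h4 ⊢
  rw [hf.symm t 1, mul_comm t s⁻¹] at h4
  rw [mul_comm t s⁻¹]
  grind

theorem hi_all {S : Set G} (hS : Sy S) {s t : G} (hs : s ∈ S) (ht : t ∈ S)
    (htK : t ∉ Subgroup.zpowers s) (hi : idx (Subgroup.zpowers s) t = 2)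
    (htop : ext (Subgroup.zpowers s) t = ⊤) {f : G → G → ZMod 2} (hf : Ann S f) (j : ℕ) :
    f (s ^ j) (s ^ j * s) + f (s ^ j * t) (s ^ j * t * s) + f (s ^ j) (s ^ j * t) + f (s ^ j * s) (s ^ j * s * t)
      = rs s t f := by
  have hrs : ∀ j : ℕ, rs s t (fun x y => f (s ^ j * x) (s ^ j * y)) = rs s t f := by
    intro j
    induction j with
    | zero => simp
    | succ j ih =>
      rw [← ih, ← rs_trl s t (fun x y => f (s ^ j * x) (s ^ j * y))]
      simp only [pow_succ, mul_assoc]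
  have h := hi_one hS hs ht htK hi htop (hf.trl (s ^ (j + 1)))
  rw [hrs] at h
  rw [← h]
  have e1 : s ^ (j + 1) * s⁻¹ = s ^ j := by rw [pow_succ]; simp
  have e2 : s ^ (j + 1) * (t * s⁻¹) = s ^ j * t := by rw [mul_left_comm, e1, mul_comm]
  have e3 : s ^ (j + 1) * (s⁻¹ * t) = s ^ j * t := by rw [← mul_assoc, e1]
  simp only [e1, e2, e3, mul_one]
  rw [pow_succ, show s ^ j * t * s = s ^ j * s * t from mul_right_comm _ _ _]

theorem flat_hi {S : Set G} (hS : Sy S) {s t : G} (hs : s ∈ S) (ht : t ∈ S)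
    (htK : t ∉ Subgroup.zpowers s) (hi : idx (Subgroup.zpowers s) t = 2)
    (htop : ext (Subgroup.zpowers s) t = ⊤) (he : Even (orderOf s)) : K0 S s t := by
  refine K0.of_one fun f hf => ?_
  have h := fun j => hi_all hS hs ht htK hi htop hf j
  have h0 := h 0
  simp only [pow_zero, one_mul] at h0
  rw [h0]
  have hsum := Finset.sum_congr rfl (fun j (_ : j ∈ Finset.range (orderOf s)) => h j)
  rw [Finset.sum_const, Finset.card_range, nsmul_eq_mul, (ZMod.natCast_eq_zero_iff_even).2 he, zero_mul] at hsum
  rw [Finset.sum_add_distrib, Finset.sum_add_distrib] at hsum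
  have hc := sum_cyc (fun i => f (s ^ i) (s ^ i * t)) (orderOf s) (by simp [pow_orderOf_eq_one])
  simp only [pow_succ] at hc
  rw [hc, add_assoc, CharTwo.add_self_eq_zero, add_zero] at hsum
  rw [← hsum, rs]
  refine Finset.sum_congr rfl fun i _ => ?_
  rw [mul_comm t]

theorem sw_grid_top {S : Set G} (hS : Sy S) {R : ℤ × ℤ → ℤ × ℤ → Prop} {b s : G}
    (htop : ext (Subgroup.zpowers s) b = ⊤)
    (hR : ∀ p q, R p q → L S (cy b s p) (cy b s q))
    {r0 : ℤ} {a : ℤ → ℤ} {U V : Set (ℤ × ℤ)} {p q p' q' : ℤ × ℤ} (h1 : EP R U p q) (h2 : EP R V p' q')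
    (hd : Disjoint U V) (hu : U ∪ V = Win r0 (idx (Subgroup.zpowers s) b) (orderOf s) a)
    {u v x : G} (hus : u ∈ S) (hvs : v ∈ S) (e1 : cy b s p = x * u) (e2 : cy b s q = x * v)
    (e3 : cy b s p' = x * u * v) (e4 : cy b s q' = x) : K0 S u v := by
  have k1 : U ⊆ Win r0 (idx (Subgroup.zpowers s) b) (orderOf s) a := by rw [← hu]; exact Set.subset_union_left
  have k2 : V ⊆ Win r0 (idx (Subgroup.zpowers s) b) (orderOf s) a := by rw [← hu]; exact Set.subset_union_right
  have g1 := h1.win hR k1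
  have g2 := h2.win hR k2
  rw [e1, e2] at g1
  rw [e3, e4] at g2
  refine sw hS hus hvs (disj_img (win_inj r0 a) k1 k2 hd) ?_ g1 g2
  rw [← Set.image_union, hu, win_image, htop]; rfl

theorem flat_pr1 {S : Set G} (hS : Sy S) {s t : G} (hs : s ∈ S) (ht : t ∈ S)
    (hi : idx (Subgroup.zpowers s) t = 2) (htop : ext (Subgroup.zpowers s) t = ⊤) {k : ℕ} (hk : 2 ≤ k)
    (hk' : k + 2 ≤ orderOf s) (hu : s ^ k ∈ S) : K0 S s t := by
  set m := orderOf s with hm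
  set R : ℤ × ℤ → ℤ × ℤ → Prop := fun p q => GR 0 p q ∨ (p.1 = q.1 ∧ q.2 = p.2 + k) with hRd
  have hR0 : ∀ p q, GR 0 p q → R p q := fun p q h => .inl h
  have hR : ∀ p q, R p q → L S (cy t s p) (cy t s q) := by
    rintro ⟨i, j⟩ ⟨i', j'⟩ (h | ⟨h, h'⟩)
    · exact GR_L hs (hS _ hs) ht (hS _ ht) _ _ h
    · simp only at h h'
      subst h h'
      simp only [cy]
      rw [zpow_add, ← mul_assoc, zpow_natCast]; exact L_right _ hu
  have a1 := hsegR 0 hR0 0 1 (k - 1) (by omega)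
  have a2 := hsegZ 0 hR0 0 (k + 1) (m - 1) (by omega)
  have a3 := hsegR 0 hR0 1 k (m - 1) (by omega)
  have r1 : R (0, 1) (0, (k : ℤ) + 1) := .inr ⟨rfl, by simp; omega⟩
  have r2 : R (0, (m : ℤ) - 1) (1, (m : ℤ) - 1) := hR0 _ _ (by right; simp)
  have aa := (a1.append r1 a2 (by rw [Set.disjoint_left]; rintro ⟨a, b⟩; simp; omega)).append
    r2 a3 (by rw [Set.disjoint_left]; rintro ⟨a, b⟩; simp; omega)
  have b1 := hsegR 0 hR0 1 0 (k - 1) (by omega)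
  have bb := (b1.append (hR0 _ (0, 0) (by right; simp)) (EP.single _) (by
    rw [Set.disjoint_left]; rintro ⟨a, b⟩; simp; omega)).append
    (z := (0, (k : ℤ))) (.inr ⟨rfl, by simp⟩) (EP.single _) (by rw [Set.disjoint_left]; rintro ⟨a, b⟩; simp; omega)
  refine K0.inv (sw_grid_top hS htop hR (r0 := 0) (a := fun _ => 0) aa bb ?_ ?_ (hS _ hs) ht (x := s ^ k) ?_ ?_ ?_ ?_)
  · rw [Set.disjoint_left]; rintro ⟨a, b⟩; simp; omega
  · rw [hi, ← hm]
    ext ⟨a, b⟩; simp [Win]; omega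
  · simp [cy, zpow_sub]
  · simp [cy, mul_comm]
  · simp [cy, zpow_sub, mul_comm]
  · simp [cy]

theorem flat_pr2 {S : Set G} (hS : Sy S) {s t : G} (hs : s ∈ S) (ht : t ∈ S) (htt : t * t = 1)
    (hi : idx (Subgroup.zpowers s) t = 2) (htop : ext (Subgroup.zpowers s) t = ⊤) {k : ℕ} (hk : 1 ≤ k)
    (hk' : 2 * k < orderOf s) (hu : t * s ^ (2 * k) ∈ S) : K0 S s t := by
  set m := orderOf s with hm
  set R : ℤ × ℤ → ℤ × ℤ → Prop := fun p q => GR 0 p q ∨ (q.1 = p.1 + 1 ∧ q.2 = p.2 + 2 * k) with hRd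
  have hR0 : ∀ p q, GR 0 p q → R p q := fun p q h => .inl h
  have hR : ∀ p q, R p q → L S (cy t s p) (cy t s q) := by
    rintro ⟨i, j⟩ ⟨i', j'⟩ (h | ⟨h, h'⟩)
    · exact GR_L hs (hS _ hs) ht (hS _ ht) _ _ h
    · simp only at h h'
      subst h h'
      have : cy t s (i + 1, j + 2 * k) = cy t s (i, j) * (t * s ^ (2 * k)) := by
        simp only [cy]
        rw [zpow_add, zpow_add, zpow_one, ← zpow_natCast s (2 * k)]
        push_cast
        exact mul_mul_mul_comm _ _ _ _
      rw [this]; exact L_right _ hu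
  have a1 := hsegZ 0 hR0 1 0 1 (by omega)
  have a12 := a1.append (hR0 _ (0, 1) (by right; simp)) (EP.single _) (by
    rw [Set.disjoint_left]; rintro ⟨a, b⟩; simp; omega)
  have a3 := hsegZ 0 hR0 0 (2 * k) (m - 1) (by omega)
  have aa : EP R {p : ℤ × ℤ | (p.1 = 1 ∧ 0 ≤ p.2 ∧ p.2 ≤ 2 * k - 1) ∨ (p.1 = 0 ∧ 1 ≤ p.2 ∧ p.2 ≤ m - 1)} (1, 0) (0, (m : ℤ) - 1) := by
    by_cases hk1 : k = 1
    · subst hk1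
      refine (a12.append (hR0 _ _ (by left; simp)) a3 (by
        rw [Set.disjoint_left]; rintro ⟨a, b⟩; simp; omega)).congr ?_
      ext ⟨a, b⟩; simp; omega
    · obtain ⟨j, rfl⟩ : ∃ j, k = j + 2 := ⟨k - 2, by omega⟩
      have z := zz 0 hR0 0 1 2 (by omega) j
      refine ((a12.append (hR0 _ _ (by left; simp)) z (by
        rw [Set.disjoint_left]; rintro ⟨a, b⟩; simp; omega)).append (hR0 _ _ (by left; simp; omega)) a3 (by
        rw [Set.disjoint_left]; rintro ⟨a, b⟩; simp; omega)).congr ?_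
      ext ⟨a, b⟩; simp; omega
  have b1 := hsegZ 0 hR0 1 (2 * k) (m - 1) (by omega)
  have bb := EP.cons (x := ((0, 0) : ℤ × ℤ)) (by simp) (.inr ⟨by simp, by simp⟩) b1
  refine sw_grid_top hS htop hR (r0 := 0) (a := fun _ => 0) aa bb ?_ ?_ hs ht (x := t * s⁻¹) ?_ ?_ ?_ ?_
  · rw [Set.disjoint_left]; rintro ⟨a, b⟩; simp; omega
  · rw [hi, ← hm]
    ext ⟨a, b⟩; simp [Win]; omega
  · simp [cy]
  · simp only [cy, zpow_sub, zpow_natCast, hm, pow_orderOf_eq_one, zpow_zero, one_mul, zpow_one]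
    rw [mul_right_comm, htt, one_mul]
  · simp [cy, htt]
  · simp only [cy, zpow_sub, zpow_natCast, hm, pow_orderOf_eq_one, zpow_zero, one_mul, zpow_one]

/-- connection set of an odd prism -/
def OP (S : Set G) (s t : G) : Prop :=
  S = {s, s⁻¹, t} ∧ Odd (orderOf s) ∧ 3 ≤ orderOf s ∧ t * t = 1 ∧ t ∉ Subgroup.zpowers s

theorem flat_odd' {S : Set G} (hS : Sy S) (h1 : (1 : G) ∉ S) (hgen : Subgroup.closure S = ⊤) {s t : G}
    (hs : s ∈ S) (ht : t ∈ S) (hts : t ≠ s) (hts' : t ≠ s⁻¹) (hm : 3 ≤ orderOf s)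
    (ho : Odd (idx (Subgroup.zpowers s) t)) : K0 S s t := by
  by_cases htK : t ∈ Subgroup.zpowers s
  · exact flat_A1 hS h1 hgen hs ht hts hts' htK
  · exact flat_odd hS h1 hgen hs ht htK hm ho

theorem flat_caseA {S : Set G} (hS : Sy S) (h1 : (1 : G) ∉ S) (hgen : Subgroup.closure S = ⊤)
    (hop : ∀ s t, ¬ OP S s t) {s t : G}
    (hs : s ∈ S) (ht : t ∈ S) (hts : t ≠ s) (hts' : t ≠ s⁻¹) (hm : 3 ≤ orderOf s) : K0 S s t := by
  by_cases ho : Odd (idx (Subgroup.zpowers s) t)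
  · exact flat_odd' hS h1 hgen hs ht hts hts' hm ho
  by_cases ho' : 3 ≤ orderOf t ∧ Odd (idx (Subgroup.zpowers t) s)
  · exact (flat_odd' hS h1 hgen ht hs (Ne.symm hts) (by rintro rfl; simp at hts') ho'.1 ho'.2).swap
  have htK : t ∉ Subgroup.zpowers s := by
    intro h
    apply ho
    rw [show idx (Subgroup.zpowers s) t = 1 from ?_]
    · decide
    · have := (pow_mem_iff (Subgroup.zpowers s) t 1).1 (by simpa using h)
      simpa using this
  have hn2 := idx_two htK
  obtain ⟨r, hr, hr'⟩ := exp_ex ((pow_mem_iff (Subgroup.zpowers s) t _).2 dvd_rfl)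
  rw [Nat.not_odd_iff_even] at ho
  have hodd : ∀ j : ℕ, Odd j → s ^ j ∈ Subgroup.zpowers t → Odd (idx (Subgroup.zpowers t) s) := by
    intro j hj h
    rw [pow_mem_iff] at h
    exact Odd.of_dvd_nat hj h
  by_cases h4 : 4 ≤ idx (Subgroup.zpowers s) t
  · by_cases hcase : Even (orderOf s) → Even r
    · exact flat_ev4 hS h1 hgen hs ht htK hm ho h4 hr' hcase
    · exfalso
      push Not at hcase
      rw [Nat.not_even_iff_odd] at hcase
      refine ho' ⟨?_, hodd r hcase.2 (by rw [← hr']; exact Subgroup.npow_mem_zpowers _ _)⟩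
      by_contra hlt
      have hp := orderOf_pos t
      have : t ^ 2 ∈ Subgroup.zpowers s := by
        rcases (by omega : orderOf t = 1 ∨ orderOf t = 2) with h | h
        · rw [orderOf_eq_one_iff] at h; rw [h]; simp
        · rw [← h, pow_orderOf_eq_one]; exact one_mem _
      rw [pow_mem_iff] at this
      have := Nat.le_of_dvd (by omega) this
      omega
  have hi : idx (Subgroup.zpowers s) t = 2 := by
    obtain ⟨j, hj⟩ := ho; omega
  by_cases htop : ext (Subgroup.zpowers s) t = ⊤
  swap
  · obtain ⟨u, hu, huL⟩ := exists_not_mem hgen htop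
    exact flat_A2 hS h1 hgen hs ht htK hm hi hu huL
  by_cases he : Even (orderOf s)
  · exact flat_hi hS hs ht htK hi htop he
  rw [Nat.not_even_iff_odd] at he
  have htt : t * t = 1 := by
    have h := fun h => ho' ⟨h, hodd _ he (by rw [pow_orderOf_eq_one]; exact one_mem _)⟩
    have ht1 : orderOf t ≠ 1 := by
      rw [Ne, orderOf_eq_one_iff]; rintro rfl; exact h1 ht
    have hp := orderOf_pos t
    have : orderOf t = 2 := by
      by_contra h2
      exact h (by omega)
    rw [← pow_two, ← this, pow_orderOf_eq_one]
  have hti : t⁻¹ = t := inv_eq_of_mul_eq_one_left htt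
  -- third generator
  have hex : ∃ u ∈ S, u ≠ s ∧ u ≠ s⁻¹ ∧ u ≠ t := by
    by_contra hne
    push Not at hne
    refine hop s t ⟨?_, he, hm, htt, htK⟩
    ext u
    simp only [Set.mem_insert_iff, Set.mem_singleton_iff]
    constructor
    · intro hu
      by_cases h1 : u = s
      · exact .inl h1
      · by_cases h2 : u = s⁻¹
        · exact .inr (.inl h2)
        · exact .inr (.inr (hne u hu h1 h2))
    · rintro (rfl | rfl | rfl)
      exacts [hs, hS _ hs, ht]
  obtain ⟨u, hu, hus, hus', hut⟩ := hex
  rcases two_rows hi htop u with h | h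
  · obtain ⟨k, hk, rfl⟩ := exp_ex h
    have hk0 : k ≠ 0 := by rintro rfl; exact h1 (by simpa using hu)
    have hk1 : k ≠ 1 := by rintro rfl; simp at hus
    have hkm : k + 1 ≠ orderOf s := by
      intro h
      apply hus'
      rw [eq_inv_iff_mul_eq_one, ← pow_succ, h, pow_orderOf_eq_one]
    exact flat_pr1 hS hs ht hi htop (by omega) (by omega) hu
  · obtain ⟨k, hk, h2⟩ := exp_ex h
    rw [inv_mul_eq_iff_eq_mul] at h2
    subst h2
    have hk0 : k ≠ 0 := by rintro rfl; simp at hut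
    rcases Nat.even_or_odd k with ⟨j, hj⟩ | hodd
    · obtain rfl : k = 2 * j := by omega
      exact flat_pr2 hS hs ht htt hi htop (by omega) (by omega) hu
    · obtain ⟨j, hj⟩ := Nat.Odd.sub_odd he hodd
      have h3 := hS _ hu
      refine flat_pr2 hS hs ht htt hi htop (k := j) (by omega) (by omega) ?_
      rw [show 2 * j = orderOf s - k by omega]
      convert h3 using 1
      rw [mul_inv, hti]
      congr 1
      rw [eq_inv_iff_mul_eq_one, ← pow_add, show orderOf s - k + k = orderOf s by omega, pow_orderOf_eq_one]

end grp
end HamSp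


/-! Part 17 -/
set_option linter.unusedSectionVars false
set_option linter.unusedSimpArgs false
set_option linter.unusedVariables false
namespace HamSp

section lst
variable {α : Type*} {R : α → α → Prop} {f : α → α → ZMod 2}

def pv (f : α → α → ZMod 2) : α → List α → ZMod 2
  | _, [] => 0
  | x, y :: l => f x y + pv f y l

def lastOf : α → List α → α
  | x, [] => x
  | _, y :: l => lastOf y l

theorem HP.ofList (l : List α) (x : α) (hc : (x :: l).IsChain R) (hn : (x :: l).Nodup) :
    HP R f {z | z ∈ x :: l} x (lastOf x l) (pv f x l) := by
  induction l generalizing x with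
  | nil => exact (HP.single x).congr (by ext z; simp) rfl
  | cons y l ih =>
    rw [List.isChain_cons_cons] at hc
    rw [List.nodup_cons] at hn
    refine (HP.cons (x := x) (by simpa using hn.1) hc.1 (ih y hc.2 hn.2)).congr ?_ rfl
    ext z; simp

theorem EP.ofList (l : List α) (x : α) (hc : (x :: l).IsChain R) (hn : (x :: l).Nodup) :
    EP R {z | z ∈ x :: l} x (lastOf x l) := (HP.ofList (f := fun _ _ => 0) l x hc hn).toEP
end lst

section grp
variable {G : Type*} [CommGroup G] [Finite G]

/-- prism relation -/
abbrev bx {α : Type*} (R : α → α → Prop) (p q : α × Bool) : Prop :=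
  (p.2 = q.2 ∧ R p.1 q.1) ∨ (p.1 = q.1 ∧ p.2 ≠ q.2)

abbrev r0 (_ _ : Unit) : Prop := False

def bF {α : Type*} (F : α → G) (b : G) (p : α × Bool) : G := F p.1 * (if p.2 then b else 1)

structure Cb {α : Type*} (T : Set G) (R : α → α → Prop) (F : α → G) : Prop where
  inj : Function.Injective F
  adj : ∀ x y, R x y → L T (F x) (F y)

theorem Cb.zero (T : Set G) : Cb T r0 (fun _ => (1 : G)) where
  inj := fun _ _ _ => rfl
  adj := fun _ _ h => h.elim

theorem Cb.step {α : Type*} {T : Set G} {R : α → α → Prop} {F : α → G} (h : Cb T R F) {K : Subgroup G} {b : G}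
    (hF : ∀ x, F x ∈ K) (hb : b ∉ K) (hbT : b ∈ T) (hbT' : b⁻¹ ∈ T) : Cb T (bx R) (bF F b) where
  inj := by
    rintro ⟨x, i⟩ ⟨y, j⟩ hxy
    have hx := hF x
    have hy := hF y
    rcases i with _ | _ <;> rcases j with _ | _ <;> simp only [bF, if_true, if_false, mul_one, Bool.false_eq_true] at hxy
    · rw [h.inj hxy]
    · exact absurd (by have := mul_mem (inv_mem hy) hx; rw [hxy] at this; simpa using this) hb
    · exact absurd (by have := mul_mem (inv_mem hx) hy; rw [← hxy] at this; simpa using this) hb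
    · rw [h.inj (mul_right_cancel hxy)]
  adj := by
    rintro ⟨x, i⟩ ⟨y, j⟩ (⟨h1, h2⟩ | ⟨h1, h2⟩)
    · simp only at h1 h2
      subst h1
      have := h.adj _ _ h2
      simp only [bF]
      rwa [mul_comm (F x), mul_comm (F y), L_mul]
    · simp only at h1 h2
      subst h1
      simp only [bF]
      rw [L_mul]
      rcases i with _ | _ <;> rcases j with _ | _ <;> simp [L] at h2 ⊢ <;> assumption

theorem bF_mem {α : Type*} {F : α → G} {K : Subgroup G} (b : G) (hF : ∀ x, F x ∈ K) (p : α × Bool) :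
    bF F b p ∈ ext K b := by
  rw [bF]
  refine mul_mem (le_ext K b (hF _)) ?_
  split
  · exact mem_ext _ _
  · exact one_mem _

theorem bF_range {α : Type*} {F : α → G} {K : Subgroup G} {b : G} (hF : Set.range F = K) :
    Set.range (bF F b) = Strip K b 2 := by
  ext z
  constructor
  · rintro ⟨⟨x, i⟩, rfl⟩
    have hx : F x ∈ (K : Set G) := by rw [← hF]; exact ⟨x, rfl⟩
    rcases i with _ | _
    · exact ⟨0, by omega, by simpa [bF] using hx⟩
    · exact ⟨1, by omega, by simpa [bF, mul_comm] using hx⟩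
  · rintro ⟨i, hi, h⟩
    have h' : _ ∈ (K : Set G) := h
    rw [← hF] at h'
    obtain ⟨x, hx⟩ := h'
    rcases (by omega : i = 0 ∨ i = 1) with rfl | rfl
    · exact ⟨(x, false), by simp [bF, hx]⟩
    · exact ⟨(x, true), by simp [bF, hx]⟩

theorem idx_inv2 {K : Subgroup G} {b : G} (hb : b ∉ K) (hbb : b * b = 1) : idx K b = 2 := by
  have h2 := idx_two hb
  have : b ^ 2 ∈ K := by rw [pow_two, hbb]; exact one_mem _
  rw [pow_mem_iff] at this
  have := Nat.le_of_dvd (by omega) this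
  omega

theorem bF_range' {α : Type*} {F : α → G} {K : Subgroup G} {b : G} (hF : Set.range F = K) (hb : b ∉ K)
    (hbb : b * b = 1) : Set.range (bF F b) = ext K b := by
  rw [bF_range hF, ← Strip_full, idx_inv2 hb hbb]

theorem range_mem {α : Type*} {F : α → G} {K : Subgroup G} (hF : Set.range F = K) (x : α) : F x ∈ K := by
  have : F x ∈ (K : Set G) := by rw [← hF]; exact ⟨x, rfl⟩
  exact this

theorem Cb.hp {α : Type*} {T U : Set G} {R : α → α → Prop} {F : α → G} (h : Cb T R F) (f : G → G → ZMod 2)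
    (hU : Set.range F = U) (x : α) (l : List α) (hc : (x :: l).IsChain R) (hn : (x :: l).Nodup)
    (ha : ∀ z, z ∈ x :: l) :
    HP (L T) f U (F x) (F (lastOf x l)) (pv (fun a b => f (F a) (F b)) x l) := by
  refine ((HP.ofList l x hc hn).map (Q := L T) (f' := f) (f := fun a b => f (F a) (F b)) F h.inj.injOn (fun a _ b _ => h.adj a b)
    (fun _ _ _ _ _ => rfl)).congr ?_ rfl
  rw [← hU, ← Set.image_univ]
  congr 1
  ext z; simpa using ha z

theorem Cb.ep {α : Type*} {T : Set G} {R : α → α → Prop} {F : α → G} (h : Cb T R F)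
    (x : α) (l : List α) (hc : (x :: l).IsChain R) (hn : (x :: l).Nodup) :
    EP (L T) (F '' {z | z ∈ x :: l}) (F x) (F (lastOf x l)) :=
  (EP.ofList l x hc hn).map (Q := L T) F h.inj.injOn (fun a _ b _ => h.adj a b)

theorem flat_caseB {S : Set G} (hS : Sy S) (h1 : (1 : G) ∉ S) (hgen : Subgroup.closure S = ⊤)
    (hop : ∀ s t, ¬ OP S s t) {p q : G}
    (hp : p ∈ S) (hq : q ∈ S) (hqp : q ≠ p) (hpp : p * p = 1) (hqq : q * q = 1) : K0 S p q := by
  have ip : p⁻¹ = p := inv_eq_of_mul_eq_one_left hpp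
  have iq : q⁻¹ = q := inv_eq_of_mul_eq_one_left hqq
  have hp1 : p ≠ 1 := by rintro rfl; exact h1 hp
  have hq1 : q ≠ 1 := by rintro rfl; exact h1 hq
  have hp0 : p ∉ (⊥ : Subgroup G) := by simpa using hp1
  set P := ext (⊥ : Subgroup G) p with hP
  have c0 := Cb.zero (G := G) S
  have g0 : Set.range (fun _ : Unit => (1 : G)) = ((⊥ : Subgroup G) : Set G) := by ext z; simp [eq_comm]
  have c1 := c0.step (range_mem g0) hp0 hp (hS _ hp)
  have g1 := bF_range' g0 hp0 hpp
  have hq0 : q ∉ P := by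
    intro h
    have : q ∈ (P : Set G) := h
    rw [hP, ← g1] at this
    obtain ⟨⟨_, i⟩, hi⟩ := this
    rcases i with _ | _ <;> simp [bF] at hi
    · exact hq1 hi.symm
    · exact hqp hi.symm
  have c2 := c1.step (range_mem g1) hq0 hq (hS _ hq)
  have g2 := bF_range' g1 hq0 hqq
  set V := ext P q with hV
  have rP : RE P (Adj1 ∅ p) := by
    have h := RE_single hp1
    have e1 : P = Subgroup.zpowers p := by simp [hP, ext]
    have e2 : Adj1 ∅ p = {p, p⁻¹} := by simp [Adj1]
    rwa [e1, e2]
  have rV : RE V (Adj1 (Adj1 ∅ p) q) := RE_step rP hq0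
  have hAV : Adj1 (Adj1 ∅ p) q ⊆ S := Adj1_subS (Adj1_subS (by simp) hp hS) hq hS
  by_cases hVt : V = ⊤
  · refine K0.of_one fun f hf => ?_
    rw [hVt] at g2
    have h := c2.hp f g2 (((), false), false) [(((), true), false), (((), true), true), (((), false), true)]
      (by decide) (by decide) (by decide)
    have h2 := hf.ham _ ⟨_, _, _, h, by simpa [lastOf, bF, L] using hS _ hq, rfl⟩
    simp [lastOf, bF, pv] at h2
    have e1 := hf.symm (p * q) q
    have e2 := hf.symm q 1
    rw [mul_comm q p]
    grind
  by_cases h3 : ∃ s ∈ S, 3 ≤ orderOf s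
  · obtain ⟨s, hs, hso⟩ := h3
    have hsV : s ∉ V := by
      intro h
      have : s ∈ (V : Set G) := h
      rw [hV, ← g2] at this
      obtain ⟨x, hx⟩ := this
      have hss : s ^ 2 = 1 := by
        rw [← hx]
        obtain ⟨⟨_, i⟩, j⟩ := x
        rcases i with _ | _ <;> rcases j with _ | _ <;> simp [bF, pow_two, mul_mul_mul_comm, hpp, hqq]
      have := Nat.le_of_dvd (by omega) (orderOf_dvd_of_pow_eq_one hss)
      omega
    have k0 : K0 S s q := flat_caseA hS h1 hgen hop hs hq (by
      rintro rfl; exact hsV (mem_ext _ _)) (by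
      rintro rfl; apply hsV; simpa using inv_mem (mem_ext P s⁻¹)) hso
    have c3 := c2.step (range_mem g2) hsV hs (hS _ hs)
    have g3 := bF_range (b := s) g2
    have hbr := (br_strip hS hgen rV hAV hs hsV 2 (by omega) (by
      intro i hi hi2
      obtain rfl : i = 1 := by omega
      simpa using hsV) (mem_Adj1 _ _)).trl p
    have hpV : p ∈ V := le_ext _ _ (mem_ext _ _)
    rw [show {z | p⁻¹ * z ∈ Strip V s 2} = Strip V s 2 by
      ext z
      simp only [Strip, Set.mem_ofPred_eq]
      refine exists_congr fun i => and_congr_right fun _ => ?_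
      rw [mul_left_comm]
      exact Subgroup.mul_mem_cancel_left _ (inv_mem hpV)] at hbr
    refine K0.of_one fun f hf' => ?_
    have hf := hf'.trl s⁻¹
    set f' : G → G → ZMod 2 := fun x y => f (s⁻¹ * x) (s⁻¹ * y) with hfd
    have h1 := c3.hp f' g3 ((((), true), false), true) [((((), false), false), true), ((((), false), false), false),
      ((((), true), false), false), ((((), true), true), false), ((((), false), true), false), ((((), false), true), true),
      ((((), true), true), true)] (by decide) (by decide) (by decide)
    have h2 := c3.hp f' g3 ((((), true), false), true) [((((), true), false), false), ((((), false), false), false),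
      ((((), false), false), true), ((((), false), true), true), ((((), false), true), false), ((((), true), true), false),
      ((((), true), true), true)] (by decide) (by decide) (by decide)
    simp [lastOf, bF] at h1 h2 hbr
    rw [show p * (s * q) = p * q * s from Additive.ofMul.injective (by simp only [ofMul_mul]; abel)] at hbr
    have h := hf.br hS (by
      rw [mul_right_comm]
      exact L_symm hS _ _ (L_right _ hq)) hbr h1 h2
    have k := k0 f' hf p
    have hsy := hf.symm
    simp only [pv, bF, one_mul, mul_one, if_true, if_false, Bool.false_eq_true] at h
    have e1 := hsy (p * s) s
    have e2 := hsy (p * q) q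
    have e3 := hsy (q * s) s
    have e4 := hsy (p * q * s) (q * s)
    have e5 := hsy (p * s) p
    have e6 : f' (p * s) (p * q * s) = f' (p * s) (p * s * q) := by rw [mul_right_comm]
    have e7 := hsy s 1
    have e8 := hsy p 1
    have e9 := hsy q (q * s)
    have e10 := hsy (p * q) (p * q * s)
    rw [mul_right_comm p s q] at k
    have m1 : f' s (p * s) = f 1 p := by simp [hfd, mul_left_comm]
    have m2 : f' s (q * s) = f 1 q := by simp [hfd, mul_left_comm]
    have m3 : f' (q * s) (p * q * s) = f q (q * p) := by
      simp only [hfd]; congr 1 <;> exact Additive.ofMul.injective (by simp only [ofMul_mul, ofMul_inv]; abel)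
    have m4 : f' (p * s) (p * q * s) = f p (p * q) := by
      simp only [hfd]; congr 1 <;> exact Additive.ofMul.injective (by simp only [ofMul_mul, ofMul_inv]; abel)
    grind
  -- all involutions
  have hinv : ∀ s ∈ S, s * s = 1 := by
    intro s hs
    have h2 : ¬ 3 ≤ orderOf s := fun h => h3 ⟨s, hs, h⟩
    have hp := orderOf_pos s
    have : orderOf s ≠ 1 := by
      rw [Ne, orderOf_eq_one_iff]; rintro rfl; exact h1 hs
    rw [← pow_two, ← show orderOf s = 2 by omega, pow_orderOf_eq_one]
  obtain ⟨u, hu, huV⟩ := exists_not_mem hgen hVt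
  have c3 := c2.step (range_mem g2) huV hu (hS _ hu)
  have g3 := bF_range' g2 huV (hinv _ hu)
  set W := ext V u with hW
  by_cases hWt : W = ⊤
  · refine K0.of_one fun f hf => ?_
    rw [hWt] at g3
    have key := fun x l hc hn ha (h : L S _ _) => hf.ham _ ⟨_, _, _, c3.hp f g3 x l hc hn ha, h, rfl⟩
    -- (p,q,u): four cycle on p,u with rungs q
    have h0 := key ((((), false), false), false) [((((), false), false), true), ((((), true), false), true),
      ((((), true), false), false), ((((), true), true), false), ((((), true), true), true), ((((), false), true), true),
      ((((), false), true), false)] (by decide) (by decide) (by decide) (c3.adj _ _ (by decide))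
    have h1 := key ((((), true), false), false) [((((), false), false), false), ((((), false), false), true),
      ((((), true), false), true), ((((), true), true), true), ((((), false), true), true), ((((), false), true), false),
      ((((), true), true), false)] (by decide) (by decide) (by decide) (c3.adj _ _ (by decide))
    have h2 := key ((((), true), false), true) [((((), true), false), false), ((((), false), false), false), ((((), false), false), true),
      ((((), false), true), true), ((((), false), true), false), ((((), true), true), false), 
      ((((), true), true), true)] (by decide) (by decide) (by decide) (c3.adj _ _ (by decide))
    have h3 := key ((((), false), false), true) [((((), true), false), true), ((((), true), false), false), ((((), false), false), false), 
      ((((), false), true), false), ((((), true), true), false), ((((), true), true), true), 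
      ((((), false), true), true)] (by decide) (by decide) (by decide) (c3.adj _ _ (by decide))
    simp only [pv, lastOf, bF, one_mul, mul_one, if_true, if_false, Bool.false_eq_true] at h0 h1 h2 h3
    have hsy := hf.symm
    rw [mul_comm q p]
    have s1 := hsy u 1
    have s2 := hsy p 1
    have s3 := hsy q 1
    have s4 := hsy u (p * u)
    have s5 := hsy u (q * u)
    have s6 := hsy p (p * u)
    have s7 := hsy p (p * q)
    have s8 := hsy q (q * u)
    have s9 := hsy q (p * q)
    have s10 := hsy (p * q) (p * q * u)
    have s11 := hsy (p * u) (p * q * u)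
    have s12 := hsy (q * u) (p * q * u)
    grind
  obtain ⟨w, hw, hwW⟩ := exists_not_mem hgen hWt
  have rW : RE W (Adj1 (Adj1 (Adj1 ∅ p) q) u) := RE_step rV huV
  have rX := RE_step rW hwW
  set T := Adj1 (Adj1 (Adj1 (Adj1 ∅ p) q) u) w with hT
  have hTS : T ⊆ S := Adj1_subS (Adj1_subS hAV hu hS) hw hS
  have tw : w ∈ T := mem_Adj1 _ _
  have tu : u ∈ T := Adj1_sub _ _ (mem_Adj1 _ _)
  have tq : q ∈ T := Adj1_sub _ _ (Adj1_sub _ _ (mem_Adj1 _ _))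
  have tp : p ∈ T := Adj1_sub _ _ (Adj1_sub _ _ (Adj1_sub _ _ (mem_Adj1 _ _)))
  have d1 := (Cb.zero (G := G) T).step (range_mem g0) hp0 tp (rX.symm _ tp)
  have d2 := d1.step (range_mem g1) hq0 tq (rX.symm _ tq)
  have d3 := d2.step (range_mem g2) huV tu (rX.symm _ tu)
  have d4 := d3.step (range_mem g3) hwW tw (rX.symm _ tw)
  have g4 := bF_range' g3 hwW (hinv _ hw)
  have a := d4.ep (((((), true), false), false), false) [(((((), true), false), true), false), (((((), false), false), true), false),
    (((((), false), true), true), false), (((((), false), true), false), false)] (by decide) (by decide)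
  have b := d4.ep (((((), true), true), false), false) [(((((), true), true), true), false), (((((), true), true), true), true),
    (((((), true), true), false), true), (((((), false), true), false), true), (((((), false), true), true), true),
    (((((), false), false), true), true), (((((), true), false), true), true), (((((), true), false), false), true),
    (((((), false), false), false), true), (((((), false), false), false), false)] (by decide) (by decide)
  have key : ∀ {A B : Set G}, Disjoint A B → A ∪ B = ext W w → EP (L T) A p q → EP (L T) B (p * q) 1 → K0 S p q :=
    fun hd hu ha hb => sw_sub hS hgen rX hTS hp hq (Ne.symm hqp) hd hu (x := 1) (by simpa using ha) (by simpa using hb)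
  simp only [lastOf, bF, one_mul, mul_one, if_true, if_false, Bool.false_eq_true] at a b
  refine key ?_ ?_ a b
  · rw [Set.disjoint_image_iff d4.inj, Set.disjoint_left]
    simp only [Set.mem_ofPred_eq]
    decide
  · rw [← Set.image_union, ← g4, ← Set.image_univ]
    congr 1
    ext z
    simp only [Set.mem_union, Set.mem_ofPred_eq, Set.mem_univ, iff_true]
    revert z
    decide

/-- Main structural theorem. -/
theorem core {S : Set G} (hS : Sy S) (h1 : (1 : G) ∉ S) (hgen : Subgroup.closure S = ⊤) (hne : S.Nonempty)
    (hop : ∀ s t, ¬ OP S s t) {f : G → G → ZMod 2} (hf : Ann S f) :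
    ∃ φ : G → ZMod 2, ∃ e : ZMod 2, ∀ z, ∀ t ∈ S, f z (z * t) = φ z + φ (z * t) + e := by
  have hinv : ∀ s ∈ S, ¬ 3 ≤ orderOf s → s * s = 1 := by
    intro s hs h2
    have hp := orderOf_pos s
    have : orderOf s ≠ 1 := by
      rw [Ne, orderOf_eq_one_iff]; rintro rfl; exact h1 hs
    rw [← pow_two, ← show orderOf s = 2 by omega, pow_orderOf_eq_one]
  have hfl : Fl S f := by
    intro g s hs t ht hts hts'
    suffices K0 S s t from this f hf g
    by_cases h : 3 ≤ orderOf s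
    · exact flat_caseA hS h1 hgen hop hs ht hts hts' h
    by_cases h' : 3 ≤ orderOf t
    · exact (flat_caseA hS h1 hgen hop ht hs (Ne.symm hts) (by rintro rfl; simp at hts') h').swap
    exact flat_caseB hS h1 hgen hop hs ht hts (hinv s hs h) (hinv t ht h')
  obtain ⟨F', ⟨φ, e, rfl⟩, h⟩ := partII ⟨hf.symm, hfl, 0, fun _ => rfl, hf.ham⟩ hS h1 hgen hne
  refine ⟨φ, e, fun z t ht => ?_⟩
  have := h z t ht
  grind

end grp
end HamSp


/-! Part 18 -/
set_option linter.unusedSectionVars false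
set_option linter.unusedSimpArgs false
set_option linter.unusedVariables false
namespace HamSp

section graph
variable {V : Type*} {X : SimpleGraph V}

def wsum (f : V → V → ZMod 2) : ∀ {u v : V}, X.Walk u v → ZMod 2
  | _, _, .nil => 0
  | u, _, .cons (v := v) _ p => f u v + wsum f p

theorem wsum_congr {f g : V → V → ZMod 2} (h : ∀ x y, X.Adj x y → f x y = g x y) {u v : V} (w : X.Walk u v) :
    wsum f w = wsum g w := by
  induction w with
  | nil => rfl
  | cons ha p ih => simp only [wsum]; rw [h _ _ ha, ih]

theorem wsum_lin (φ : V → ZMod 2) (a b : ZMod 2) (f g : V → V → ZMod 2) {u v : V} (w : X.Walk u v) :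
    wsum (fun x y => φ x + φ y + a * f x y + b * g x y) w = φ u + φ v + a * wsum f w + b * wsum g w := by
  induction w with
  | nil => simp [wsum, CharTwo.add_self_eq_zero]
  | cons ha p ih => simp only [wsum]; rw [ih]; grind

theorem wsum_one {u v : V} (w : X.Walk u v) : wsum (fun _ _ => 1) w = (w.length : ZMod 2) := by
  induction w with
  | nil => simp [wsum]
  | cons ha p ih => simp only [wsum]; rw [ih]; simp [add_comm]

theorem path_edge {u v : V} (p : X.Walk v u) (hp : p.IsPath) (he : s(u, v) ∈ p.edges) : p.length = 1 := by
  cases p with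
  | nil => simp at he
  | cons h q =>
    rename_i z
    rw [Walk.cons_isPath_iff] at hp
    rw [Walk.edges_cons, List.mem_cons] at he
    rcases he with he | he
    · have hz : z = u := by
        have h2 := h.ne
        rw [Sym2.eq_iff] at he
        rcases he with ⟨h3, h4⟩ | ⟨h3, h4⟩
        · exact absurd h4 h2
        · exact h3.symm
      subst hz
      have := Walk.length_eq_zero_iff.2 (Walk.isPath_iff_nil.1 hp.1)
      simp [this]
    · exact absurd (q.snd_mem_support_of_mem_edges he) hp.2

theorem bypass_parity [DecidableEq V] (hc : ∀ (u : V) (w : X.Walk u u), w.IsCycle → Even w.length) {u v : V} (p : X.Walk u v) :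
    (p.length : ZMod 2) = p.bypass.length := by
  induction p with
  | nil => rfl
  | cons h p ih =>
    rename_i u v w
    rw [Walk.length_cons, Nat.cast_add, ih]
    simp only [Walk.bypass]
    split_ifs with hs
    · have h1 := congrArg Walk.length (p.bypass.take_spec hs)
      rw [Walk.length_append] at h1
      have hp := (p.bypass_isPath).takeUntil hs
      rw [← h1]
      suffices Even ((p.bypass.takeUntil u hs).length + 1) by
        have := (ZMod.natCast_eq_zero_iff_even).2 this
        push_cast at this ⊢
        grind
      by_cases he : s(u, v) ∈ (p.bypass.takeUntil u hs).edges
      · rw [path_edge _ hp he]; decide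
      · exact hc _ (Walk.cons h (p.bypass.takeUntil u hs)) ((Walk.cons_isCycle_iff _ _).2 ⟨hp, he⟩)
    · simp

theorem colorable_of_cycles (hc : ∀ (u : V) (w : X.Walk u u), w.IsCycle → Even w.length) : X.Colorable 2 := by
  classical
  rw [SimpleGraph.two_colorable_iff_forall_loop_even]
  intro u w
  have h := bypass_parity hc w
  rw [Walk.length_eq_zero_iff.2 (Walk.isPath_iff_nil.1 w.bypass_isPath)] at h
  exact (ZMod.natCast_eq_zero_iff_even).1 (by simpa using h)

theorem HP.walk {R : V → V → Prop} {f : V → V → ZMod 2} {U : Set V} {x y : V} {v : ZMod 2} (h : HP R f U x y v)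
    (hR : ∀ a b, R a b → X.Adj a b) :
    ∃ p : X.Walk x y, p.IsPath ∧ (∀ z, z ∈ p.support ↔ z ∈ U) ∧ wsum f p = v := by
  induction h with
  | single x => exact ⟨.nil, by simp, by simp, rfl⟩
  | cons hx hr h ih =>
    obtain ⟨p, h1, h2, h3⟩ := ih
    refine ⟨.cons (hR _ _ hr) p, ?_, ?_, ?_⟩
    · rw [Walk.cons_isPath_iff, h2]; exact ⟨h1, hx⟩
    · intro z; simp [h2]
    · simp [wsum, h3]

theorem HP.cycle {R : V → V → Prop} {f : V → V → ZMod 2} {U : Set V} {x y : V} {v : ZMod 2} (h : HP R f U x y v)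
    (hR : ∀ a b, R a b → X.Adj a b) (hyx : R y x) (hU : ∃ z ∈ U, z ≠ x ∧ z ≠ y) :
    ∃ p : X.Walk x y, ∃ w : X.Walk y y, w = .cons (hR _ _ hyx) p ∧ w.IsCycle ∧ p.IsPath ∧ (∀ z, z ∈ p.support ↔ z ∈ U) ∧ wsum f w = v + f y x := by
  obtain ⟨p, h1, h2, h3⟩ := h.walk hR
  refine ⟨p, _, rfl, ?_, h1, h2, by simp [wsum, h3, add_comm]⟩
  rw [Walk.cons_isCycle_iff]
  refine ⟨h1, fun he => ?_⟩
  have hl := path_edge p h1 he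
  obtain ⟨z, hz, hzx, hzy⟩ := hU
  rw [← h2] at hz
  cases p with
  | nil => simp at hl
  | cons h q =>
    cases q with
    | nil => simp at hz; tauto
    | cons h' q' => simp at hl

theorem HP.hamCycle [Fintype V] [DecidableEq V] {R : V → V → Prop} {f : V → V → ZMod 2} {x y : V} {v : ZMod 2} (h : HP R f Set.univ x y v)
    (hR : ∀ a b, R a b → X.Adj a b) (hyx : R y x) (h3 : 3 ≤ Fintype.card V) :
    ∃ w : X.Walk y y, w.IsHamiltonianCycle ∧ wsum f w = v + f y x := by
  obtain ⟨p, w, rfl, hc, hp, hU, hv⟩ := h.cycle hR hyx (by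
    by_contra hne
    push Not at hne
    have : (Finset.univ : Finset V) ⊆ {x, y} := by
      intro z _
      have := hne z trivial
      simp only [Finset.mem_insert, Finset.mem_singleton]
      tauto
    have h4 := (Finset.card_le_card this).trans Finset.card_le_two
    rw [Finset.card_univ] at h4
    omega)
  refine ⟨_, ⟨hc, ?_⟩, hv⟩
  have : p.IsHamiltonian := hp.isHamiltonian_of_mem fun z => (hU z).2 trivial
  intro a
  have := this a
  simpa using this

variable [DecidableEq V]

noncomputable def lbl (ψ : (X.edgeSet → ZMod 2) →ₗ[ZMod 2] ZMod 2) (x y : V) : ZMod 2 :=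
  open Classical in if h : X.Adj x y then ψ (Pi.single ⟨s(x, y), h⟩ 1) else 0

theorem lbl_symm (ψ : (X.edgeSet → ZMod 2) →ₗ[ZMod 2] ZMod 2) (x y : V) : lbl ψ x y = lbl ψ y x := by
  unfold lbl
  by_cases h : X.Adj x y
  · rw [dif_pos h, dif_pos h.symm]
    congr 2
    exact Subtype.ext Sym2.eq_swap
  · rw [dif_neg h, dif_neg (fun h' => h h'.symm)]

theorem eval_trail (ψ : (X.edgeSet → ZMod 2) →ₗ[ZMod 2] ZMod 2) {u v : V} (w : X.Walk u v) (hw : w.IsTrail) :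
    ψ (fun e => if (e : Sym2 V) ∈ w.edges then 1 else 0) = wsum (lbl ψ) w := by
  induction w with
  | nil => simp [wsum]; exact map_zero ψ
  | cons h p ih =>
    rename_i u v w
    rw [Walk.isTrail_cons] at hw
    rw [wsum, ← ih hw.1, lbl, dif_pos h, ← map_add]
    congr 1
    ext e
    simp only [Walk.edges_cons, List.mem_cons, Pi.add_apply]
    by_cases he : e = ⟨s(u, v), h⟩
    · subst he
      simp [hw.2]
    · rw [Pi.single_eq_of_ne he]
      have : (e : Sym2 V) ≠ s(u, v) := fun h' => he (Subtype.ext h')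
      simp [this]

theorem eval_cycle (ψ : (X.edgeSet → ZMod 2) →ₗ[ZMod 2] ZMod 2) {u : V} (w : X.Walk u u) (hw : w.IsCycle) :
    ψ (walkIndicator X w) = wsum (lbl ψ) w := eval_trail ψ w hw.isTrail

theorem exists_lbl [Finite V] (c : V → V → ZMod 2) (hc : ∀ x y, c x y = c y x) :
    ∃ ψ : (X.edgeSet → ZMod 2) →ₗ[ZMod 2] ZMod 2, ∀ x y, X.Adj x y → lbl ψ x y = c x y := by
  classical
  have := Fintype.ofFinite X.edgeSet
  refine ⟨∑ e : X.edgeSet, (Sym2.lift ⟨c, hc⟩ (e : Sym2 V)) • LinearMap.proj e, fun x y h => ?_⟩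
  rw [lbl, dif_pos h]
  simp [LinearMap.sum_apply, Pi.single_apply]

theorem ham_le_cyc : hamiltonSpace X ≤ cycleSpace X := by
  refine Submodule.span_mono ?_
  rintro f ⟨u, w, hw, rfl⟩
  exact ⟨u, w, hw.isCycle, rfl⟩

/-- abstract codimension criterion -/
theorem sep {M : Type*} [AddCommGroup M] [Module (ZMod 2) M] {H C : Submodule (ZMod 2) M}
    (h : ∀ ψ : M →ₗ[ZMod 2] ZMod 2, (∀ x ∈ H, ψ x = 0) → ∀ x ∈ C, ψ x = 0) : C ≤ H := by
  intro x hx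
  by_contra hxH
  obtain ⟨ψ, h1, h2⟩ := Submodule.exists_le_ker_of_notMem hxH
  exact h1 (h ψ (fun y hy => h2 hy) x hx)

theorem codim_one {M : Type*} [AddCommGroup M] [Module (ZMod 2) M] [Module.Finite (ZMod 2) M] (C : Submodule (ZMod 2) M)
    (ψ : M →ₗ[ZMod 2] ZMod 2) {x : M} (hx : x ∈ C) (hψ : ψ x ≠ 0) :
    Module.finrank (ZMod 2) C = Module.finrank (ZMod 2) (C ⊓ LinearMap.ker ψ : Submodule (ZMod 2) M) + 1 := by
  have h1 := LinearMap.finrank_range_add_finrank_ker (ψ.domRestrict C)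
  have h2 : LinearMap.range (ψ.domRestrict C) = ⊤ := by
    rw [LinearMap.range_eq_top]
    intro a
    refine ⟨(a * (ψ x)⁻¹) • ⟨x, hx⟩, ?_⟩
    simp [hψ]
  have h3 : Module.finrank (ZMod 2) (LinearMap.ker (ψ.domRestrict C)) = Module.finrank (ZMod 2) (C ⊓ LinearMap.ker ψ : Submodule (ZMod 2) M) := by
    rw [← Submodule.finrank_map_subtype_eq, show Submodule.map C.subtype (LinearMap.ker (ψ.domRestrict C)) =
      C ⊓ LinearMap.ker ψ from ?_]
    ext z
    simp only [Submodule.mem_map, LinearMap.mem_ker, Submodule.mem_inf, Submodule.subtype_apply]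
    constructor
    · rintro ⟨y, hy, rfl⟩; exact ⟨y.2, hy⟩
    · rintro ⟨h1, h2⟩; exact ⟨⟨z, h1⟩, h2, rfl⟩
  rw [h2, finrank_top, Module.finrank_self, h3] at h1
  omega

end graph
end HamSp


/-! Part 19 -/
set_option linter.unusedSectionVars false
set_option linter.unusedSimpArgs false
set_option linter.unusedVariables false
namespace HamSp
section grp
variable {G : Type*} [CommGroup G] [Fintype G] [DecidableEq G]

theorem cay_adj {S : Set G} (hS : Sy S) (h1 : (1 : G) ∉ S) (x y : G) : (cayleyGraph S).Adj x y ↔ L S x y := by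
  rw [cayleyGraph, SimpleGraph.fromRel_adj]
  constructor
  · rintro ⟨_, h | h⟩
    · exact h
    · exact L_symm hS _ _ h
  · intro h
    refine ⟨?_, .inl h⟩
    rintro rfl
    apply h1
    simpa [L] using h

theorem gen_of_conn {S : Set G} (hS : Sy S) (h1 : (1 : G) ∉ S) (hc : (cayleyGraph S).Connected) :
    Subgroup.closure S = ⊤ := by
  rw [eq_top_iff]
  rintro z -
  have key : ∀ {x y : G} (w : (cayleyGraph S).Walk x y), x⁻¹ * y ∈ Subgroup.closure S := by
    intro x y w
    induction w with
    | nil => simp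
    | cons h p ih =>
      have h2 := Subgroup.subset_closure ((cay_adj hS h1 _ _).1 h)
      have := mul_mem h2 ih
      simpa [mul_assoc] using this
  obtain ⟨w⟩ := hc.preconnected 1 z
  simpa using key w

theorem ann_of {S : Set G} (hS : Sy S) (h1 : (1 : G) ∉ S) (h3 : 3 ≤ Fintype.card G)
    {ψ : ((cayleyGraph S).edgeSet → ZMod 2) →ₗ[ZMod 2] ZMod 2}
    (hψ : ∀ x ∈ hamiltonSpace (cayleyGraph S), ψ x = 0) : Ann S (lbl ψ) where
  symm := lbl_symm ψ
  ham := by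
    rintro w ⟨x, y, u, hp, hyx, rfl⟩
    obtain ⟨w, hw, hv⟩ := hp.hamCycle (fun a b h => (cay_adj hS h1 a b).2 h) hyx h3
    rw [← hv, ← eval_cycle ψ w hw.isCycle]
    exact hψ _ (Submodule.subset_span ⟨_, w, hw, rfl⟩)

theorem ham_ex {S : Set G} (hS : Sy S) (h1 : (1 : G) ∉ S) (hgen : Subgroup.closure S = ⊤) (hne : S.Nonempty) :
    ∃ x y : G, EP (L S) Set.univ x y ∧ L S y x := by
  obtain ⟨s, hs⟩ := hne
  have hs1 : s ≠ 1 := by rintro rfl; exact h1 hs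
  have r := RE_single hs1
  have hp := r.path s (by simp)
  have hsub : ({s, s⁻¹} : Set G) ⊆ S := by rintro z (rfl | rfl); exacts [hs, hS _ hs]
  have hp := hp.monoL hsub
  rcases br_all hS hgen _ _ r hsub s (by simp) with h | ⟨p, q, h, hp1, hq⟩
  · rw [Set.compl_empty_iff] at h
    exact ⟨1, s, hp.congr h, L_symm hS _ _ (by simpa [L] using hs)⟩
  · refine ⟨1, p, (hp.append (L_symm hS _ _ hq) (h.reverse (L_symm hS)) disjoint_compl_right).congr (by simp), L_symm hS _ _ hp1⟩

/-- value of an annihilating functional on the cycle space, non-prism case -/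
theorem psi_val {S : Set G} (hS : Sy S) (h1 : (1 : G) ∉ S) (hgen : Subgroup.closure S = ⊤)
    (hop : ∀ s t, ¬ OP S s t) (h3 : 3 ≤ Fintype.card G)
    {ψ : ((cayleyGraph S).edgeSet → ZMod 2) →ₗ[ZMod 2] ZMod 2}
    (hψ : ∀ x ∈ hamiltonSpace (cayleyGraph S), ψ x = 0) :
    ∃ e : ZMod 2, (∀ (u : G) (w : (cayleyGraph S).Walk u u), w.IsCycle → ψ (walkIndicator _ w) = e * w.length) ∧
      (Odd (Fintype.card G) → e = 0) := by
  have hne : S.Nonempty := by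
    rw [Set.nonempty_iff_ne_empty]
    rintro rfl
    rw [Subgroup.closure_empty] at hgen
    have : Subsingleton G := by
      refine ⟨fun a b => ?_⟩
      have ha : a ∈ (⊥ : Subgroup G) := by rw [hgen]; trivial
      have hb : b ∈ (⊥ : Subgroup G) := by rw [hgen]; trivial
      rw [Subgroup.mem_bot] at ha hb
      rw [ha, hb]
    have := Fintype.card_le_one_iff_subsingleton.2 this
    omega
  have ha := ann_of hS h1 h3 hψ
  obtain ⟨φ, e, h⟩ := core hS h1 hgen hne hop ha
  have hv : ∀ (u v : G) (w : (cayleyGraph S).Walk u v), wsum (lbl ψ) w = φ u + φ v + e * w.length := by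
    intro u v w
    rw [wsum_congr (g := fun x y => φ x + φ y + e * (fun _ _ => 1) x y + 0 * (fun _ _ => 0) x y), wsum_lin, wsum_one]
    · simp
    · intro x y hxy
      have h2 := h x (x⁻¹ * y) ((cay_adj hS h1 _ _).1 hxy)
      simpa using h2
  refine ⟨e, fun u w hw => ?_, fun ho => ?_⟩
  · rw [eval_cycle ψ w hw, hv, CharTwo.add_self_eq_zero, zero_add]
  · obtain ⟨x, y, hp, hyx⟩ := ham_ex hS h1 hgen hne
    obtain ⟨v, hp⟩ := hp.toHP (lbl ψ)
    obtain ⟨w, hw, _⟩ := hp.hamCycle (fun a b h => (cay_adj hS h1 a b).2 h) hyx h3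
    have h4 := hψ _ (Submodule.subset_span ⟨_, w, hw, rfl⟩)
    rw [eval_cycle ψ w hw.isCycle, hv, CharTwo.add_self_eq_zero, zero_add, hw.length_eq, (ZMod.natCast_eq_one_iff_odd).2 ho, mul_one] at h4
    exact h4

theorem cyc_bot {V : Type*} [Fintype V] [DecidableEq V] (X : SimpleGraph V) (h : Fintype.card V < 3) : cycleSpace X = ⊥ := by
  rw [cycleSpace, Submodule.span_eq_bot]
  rintro f ⟨u, w, hw, rfl⟩
  have h1 := hw.three_le_length
  have h2 := hw.support_nodup.length_le_card
  simp at h2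
  omega

theorem main_eq {S : Set G} (hS : Sy S) (h1 : (1 : G) ∉ S) (hgen : Subgroup.closure S = ⊤)
    (hop : ∀ s t, ¬ OP S s t) (h : (cayleyGraph S).Colorable 2 ∨ Odd (Fintype.card G)) :
    hamiltonSpace (cayleyGraph S) = cycleSpace (cayleyGraph S) := by
  by_cases h3 : 3 ≤ Fintype.card G
  swap
  · have hb := cyc_bot (cayleyGraph S) (by omega)
    have := ham_le_cyc (X := cayleyGraph S)
    rw [hb] at this ⊢
    exact le_bot_iff.1 this
  refine le_antisymm ham_le_cyc (sep fun ψ hψ => ?_)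
  obtain ⟨e, he, ho⟩ := psi_val hS h1 hgen hop h3 hψ
  intro x hx
  suffices cycleSpace (cayleyGraph S) ≤ LinearMap.ker ψ from this hx
  rw [cycleSpace, Submodule.span_le]
  rintro f ⟨u, w, hw, rfl⟩
  rw [SetLike.mem_coe, LinearMap.mem_ker, he u w hw]
  rcases h with h | h
  · rw [(ZMod.natCast_eq_zero_iff_even).2 ((two_colorable_iff_forall_loop_even.1 h) u w), mul_zero]
  · rw [ho h, zero_mul]

theorem main_one {S : Set G} (hS : Sy S) (h1 : (1 : G) ∉ S) (hgen : Subgroup.closure S = ⊤)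
    (hop : ∀ s t, ¬ OP S s t) (h : ¬ ((cayleyGraph S).Colorable 2 ∨ Odd (Fintype.card G))) :
    Module.finrank (ZMod 2) (cycleSpace (cayleyGraph S)) =
        Module.finrank (ZMod 2) (hamiltonSpace (cayleyGraph S)) + 1 := by
  push Not at h
  obtain ⟨hc, ho⟩ := h
  have h3 : 3 ≤ Fintype.card G := by
    by_contra hlt
    apply hc
    refine colorable_of_cycles fun u w hw => ?_
    have h1 := hw.three_le_length
    have h2 := hw.support_nodup.length_le_card
    simp at h2
    omega
  rw [Nat.not_odd_iff_even] at ho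
  obtain ⟨ψ0, h0⟩ := exists_lbl (X := cayleyGraph S) (fun _ _ => 1) (fun _ _ => rfl)
  have hv0 : ∀ (u : G) (w : (cayleyGraph S).Walk u u), w.IsCycle → ψ0 (walkIndicator _ w) = w.length := by
    intro u w hw
    rw [eval_cycle _ w hw, wsum_congr h0, wsum_one]
  have hH : hamiltonSpace (cayleyGraph S) = cycleSpace (cayleyGraph S) ⊓ LinearMap.ker ψ0 := by
    refine le_antisymm (le_inf ham_le_cyc ?_) (sep fun ψ hψ x hx => ?_)
    · rw [hamiltonSpace, Submodule.span_le]
      rintro f ⟨u, w, hw, rfl⟩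
      rw [SetLike.mem_coe, LinearMap.mem_ker, hv0 u w hw.isCycle, hw.length_eq, (ZMod.natCast_eq_zero_iff_even).2 ho]
    · obtain ⟨e, he, -⟩ := psi_val hS h1 hgen hop h3 hψ
      have : cycleSpace (cayleyGraph S) ≤ LinearMap.ker (ψ - e • ψ0) := by
        rw [cycleSpace, Submodule.span_le]
        rintro f ⟨u, w, hw, rfl⟩
        rw [SetLike.mem_coe, LinearMap.mem_ker]
        simp [he u w hw, hv0 u w hw]
      have h5 := this hx.1
      have h6 : ψ0 x = 0 := hx.2
      rw [LinearMap.mem_ker] at h5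
      simpa [h6] using h5
  obtain ⟨u, w, hw, hodd⟩ : ∃ (u : G) (w : (cayleyGraph S).Walk u u), w.IsCycle ∧ ¬ Even w.length := by
    by_contra hne
    push Not at hne
    exact hc (colorable_of_cycles hne)
  rw [hH]
  refine codim_one _ ψ0 (x := walkIndicator _ w) (Submodule.subset_span ⟨u, w, hw, rfl⟩) ?_
  rw [hv0 u w hw, Ne, ZMod.natCast_eq_zero_iff_even]
  exact hodd

end grp
end HamSp


/-! Part 20 -/
set_option linter.unusedSectionVars false
set_option linter.unusedSimpArgs false
set_option linter.unusedVariables false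
namespace HamSp
section cut
variable {V : Type*} {X : SimpleGraph V} [Fintype V] [DecidableEq V]

theorem ham_cut {u : V} {w : X.Walk u u} (hw : w.IsHamiltonianCycle) (U : Set V) {x y : V} (hx : x ∈ U) (hy : y ∉ U) :
    ∃ a b, a ∈ U ∧ b ∉ U ∧ X.Adj a b ∧ s(a, b) ∈ w.edges := by
  have hx' := hw.mem_support x
  have hy' := hw.mem_support y
  obtain ⟨d, hd, h1, h2⟩ := ((w.takeUntil x hx').reverse.append (w.takeUntil y hy')).exists_boundary_dart U hx hy
  refine ⟨d.fst, d.snd, h1, h2, d.adj, ?_⟩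
  have : s(d.fst, d.snd) ∈ ((w.takeUntil x hx').reverse.append (w.takeUntil y hy')).edges :=
    List.mem_map_of_mem hd
  rw [Walk.edges_append, List.mem_append, Walk.edges_reverse, List.mem_reverse] at this
  rcases this with h | h
  · exact w.edges_takeUntil_subset_edges hx' h
  · exact w.edges_takeUntil_subset_edges hy' h

theorem ham_deg {u : V} {w : X.Walk u u} (hw : w.IsHamiltonianCycle) {v p q r : V} (hpq : p ≠ q) (hpr : p ≠ r) (hqr : q ≠ r)
    (hN : ∀ z, X.Adj v z → z = p ∨ z = q ∨ z = r) :
    (if s(v, p) ∈ w.edges then 1 else 0) + (if s(v, q) ∈ w.edges then 1 else 0) + (if s(v, r) ∈ w.edges then 1 else 0) = (2 : ℤ) := by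
  have h := hw.isCycle.ncard_neighborSet_toSubgraph_eq_two (hw.mem_support v)
  have hmem : ∀ z, z ∈ w.toSubgraph.neighborSet v ↔ s(v, z) ∈ w.edges := by
    intro z
    rw [Subgraph.mem_neighborSet, ← Walk.mem_edges_toSubgraph, Subgraph.mem_edgeSet]
  have hs : w.toSubgraph.neighborSet v = ((({p, q, r} : Finset V).filter (fun z => s(v, z) ∈ w.edges) : Finset V) : Set V) := by
    ext z
    rw [hmem, Finset.coe_filter, Set.mem_ofPred_eq]
    simp only [Finset.mem_insert, Finset.mem_singleton]
    constructor
    · intro hz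
      exact ⟨hN z (w.adj_of_mem_edges hz), hz⟩
    · exact fun hz => hz.2
  rw [hs, Set.ncard_coe_finset, Finset.card_filter, Finset.sum_insert (by simp [hpq, hpr]), Finset.sum_insert (by simp [hqr]),
    Finset.sum_singleton] at h
  have := congrArg (Nat.cast : ℕ → ℤ) h
  push_cast at this
  rw [← this]; ring
end cut

section grp
variable {G : Type*} [CommGroup G] [Fintype G] [DecidableEq G]

theorem op_facts {S : Set G} (hgen : Subgroup.closure S = ⊤) {s t : G} (h : OP S s t) :
    idx (Subgroup.zpowers s) t = 2 ∧ ext (Subgroup.zpowers s) t = ⊤ ∧ s ∈ S ∧ t ∈ S ∧ t⁻¹ = t := by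
  obtain ⟨hS, ho, h3, htt, ht⟩ := h
  refine ⟨idx_inv2 ht htt, ?_, by simp [hS], by simp [hS], inv_eq_of_mul_eq_one_left htt⟩
  rw [eq_top_iff, ← hgen, Subgroup.closure_le, hS]
  have h1 := le_ext (Subgroup.zpowers s) t (Subgroup.mem_zpowers s)
  rintro z (rfl | rfl | rfl)
  exacts [h1, inv_mem h1, mem_ext _ _]

theorem op_cases {S : Set G} (hgen : Subgroup.closure S = ⊤) {s t : G} (h : OP S s t) (z : G) :
    (∃ j < orderOf s, z = s ^ j) ∨ (∃ j < orderOf s, z = t * s ^ j) := by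
  obtain ⟨hi, htop, -, -, htt⟩ := op_facts hgen h
  rcases two_rows hi htop z with hz | hz
  · exact .inl (exp_ex hz)
  · obtain ⟨j, hj, e⟩ := exp_ex hz
    exact .inr ⟨j, hj, by rw [← e]; simp⟩

theorem op_row {S : Set G} {s t : G} (h : OP S s t) (i j : ℕ) : s ^ i ≠ t * s ^ j := by
  intro e
  apply h.2.2.2.2
  have : t = s ^ i * (s ^ j)⁻¹ := by rw [e]; simp
  rw [this]
  exact mul_mem (pow_mem (Subgroup.mem_zpowers s) _) (inv_mem (pow_mem (Subgroup.mem_zpowers s) _))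

theorem op_ne {S : Set G} {s t : G} (h : OP S s t) : s ≠ s⁻¹ ∧ s ≠ t ∧ s⁻¹ ≠ t := by
  obtain ⟨hS, ho, h3, htt, ht⟩ := h
  refine ⟨fun e => ?_, ?_, ?_⟩
  · have : s ^ 2 = 1 := by rw [pow_two]; nth_rewrite 2 [e]; simp
    have := orderOf_le_of_pow_eq_one (by norm_num) this
    omega
  · rintro rfl; exact ht (Subgroup.mem_zpowers _)
  · rintro rfl; exact ht (inv_mem (Subgroup.mem_zpowers _))

theorem op_deg {S : Set G} (hS : Sy S) (h1 : (1 : G) ∉ S) {s t : G} (h : OP S s t) {u : G}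
    {w : (cayleyGraph S).Walk u u} (hw : w.IsHamiltonianCycle) (v : G) :
    (if s(v, v * s) ∈ w.edges then 1 else 0) + (if s(v, v * s⁻¹) ∈ w.edges then 1 else 0) + (if s(v, t * v) ∈ w.edges then 1 else 0) = (2 : ℤ) := by
  obtain ⟨n1, n2, n3⟩ := op_ne h
  apply ham_deg hw
  · simpa using n1
  · rw [mul_comm]; simpa using n2
  · rw [mul_comm]; simpa using n3
  · intro z hz
    rw [cay_adj hS h1, L, h.1] at hz
    simp only [Set.mem_insert_iff, Set.mem_singleton_iff, inv_mul_eq_iff_eq_mul] at hz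
    rwa [mul_comm t v]

theorem op_ham {S : Set G} (hS : Sy S) (h1 : (1 : G) ∉ S) (hgen : Subgroup.closure S = ⊤) {s t : G} (h : OP S s t) {u : G}
    {w : (cayleyGraph S).Walk u u} (hw : w.IsHamiltonianCycle) :
    (∀ i, (s(s ^ i, s ^ i * s) ∈ w.edges ↔ s(t * s ^ i, t * s ^ i * s) ∈ w.edges)) ∧
    ∃ i < orderOf s, ∀ j < orderOf s, s(s ^ j, s ^ j * s) ∈ w.edges ↔ j ≠ i := by
  obtain ⟨hi, htop, hs, ht, htt⟩ := op_facts hgen h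
  have hodd := h.2.1
  have h3 := h.2.2.1
  set n := orderOf s with hn
  have hinj : ∀ i < n, ∀ j < n, s ^ i = s ^ j → i = j := fun i hi j hj e => pow_injOn_Iio_orderOf hi hj e
  let A : ℕ → ℤ := fun i => if s(s ^ i, s ^ i * s) ∈ w.edges then 1 else 0
  let B : ℕ → ℤ := fun i => if s(t * s ^ i, t * s ^ i * s) ∈ w.edges then 1 else 0
  let R : ℕ → ℤ := fun i => if s(s ^ i, t * s ^ i) ∈ w.edges then 1 else 0
  have hA : ∀ i, A (i + 1) + A i + R (i + 1) = 2 := by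
    intro i
    have := op_deg hS h1 h hw (s ^ (i + 1))
    rw [show s ^ (i + 1) * s⁻¹ = s ^ i by rw [pow_succ]; simp] at this
    rw [← this]
    simp only [A, R]
    rw [Sym2.eq_swap (a := s ^ i), pow_succ]
  have hB : ∀ i, B (i + 1) + B i + R (i + 1) = 2 := by
    intro i
    have := op_deg hS h1 h hw (t * s ^ (i + 1))
    rw [show t * s ^ (i + 1) * s⁻¹ = t * s ^ i by rw [pow_succ, ← mul_assoc]; simp, ← mul_assoc, h.2.2.2.1, one_mul] at this
    rw [← this]
    simp only [B, R]
    rw [Sym2.eq_swap (a := t * s ^ i), Sym2.eq_swap (a := s ^ (i + 1)), pow_succ, ← mul_assoc t]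
  have hd : ∀ i, A i - B i = (-1) ^ i * (A 0 - B 0) := by
    intro i
    induction i with
    | zero => simp
    | succ i ih =>
      rw [pow_succ]
      linarith [hA i, hB i]
  have hper : ∀ i, s ^ (i + n) = s ^ i := by intro i; rw [pow_add, hn, pow_orderOf_eq_one, mul_one]
  have hA0 : A n = A 0 := by have := hper 0; rw [zero_add] at this; simp only [A, this]
  have hB0 : B n = B 0 := by have := hper 0; rw [zero_add] at this; simp only [B, this]
  have h00 : A 0 - B 0 = 0 := by
    have := hd n
    rw [hodd.neg_one_pow, hA0, hB0] at this
    linarith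
  have hAB : ∀ i, A i = B i := by
    intro i
    have := hd i
    rw [h00, mul_zero] at this
    linarith
  have hiff : ∀ i, (s(s ^ i, s ^ i * s) ∈ w.edges ↔ s(t * s ^ i, t * s ^ i * s) ∈ w.edges) := by
    intro i
    have := hAB i
    simp only [A, B] at this
    split_ifs at this <;> simp_all
  refine ⟨hiff, ?_⟩
  have hone : ∃ i < n, s(s ^ i, s ^ i * s) ∉ w.edges := by
    by_contra hne
    push Not at hne
    have hall : ∀ i, s(s ^ i, s ^ i * s) ∈ w.edges := by
      intro i
      rw [← pow_mod_orderOf]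
      exact hne _ (Nat.mod_lt _ (by omega))
    obtain ⟨p, q, hp, hq, hadj, he⟩ := ham_cut hw (Subgroup.zpowers s : Set G) (x := 1) (y := t) (one_mem _) h.2.2.2.2
    obtain ⟨j, hj, rfl⟩ := exp_ex hp
    rw [cay_adj hS h1, L, h.1] at hadj
    simp only [Set.mem_insert_iff, Set.mem_singleton_iff, inv_mul_eq_iff_eq_mul] at hadj
    rcases hadj with rfl | rfl | rfl
    · exact hq (mul_mem hp (Subgroup.mem_zpowers s))
    · exact hq (mul_mem hp (inv_mem (Subgroup.mem_zpowers s)))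
    · have h5 := hA (j + n - 1)
      rw [show j + n - 1 + 1 = j + n by omega] at h5
      simp only [A, R, hper, if_pos (hall _)] at h5

      rw [mul_comm t, if_pos he] at h5
      norm_num at h5
  obtain ⟨i, hi, hi0⟩ := hone
  have two : ∀ i j, i < j → j < n → s(s ^ i, s ^ i * s) ∉ w.edges → s(s ^ j, s ^ j * s) ∉ w.edges → False := by
    intro i j hij hj hi0 hj0
    have hi0' := hi0
    have hj0' := hj0
    rw [hiff] at hi0' hj0'
    have hz : ∀ τ, τ = 1 ∨ τ = t → s(τ * s ^ i, τ * s ^ i * s) ∉ w.edges ∧ s(τ * s ^ j, τ * s ^ j * s) ∉ w.edges := by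
      rintro τ (rfl | rfl)
      · simpa using ⟨hi0, hj0⟩
      · exact ⟨hi0', hj0'⟩
    obtain ⟨p, q, hp, hq, hadj, he⟩ := ham_cut hw {z | ∃ τ, (τ = 1 ∨ τ = t) ∧ ∃ k, i < k ∧ k ≤ j ∧ z = τ * s ^ k}
      (x := s ^ j) (y := s ^ i) ⟨1, .inl rfl, j, hij, le_rfl, by simp⟩ (by
        rintro ⟨τ, rfl | rfl, k, hk1, hk2, e⟩
        · rw [one_mul] at e
          have := hinj _ (by omega) _ (by omega) e
          omega
        · exact op_row h _ _ e)
    obtain ⟨τ, hτ, k, hk1, hk2, rfl⟩ := hp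
    rw [cay_adj hS h1, L, h.1] at hadj
    simp only [Set.mem_insert_iff, Set.mem_singleton_iff, inv_mul_eq_iff_eq_mul] at hadj
    rcases hadj with rfl | rfl | rfl
    · by_cases hkj : k = j
      · subst hkj; exact (hz τ hτ).2 he
      · exact hq ⟨τ, hτ, k + 1, by omega, by omega, by rw [pow_succ, mul_assoc]⟩
    · obtain ⟨k, rfl⟩ : ∃ k', k = k' + 1 := ⟨k - 1, by omega⟩
      have e : τ * s ^ (k + 1) * s⁻¹ = τ * s ^ k := by rw [pow_succ, ← mul_assoc]; simp
      rw [e] at hq he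
      by_cases hki : k = i
      · subst hki
        apply (hz τ hτ).1
        rwa [Sym2.eq_swap, mul_assoc, ← pow_succ]
      · exact hq ⟨τ, hτ, k, by omega, by omega, rfl⟩
    · refine hq ⟨τ * t, ?_, k, hk1, hk2, by rw [mul_right_comm]⟩
      rcases hτ with rfl | rfl
      · simp
      · left; exact h.2.2.2.1
  refine ⟨i, hi, fun j hj => ⟨?_, fun hne => ?_⟩⟩
  · rintro h5 rfl; exact hi0 h5
  · by_contra hj0
    rcases lt_or_gt_of_ne hne with hlt | hlt
    · exact two j i hlt hi hj0 hi0
    · exact two i j hlt hj hi0 hj0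

end grp
end HamSp


/-! Part 21 -/
set_option linter.unusedSectionVars false
set_option linter.unusedSimpArgs false
set_option linter.unusedVariables false
namespace HamSp
section grp
variable {G : Type*} [CommGroup G] [Fintype G] [DecidableEq G]

theorem op_adj {S : Set G} (hS : Sy S) (h1 : (1 : G) ∉ S) {s : G} (hs : s ∈ S) (z : G) : (cayleyGraph S).Adj z (z * s) := by
  rw [cay_adj hS h1, L]; simpa using hs

/-- number of edges in the row of `z` -/
noncomputable def trow {S : Set G} (hS : Sy S) (h1 : (1 : G) ∉ S) {s : G} (hs : s ∈ S) (z : G) :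
    ((cayleyGraph S).edgeSet → ZMod 2) →ₗ[ZMod 2] ZMod 2 :=
  ∑ i ∈ Finset.range (orderOf s), LinearMap.proj (⟨s(z * s ^ i, z * s ^ i * s), op_adj hS h1 hs _⟩ : (cayleyGraph S).edgeSet)

theorem trow_ind {S : Set G} (hS : Sy S) (h1 : (1 : G) ∉ S) {s : G} (hs : s ∈ S) (z : G) {u : G} (w : (cayleyGraph S).Walk u u) :
    trow hS h1 hs z (walkIndicator _ w) = ∑ i ∈ Finset.range (orderOf s), if s(z * s ^ i, z * s ^ i * s) ∈ w.edges then 1 else 0 := by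
  simp [trow, walkIndicator, LinearMap.sum_apply]

theorem trow_lbl {S : Set G} (hS : Sy S) (h1 : (1 : G) ∉ S) {s : G} (hs : s ∈ S) (z : G) {x y : G} (h : (cayleyGraph S).Adj x y) :
    lbl (trow hS h1 hs z) x y = ∑ i ∈ Finset.range (orderOf s), if s(z * s ^ i, z * s ^ i * s) = s(x, y) then 1 else 0 := by
  rw [lbl, dif_pos h, trow, LinearMap.sum_apply]
  refine Finset.sum_congr rfl fun i _ => ?_
  rw [LinearMap.proj_apply, Pi.single_apply]
  exact if_congr Subtype.ext_iff rfl rfl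

theorem trow_same {S : Set G} (hS : Sy S) (h1 : (1 : G) ∉ S) {s : G} (hs : s ∈ S) (h3 : 3 ≤ orderOf s) (z : G) {j : ℕ} (hj : j < orderOf s) :
    lbl (trow hS h1 hs z) (z * s ^ j) (z * s ^ j * s) = 1 := by
  rw [trow_lbl hS h1 hs z (op_adj hS h1 hs _), Finset.sum_eq_single j]
  · simp
  · intro i hi hij
    rw [if_neg]
    rw [Finset.mem_range] at hi
    rw [Sym2.eq_iff]
    rintro (⟨e, -⟩ | ⟨e1, e2⟩)
    · exact hij (pow_injOn_Iio_orderOf (x := s) hi hj (mul_left_cancel e))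
    · rw [e1] at e2
      have : s ^ 2 = 1 := by rw [pow_two]; simpa [mul_assoc] using e2
      have := orderOf_le_of_pow_eq_one (by norm_num) this
      omega
  · intro h; exact absurd (Finset.mem_range.2 hj) h

theorem trow_diff {S : Set G} (hS : Sy S) (h1 : (1 : G) ∉ S) {s : G} (hs : s ∈ S) (z : G) {x y : G} (h : (cayleyGraph S).Adj x y)
    (hne : z⁻¹ * x ∉ Subgroup.zpowers s) :
    lbl (trow hS h1 hs z) x y = 0 := by
  rw [trow_lbl hS h1 hs z h]
  apply Finset.sum_eq_zero
  intro i hi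
  rw [if_neg]
  rw [Sym2.eq_iff]
  have hm := pow_mem (Subgroup.mem_zpowers s) i
  rintro (⟨e, -⟩ | ⟨-, e⟩)
  · apply hne; rw [← e]; simpa using hm
  · apply hne; rw [← e]; simpa [mul_assoc] using mul_mem hm (Subgroup.mem_zpowers s)

/-- structure of an annihilating labelling in the prism case -/
theorem op_str {S : Set G} (hS : Sy S) (h1 : (1 : G) ∉ S) (hgen : Subgroup.closure S = ⊤) {s t : G} (h : OP S s t)
    {f : G → G → ZMod 2} (hf : Ann S f) :
    ∃ (φ : G → ZMod 2) (a b : ZMod 2),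
      (∀ j < orderOf s, f (s ^ j) (s ^ j * s) = φ (s ^ j) + φ (s ^ j * s) + a) ∧
      (∀ j < orderOf s, f (t * s ^ j) (t * s ^ j * s) = φ (t * s ^ j) + φ (t * s ^ j * s) + b) ∧
      (∀ j < orderOf s, f (s ^ j) (t * s ^ j) = φ (s ^ j) + φ (t * s ^ j)) := by
  obtain ⟨hi, htop, hs, ht, htt⟩ := op_facts hgen h
  have hodd := h.2.1
  have h3 := h.2.2.1
  set a := ∑ i ∈ Finset.range (orderOf s), f (s ^ i) (s ^ i * s) with ha
  set b := ∑ i ∈ Finset.range (orderOf s), f (t * s ^ i) (t * s ^ i * s) with hb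
  have hrs : rs s t f = a + b := by rw [rs, Finset.sum_add_distrib]
  let g : ℕ → ZMod 2 := fun j => ∑ i ∈ Finset.range j, (f (s ^ i) (s ^ i * s) + a)
  obtain ⟨φ0, h0⟩ := exp_fun s g
  have hgn : g (orderOf s) = 0 := by
    simp only [g]
    rw [Finset.sum_add_distrib, ← ha, Finset.sum_const, Finset.card_range, nsmul_eq_mul, (ZMod.natCast_eq_one_iff_odd).2 hodd, one_mul,
      CharTwo.add_self_eq_zero]
  have h0' : ∀ j ≤ orderOf s, φ0 (s ^ j) = g j := by
    intro j hj
    rcases hj.lt_or_eq with hj | rfl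
    · exact h0 j hj
    · rw [pow_orderOf_eq_one, hgn, ← pow_zero s, h0 0 (by omega)]; simp [g]
  have hK : ∀ j : ℕ, s ^ j ∈ Subgroup.zpowers s := fun j => pow_mem (Subgroup.mem_zpowers s) _
  have hK' : ∀ j : ℕ, t * s ^ j ∉ Subgroup.zpowers s := fun j hm => h.2.2.2.2 ((Subgroup.mul_mem_cancel_right _ (hK j)).1 hm)
  classical
  let φ : G → ZMod 2 := fun z => if z ∈ Subgroup.zpowers s then φ0 z else φ0 (t * z) + f (t * z) z
  have hφ0 : ∀ j ≤ orderOf s, φ (s ^ j) = g j := by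
    intro j hj; simp only [φ, if_pos (hK j)]; exact h0' j hj
  have hφ1 : ∀ j ≤ orderOf s, φ (t * s ^ j) = g j + f (s ^ j) (t * s ^ j) := by
    intro j hj; simp only [φ, if_neg (hK' j), ← mul_assoc, h.2.2.2.1, one_mul]; rw [h0' j hj]
  have hrow : ∀ j < orderOf s, f (s ^ j) (s ^ j * s) = g j + g (j + 1) + a := by
    intro j hj
    simp only [g, Finset.sum_range_succ]
    grind
  refine ⟨φ, a, b, ?_, ?_, ?_⟩
  · intro j hj
    rw [← pow_succ, hφ0 j hj.le, hφ0 (j + 1) hj, pow_succ]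
    exact hrow j hj
  · intro j hj
    have h5 := hi_all hS hs ht h.2.2.2.2 hi htop hf j
    rw [mul_assoc t, ← pow_succ, hφ1 j hj.le, hφ1 (j + 1) hj]
    have h6 := hrow j hj
    rw [hrs, h6, mul_comm _ t, mul_comm _ t, mul_assoc t, ← pow_succ] at h5
    grind
  · intro j hj
    rw [hφ0 j hj.le, hφ1 j hj.le]
    grind

theorem op_edges {S : Set G} (hS : Sy S) (h1 : (1 : G) ∉ S) (hgen : Subgroup.closure S = ⊤) {s t : G} (h : OP S s t)
    {P : G → G → Prop} (hP : ∀ x y, P x y → P y x) (h0 : ∀ j < orderOf s, P (s ^ j) (s ^ j * s))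
    (h2 : ∀ j < orderOf s, P (t * s ^ j) (t * s ^ j * s)) (h4 : ∀ j < orderOf s, P (s ^ j) (t * s ^ j)) :
    ∀ x y, (cayleyGraph S).Adj x y → P x y := by
  intro x y hxy
  rw [cay_adj hS h1, L, h.1] at hxy
  simp only [Set.mem_insert_iff, Set.mem_singleton_iff, inv_mul_eq_iff_eq_mul] at hxy
  have hss : ∀ x, P x (x * s) := by
    intro x
    rcases op_cases hgen h x with ⟨j, hj, rfl⟩ | ⟨j, hj, rfl⟩
    exacts [h0 j hj, h2 j hj]
  rcases hxy with rfl | rfl | rfl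
  · exact hss x
  · have := hss (x * s⁻¹)
    rw [inv_mul_cancel_right] at this
    exact hP _ _ this
  · rcases op_cases hgen h x with ⟨j, hj, rfl⟩ | ⟨j, hj, rfl⟩
    · rw [mul_comm]; exact h4 j hj
    · rw [mul_right_comm, h.2.2.2.1, one_mul]; exact hP _ _ (h4 j hj)

theorem wsum_zero {V : Type*} {X : SimpleGraph V} {f : V → V → ZMod 2} {u v : V} (w : X.Walk u v)
    (h : ∀ x ∈ w.support, ∀ y, X.Adj x y → f x y = 0) : wsum f w = 0 := by
  induction w with
  | nil => rfl
  | cons ha p ih =>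
    rw [wsum, h _ (by simp) _ ha, ih (fun x hx => h x (by simp [hx])), add_zero]

theorem row_cycle {S : Set G} (hS : Sy S) (h1 : (1 : G) ∉ S) {s : G} (hs : s ∈ S) (h3 : 3 ≤ orderOf s) (z : G) (f : G → G → ZMod 2) :
    ∃ (u : G) (w : (cayleyGraph S).Walk u u), w.IsCycle ∧ (∀ x ∈ w.support, z⁻¹ * x ∈ Subgroup.zpowers s) ∧
      wsum f w = ∑ i ∈ Finset.range (orderOf s), f (z * s ^ i) (z * s ^ i * s) := by
  have h := seg (S := S) (fun x y => f (z * x) (z * y)) hs (orderOf s - 1) (by omega)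
  have h := h.map (Q := L S) (f' := f) (fun x => z * x) (by intro a _ b _ h; simpa using h)
    (fun a _ b _ h => (L_mul z a b).2 h) (fun a _ b _ _ => rfl)
  have hl : z * s ^ (orderOf s - 1) * s = z * 1 := by rw [mul_assoc, pow_last]
  obtain ⟨p, w, rfl, hw, -, hU, hv⟩ := h.cycle (X := cayleyGraph S) (fun a b h => (cay_adj hS h1 a b).2 h)
    (by show (z * s ^ (orderOf s - 1))⁻¹ * (z * 1) ∈ S; rw [← hl, inv_mul_cancel_left]; exact hs) (by
      refine ⟨z * s ^ 1, ⟨s ^ 1, ⟨1, by omega, rfl⟩, rfl⟩, ?_, ?_⟩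
      · intro e
        have := pow_injOn_Iio_orderOf (x := s) (show 1 < orderOf s by omega) (show 0 < orderOf s by omega) (by simpa using mul_left_cancel e)
        omega
      · intro e
        have := pow_injOn_Iio_orderOf (x := s) (show 1 < orderOf s by omega) (show orderOf s - 1 < orderOf s by omega) (mul_left_cancel e)
        omega)
  refine ⟨_, _, hw, ?_, ?_⟩
  · intro x hx
    have hm : ∀ y, y ∈ p.support → z⁻¹ * y ∈ Subgroup.zpowers s := by
      intro y hy
      obtain ⟨_, ⟨j, -, rfl⟩, rfl⟩ := (hU y).1 hy
      simpa using pow_mem (Subgroup.mem_zpowers s) j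
    rw [Walk.support_cons, List.mem_cons] at hx
    rcases hx with rfl | hx
    · exact hm _ p.end_mem_support
    · exact hm _ hx
  · rw [hv]
    conv_rhs => rw [show orderOf s = orderOf s - 1 + 1 by omega, Finset.sum_range_succ, hl]
    congr 1
    refine Finset.sum_congr rfl fun i _ => ?_
    rw [pow_succ, mul_assoc]

theorem op_card {S : Set G} {s t : G} (h : OP S s t) : 3 ≤ Fintype.card G :=
  h.2.2.1.trans (orderOf_le_card_univ)

theorem op_main {S : Set G} (hS : Sy S) (h1 : (1 : G) ∉ S) (hgen : Subgroup.closure S = ⊤) {s t : G} (h : OP S s t) :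
    Module.finrank (ZMod 2) (cycleSpace (cayleyGraph S)) =
        Module.finrank (ZMod 2) (hamiltonSpace (cayleyGraph S)) + 2 := by
  obtain ⟨hi, htop, hs, ht, htt⟩ := op_facts hgen h
  have hodd := h.2.1
  have h3 := h.2.2.1
  have hK : ∀ j : ℕ, s ^ j ∈ Subgroup.zpowers s := fun j => pow_mem (Subgroup.mem_zpowers s) _
  have hK' : ∀ j : ℕ, t * s ^ j ∉ Subgroup.zpowers s := fun j hm => h.2.2.2.2 ((Subgroup.mul_mem_cancel_right _ (hK j)).1 hm)
  have htj : ∀ j : ℕ, (cayleyGraph S).Adj (s ^ j) (t * s ^ j) := by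
    intro j; rw [cay_adj hS h1, L, mul_comm t]; simpa using ht
  set T0 := trow hS h1 hs 1 with hT0
  set T1 := trow hS h1 hs t with hT1
  have a00 : ∀ j < orderOf s, lbl T0 (s ^ j) (s ^ j * s) = 1 := by
    intro j hj
    have := trow_same hS h1 hs h3 1 hj
    simpa using this
  have a01 : ∀ j < orderOf s, lbl T0 (t * s ^ j) (t * s ^ j * s) = 0 := by
    intro j hj
    exact trow_diff hS h1 hs 1 (op_adj hS h1 hs _) (by simpa using hK' j)
  have a02 : ∀ j < orderOf s, lbl T0 (s ^ j) (t * s ^ j) = 0 := by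
    intro j hj
    rw [lbl_symm]
    exact trow_diff hS h1 hs 1 (htj j).symm (by simpa using hK' j)
  have a10 : ∀ j < orderOf s, lbl T1 (s ^ j) (s ^ j * s) = 0 := by
    intro j hj
    exact trow_diff hS h1 hs t (op_adj hS h1 hs _) (by rw [htt]; exact hK' j)
  have a11 : ∀ j < orderOf s, lbl T1 (t * s ^ j) (t * s ^ j * s) = 1 := fun j hj => trow_same hS h1 hs h3 t hj
  have a12 : ∀ j < orderOf s, lbl T1 (s ^ j) (t * s ^ j) = 0 := by
    intro j hj
    exact trow_diff hS h1 hs t (htj j) (by rw [htt]; exact hK' j)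
  have hsum : ∀ (P : ℕ → Prop) [DecidablePred P], (∃ i < orderOf s, ∀ j < orderOf s, P j ↔ j ≠ i) →
      ∑ j ∈ Finset.range (orderOf s), (if P j then 1 else 0 : ZMod 2) = 0 := by
    rintro P _ ⟨i, hi, hj⟩
    rw [Finset.sum_congr rfl (g := fun j => 1 + if j = i then 1 else 0), Finset.sum_add_distrib, Finset.sum_const, Finset.card_range,
      Finset.sum_ite_eq', if_pos (Finset.mem_range.2 hi), nsmul_eq_mul, (ZMod.natCast_eq_one_iff_odd).2 hodd]
    · decide
    · intro j hjn
      rw [if_congr (hj j (Finset.mem_range.1 hjn)) rfl rfl]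
      by_cases hji : j = i
      · simp [hji]; decide
      · simp [hji]
  have hH : hamiltonSpace (cayleyGraph S) = cycleSpace (cayleyGraph S) ⊓ LinearMap.ker T0 ⊓ LinearMap.ker T1 := by
    refine le_antisymm (le_inf (le_inf ham_le_cyc ?_) ?_) (sep fun ψ hψ x hx => ?_)
    · rw [hamiltonSpace, Submodule.span_le]
      rintro f ⟨u, w, hw, rfl⟩
      rw [SetLike.mem_coe, LinearMap.mem_ker, hT0, trow_ind]
      obtain ⟨-, hj⟩ := op_ham hS h1 hgen h hw
      simp only [one_mul]
      exact hsum _ hj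
    · rw [hamiltonSpace, Submodule.span_le]
      rintro f ⟨u, w, hw, rfl⟩
      rw [SetLike.mem_coe, LinearMap.mem_ker, hT1, trow_ind]
      obtain ⟨hab, i, hi, hj⟩ := op_ham hS h1 hgen h hw
      exact hsum (fun j => s(t * s ^ j, t * s ^ j * s) ∈ w.edges) ⟨i, hi, fun j hjn => (hab j).symm.trans (hj j hjn)⟩
    · obtain ⟨φ, a, b, f0, f1, f2⟩ := op_str hS h1 hgen h (ann_of hS h1 (op_card h) hψ)
      have key := op_edges hS h1 hgen h (P := fun x y => lbl ψ x y = φ x + φ y + a * lbl T0 x y + b * lbl T1 x y)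
        (fun x y e => by rw [lbl_symm, e, lbl_symm T0, lbl_symm T1]; ring)
        (fun j hj => by rw [f0 j hj, a00 j hj, a10 j hj]; ring)
        (fun j hj => by rw [f1 j hj, a01 j hj, a11 j hj]; ring)
        (fun j hj => by rw [f2 j hj, a02 j hj, a12 j hj]; ring)
      have : cycleSpace (cayleyGraph S) ≤ LinearMap.ker (ψ - a • T0 - b • T1) := by
        rw [cycleSpace, Submodule.span_le]
        rintro f ⟨u, w, hw, rfl⟩
        rw [SetLike.mem_coe, LinearMap.mem_ker, LinearMap.sub_apply, LinearMap.sub_apply, LinearMap.smul_apply, LinearMap.smul_apply,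
          eval_cycle _ w hw, eval_cycle _ w hw, eval_cycle _ w hw, wsum_congr key, wsum_lin, smul_eq_mul, smul_eq_mul,
          CharTwo.add_self_eq_zero]
        ring
      have h5 := this hx.1.1
      have h6 : T0 x = 0 := hx.1.2
      have h7 : T1 x = 0 := hx.2
      rw [LinearMap.mem_ker] at h5
      simpa [h6, h7] using h5
  have hn1 : ((orderOf s : ℕ) : ZMod 2) = 1 := (ZMod.natCast_eq_one_iff_odd).2 hodd
  obtain ⟨u0, w0, hw0, -, hv0⟩ := row_cycle hS h1 hs h3 1 (lbl T0)
  obtain ⟨u1, w1, hw1, hsup, hv1⟩ := row_cycle hS h1 hs h3 t (lbl T1)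
  rw [Finset.sum_congr rfl (g := fun _ => 1), Finset.sum_const, Finset.card_range, nsmul_eq_mul, mul_one, hn1] at hv0
  swap
  · intro j hj; rw [one_mul]; exact a00 j (Finset.mem_range.1 hj)
  rw [Finset.sum_congr rfl (g := fun _ => 1), Finset.sum_const, Finset.card_range, nsmul_eq_mul, mul_one, hn1] at hv1
  swap
  · intro j hj; exact a11 j (Finset.mem_range.1 hj)
  have c0 := codim_one (cycleSpace (cayleyGraph S)) T0 (x := walkIndicator _ w0) (Submodule.subset_span ⟨_, w0, hw0, rfl⟩)
    (by rw [eval_cycle T0 w0 hw0, hv0]; decide)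
  have c1 := codim_one (cycleSpace (cayleyGraph S) ⊓ LinearMap.ker T0) T1 (x := walkIndicator _ w1)
    ⟨Submodule.subset_span ⟨_, w1, hw1, rfl⟩, by
      rw [SetLike.mem_coe, LinearMap.mem_ker, eval_cycle T0 w1 hw1]
      refine wsum_zero _ fun x hx y hxy => trow_diff hS h1 hs 1 hxy ?_
      intro hm
      rw [inv_one, one_mul] at hm
      exact h.2.2.2.2 (by simpa using mul_mem hm (inv_mem (hsup x hx)))⟩
    (by rw [eval_cycle T1 w1 hw1, hv1]; decide)
  rw [hH]
  omega

end grp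
end HamSp


/-! Part 22 -/
set_option linter.unusedSectionVars false
set_option linter.unusedSimpArgs false
set_option linter.unusedVariables false
namespace HamSp
section grp
variable {G : Type*} [CommGroup G] [Fintype G] [DecidableEq G]

theorem op_not {S : Set G} (hS : Sy S) (h1 : (1 : G) ∉ S) (hgen : Subgroup.closure S = ⊤) {s t : G} (h : OP S s t) :
    ¬ ((cayleyGraph S).Colorable 2 ∨ Odd (Fintype.card G)) := by
  obtain ⟨hi, htop, hs, ht, htt⟩ := op_facts hgen h
  rintro (hc | ho)
  · obtain ⟨u, w, hw, -, hv⟩ := row_cycle hS h1 hs h.2.2.1 1 (fun _ _ => 1)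
    rw [wsum_one, (ZMod.natCast_eq_zero_iff_even).2 ((two_colorable_iff_forall_loop_even.1 hc) u w)] at hv
    simp [(ZMod.natCast_eq_one_iff_odd).2 h.2.1] at hv
  · have h2 : orderOf t = 2 := by
      rw [orderOf_eq_prime_iff]
      refine ⟨by rw [pow_two]; exact h.2.2.2.1, ?_⟩
      rintro rfl; exact h1 ht
    have := orderOf_dvd_card (x := t)
    rw [h2] at this
    exact (Nat.not_even_iff_odd.2 ho) (even_iff_two_dvd.2 this)

theorem fin_pow {k : ℕ} {s : G} (hk : orderOf s = k + 2) (i j : Fin (k + 2)) : s ^ j.val = s ^ i.val * s ↔ j - i = 1 := by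
  have e : s ^ i.val * s = s ^ (i + 1).val := by
    have h5 : ∀ m : ℕ, s ^ (m % (k + 2)) = s ^ m := fun m => by rw [← hk, pow_mod_orderOf]
    rw [Fin.val_add, h5, Fin.val_one, pow_succ]
  rw [e]
  constructor
  · intro h
    have := pow_injOn_Iio_orderOf (x := s) (show j.val < orderOf s by omega) (show (i + 1).val < orderOf s by rw [hk]; exact (i + 1).isLt) h
    rw [Fin.ext this]; simp
  · intro h
    rw [← h]; simp

theorem op_iso {S : Set G} (hS : Sy S) (h1 : (1 : G) ∉ S) (hgen : Subgroup.closure S = ⊤) {s t : G} (h : OP S s t) :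
    ∃ n : ℕ, Odd n ∧ 3 ≤ n ∧
        Nonempty (cayleyGraph S ≃g
          SimpleGraph.boxProd (SimpleGraph.cycleGraph n) (⊤ : SimpleGraph (Fin 2))) := by
  refine ⟨orderOf s, h.2.1, h.2.2.1, ?_⟩
  obtain ⟨k, hk⟩ : ∃ k, orderOf s = k + 2 := ⟨orderOf s - 2, by have := h.2.2.1; omega⟩
  have hc := op_cases hgen h
  have hr := op_row h
  rw [hk] at hc ⊢
  have hinj : ∀ i j : Fin (k + 2), s ^ i.val = s ^ j.val → i = j := fun i j e =>
    Fin.ext (pow_injOn_Iio_orderOf (x := s) (show i.val < orderOf s by omega) (show j.val < orderOf s by omega) e)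
  let F : Fin (k + 2) × Fin 2 → G := fun x => t ^ x.2.val * s ^ x.1.val
  have hF : Function.Bijective F := by
    constructor
    · rintro ⟨i, b⟩ ⟨j, c⟩ e
      fin_cases b <;> fin_cases c <;> simp [F] at e ⊢
      · exact hinj _ _ e
      · exact hr _ _ e
      · exact hr _ _ e.symm
      · exact hinj _ _ e
    · intro z
      rcases hc z with ⟨j, hj, rfl⟩ | ⟨j, hj, rfl⟩
      · exact ⟨(⟨j, hj⟩, 0), by simp [F]⟩
      · exact ⟨(⟨j, hj⟩, 1), by simp [F]⟩
  refine ⟨(RelIso.symm ⟨Equiv.ofBijective F hF, ?_⟩)⟩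
  rintro ⟨i, b⟩ ⟨j, c⟩
  have htt := h.2.2.2.1
  have hinv : t⁻¹ = t := inv_eq_of_mul_eq_one_left htt
  have e1 : ∀ i j : ℕ, s ^ j = s ^ i * s⁻¹ ↔ s ^ i = s ^ j * s := fun i j => by rw [eq_mul_inv_iff_mul_eq, eq_comm]
  have r1 : ∀ i j : ℕ, s ^ j ≠ s ^ i * t := fun i j => by rw [mul_comm]; exact hr j i
  have r2 : ∀ i j : ℕ, t * s ^ j ≠ s ^ i * s := fun i j e => hr (i + 1) j (by rw [pow_succ, e])
  have r3 : ∀ i j : ℕ, t * s ^ j ≠ s ^ i * s⁻¹ := fun i j e => hr i (j + 1) (by rw [pow_succ, ← mul_assoc, e]; simp)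
  have c1 : ∀ i j : ℕ, s ^ j = t * s ^ i * s ↔ t * s ^ j = s ^ i * s := fun i j => by
    rw [mul_assoc, ← inv_mul_eq_iff_eq_mul, hinv]
  have c2 : ∀ i j : ℕ, s ^ j = t * s ^ i * s⁻¹ ↔ t * s ^ j = s ^ i * s⁻¹ := fun i j => by
    rw [mul_assoc, ← inv_mul_eq_iff_eq_mul, hinv]
  have c3 : ∀ i j : ℕ, s ^ j = t * s ^ i * t ↔ s ^ j = s ^ i := fun i j => by
    rw [mul_right_comm, htt, one_mul]
  have c4 : ∀ i j : ℕ, t * s ^ j = s ^ i * t ↔ s ^ j = s ^ i := fun i j => by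
    rw [mul_comm (s ^ i), mul_right_inj]
  have c5 : ∀ i j : Fin (k + 2), s ^ j.val = s ^ i.val ↔ i = j := fun i j => ⟨fun e => (hinj _ _ e).symm, fun e => by rw [e]⟩
  rw [Equiv.ofBijective_apply, Equiv.ofBijective_apply, cay_adj hS h1, L, h.1, boxProd_adj, cycleGraph_adj]
  simp only [Set.mem_insert_iff, Set.mem_singleton_iff, inv_mul_eq_iff_eq_mul, F]
  fin_cases b <;> fin_cases c
  · simp [e1, r1, fin_pow hk, or_comm]
  · simp [r2, r3, c4, c5]
  · simp [c1, c2, c3, r2, r3, c5]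
  · have e2 : ∀ i j : ℕ, t * s ^ j ≠ t * s ^ i * t := fun i j e => r1 i j (by rw [mul_assoc] at e; exact mul_left_cancel e)
    simp [e2, r1, mul_assoc t, e1, fin_pow hk, or_comm]

theorem uniq_inv {n : ℕ} (hn : Odd n) (hcard : Fintype.card G = 2 * n) {a t : G} (ha : a * a = 1) (ht : t * t = 1) (ha1 : a ≠ 1) (ht1 : t ≠ 1) : a = t := by
  have h2 : orderOf t = 2 := by
    rw [orderOf_eq_prime_iff]; exact ⟨by rw [pow_two]; exact ht, ht1⟩
  have hq : Nat.card (G ⧸ Subgroup.zpowers t) = n := by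
    have := Subgroup.card_eq_card_quotient_mul_card_subgroup (Subgroup.zpowers t)
    rw [Nat.card_zpowers, h2, Nat.card_eq_fintype_card, hcard] at this
    omega
  have e1 : (a : G ⧸ Subgroup.zpowers t) ^ 2 = 1 := by
    rw [← QuotientGroup.mk_pow, pow_two, ha]; rfl
  have e2 : (a : G ⧸ Subgroup.zpowers t) ^ n = 1 := by rw [← hq]; exact pow_card_eq_one'
  obtain ⟨k, rfl⟩ := hn
  rw [pow_succ, pow_mul, e1, one_pow, one_mul, QuotientGroup.eq_one_iff] at e2
  obtain ⟨j, hj, e⟩ := exp_ex e2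
  rw [h2] at hj
  interval_cases j
  · exact absurd (by simpa using e) ha1
  · simpa using e

theorem iso_op {S : Set G} (hS : Sy S) (h1 : (1 : G) ∉ S) {n : ℕ} (hodd : Odd n) (h3 : 3 ≤ n)
    (e : cayleyGraph S ≃g SimpleGraph.boxProd (SimpleGraph.cycleGraph n) (⊤ : SimpleGraph (Fin 2))) : ∃ s t, OP S s t := by
  have hcard : Fintype.card G = 2 * n := by
    rw [Fintype.card_congr e.toEquiv]; simp [mul_comm]
  have hcol : ¬ (cayleyGraph S).Colorable 2 := by
    intro hc
    have h5 : (cycleGraph n).Colorable 2 :=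
      (hc.of_hom e.symm.toHom).of_hom (boxProdLeft (cycleGraph n) (⊤ : SimpleGraph (Fin 2)) 0).toHom
    have := h5.chromaticNumber_le
    rw [chromaticNumber_cycleGraph_of_odd n (by omega) hodd] at this
    norm_num at this
  have hnc : S.ncard = 3 := by
    have hN : (cayleyGraph S).neighborSet 1 = S := by
      ext z; rw [mem_neighborSet, cay_adj hS h1, L]; simp
    have h5 := Nat.card_congr (e.mapNeighborSet 1)
    rw [hN] at h5
    obtain ⟨m, rfl⟩ : ∃ m, n = m + 3 := ⟨n - 3, by omega⟩
    rw [← Nat.card_coe_set_eq, h5]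
    classical
    rw [Nat.card_eq_fintype_card, card_neighborSet_eq_degree, degree_boxProd, cycleGraph_degree_three_le]
    simp
  have hS1 : ∀ a ∈ S, a ≠ 1 := by rintro a ha rfl; exact h1 ha
  have fin : ∀ s t, S = {s, s⁻¹, t} → s ≠ s⁻¹ → t * t = 1 → ∃ s t, OP S s t := by
    intro s t hst hne htt
    have hs : s ∈ S := by simp [hst]
    have ht : t ∈ S := by simp [hst]
    have h2 : orderOf t = 2 := by
      rw [orderOf_eq_prime_iff]; exact ⟨by rw [pow_two]; exact htt, hS1 t ht⟩
    by_cases ho : Odd (orderOf s)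
    · refine ⟨s, t, hst, ho, ?_, htt, ?_⟩
      · have : orderOf s ≠ 1 := by rw [Ne, orderOf_eq_one_iff]; exact hS1 s hs
        obtain ⟨k, hk⟩ := ho
        omega
      · intro hm
        have := orderOf_dvd_of_mem_zpowers hm
        rw [h2] at this
        exact (Nat.not_even_iff_odd.2 ho) (even_iff_two_dvd.2 this)
    · exfalso
      apply hcol
      have hn2 : ∀ z : G, z ^ n * z ^ n = 1 := by
        intro z; rw [← pow_two, ← pow_mul, mul_comm, ← hcard, pow_card_eq_one]
      have hsn1 : s ^ n ≠ 1 := fun h => ho (hodd.of_dvd_nat (orderOf_dvd_of_pow_eq_one h))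
      have hsn : s ^ n = t := uniq_inv hodd hcard (hn2 s) htt hsn1 (hS1 t ht)
      have htn : t ^ n = t := by
        obtain ⟨k, rfl⟩ := hodd
        rw [pow_succ, pow_mul, pow_two, htt, one_pow, one_mul]
      have hinv : t⁻¹ = t := inv_eq_of_mul_eq_one_left htt
      have hall : ∀ a ∈ S, a ^ n = t := by
        intro a ha
        rw [hst] at ha
        rcases ha with rfl | rfl | rfl
        · exact hsn
        · rw [inv_pow, hsn, hinv]
        · exact htn
      have hC : ∀ {x y : G}, (cayleyGraph S).Adj x y → decide (x ^ n = 1) ≠ decide (y ^ n = 1) := by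
        intro x y hxy
        rw [cay_adj hS h1, L] at hxy
        have h6 := hall _ hxy
        rw [mul_pow, inv_pow, inv_mul_eq_iff_eq_mul] at h6
        rw [h6]
        by_cases hx : x ^ n = 1
        · simp [hx, hS1 t ht]
        · rw [uniq_inv hodd hcard (hn2 x) htt hx (hS1 t ht), htt]
          simp [hS1 t ht]
      exact (Coloring.mk (fun z : G => decide (z ^ n = 1)) hC).colorable
  obtain ⟨a, b, c, hab, hac, hbc, rfl⟩ := Set.ncard_eq_three.1 hnc
  have ha := hS a (by simp)
  have hb := hS b (by simp)
  have hc := hS c (by simp)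
  have mi : ∀ x : G, x⁻¹ = x → x * x = 1 := fun x hx => by nth_rewrite 1 [← hx]; simp
  have two : ∀ x y : G, x ∈ ({a, b, c} : Set G) → y ∈ ({a, b, c} : Set G) → x⁻¹ = x → y⁻¹ = y → x = y := fun x y hx hy h5 h6 =>
    uniq_inv hodd hcard (mi x h5) (mi y h6) (hS1 x hx) (hS1 y hy)
  simp only [Set.mem_insert_iff, Set.mem_singleton_iff] at ha hb hc
  rcases ha with ha | ha | ha
  · rcases hb with hb | hb | hb
    · exact absurd (by rw [← inv_inv b, hb, ha]) hab.symm
    · exact absurd (two a b (by simp) (by simp) ha hb) hab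
    · refine fin b a ?_ ?_ (mi a ha)
      · rw [hb]; ext z; simp; tauto
      · rw [hb]; exact hbc
  · rcases hc with hc | hc | hc
    · exact absurd (by rw [← inv_inv c, hc, ha]) hbc.symm
    · exact absurd (inv_injective (by rw [hc, ha] : c⁻¹ = a⁻¹)) hac.symm
    · refine fin a c ?_ ?_ (mi c hc)
      · rw [ha]
      · rw [ha]; exact hab
  · rcases hb with hb | hb | hb
    · exact absurd (by rw [← inv_inv b, hb, ha]) hbc
    · refine fin a b ?_ ?_ (mi b hb)
      · rw [ha]; ext z; simp; tauto
      · rw [ha]; exact hac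
    · exact absurd (inv_injective (by rw [hb, ha] : b⁻¹ = a⁻¹)) hab.symm

theorem final {S : Set G} (hsymm : S⁻¹ = S) (h1 : (1 : G) ∉ S)
    (hconn : (cayleyGraph S).Connected) :
    (((cayleyGraph S).Colorable 2 ∨ Odd (Fintype.card G)) →
      hamiltonSpace (cayleyGraph S) = cycleSpace (cayleyGraph S)) ∧
    ((∃ n : ℕ, Odd n ∧ 3 ≤ n ∧
        Nonempty (cayleyGraph S ≃g
          SimpleGraph.boxProd (SimpleGraph.cycleGraph n) (⊤ : SimpleGraph (Fin 2)))) →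
      Module.finrank (ZMod 2) (cycleSpace (cayleyGraph S)) =
        Module.finrank (ZMod 2) (hamiltonSpace (cayleyGraph S)) + 2) ∧
    ((¬ ((cayleyGraph S).Colorable 2 ∨ Odd (Fintype.card G)) ∧
      ¬ (∃ n : ℕ, Odd n ∧ 3 ≤ n ∧
        Nonempty (cayleyGraph S ≃g
          SimpleGraph.boxProd (SimpleGraph.cycleGraph n) (⊤ : SimpleGraph (Fin 2))))) →
      Module.finrank (ZMod 2) (cycleSpace (cayleyGraph S)) =
        Module.finrank (ZMod 2) (hamiltonSpace (cayleyGraph S)) + 1) := by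
  have hS : Sy S := fun a ha => by rw [← hsymm]; simpa using ha
  have hgen := gen_of_conn hS h1 hconn
  refine ⟨fun h => main_eq hS h1 hgen (fun s t hop => op_not hS h1 hgen hop h) h, ?_, ?_⟩
  · rintro ⟨n, hodd, h3, ⟨e⟩⟩
    obtain ⟨s, t, h⟩ := iso_op hS h1 hodd h3 e
    exact op_main hS h1 hgen h
  · rintro ⟨h, hni⟩
    exact main_one hS h1 hgen (fun s t hop => hni (op_iso hS h1 hgen hop)) h

end grp
end HamSp


/-- Alspach–Locke–Witte: Let `X` be a connected Cayley graph on a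
finite abelian group, `𝒞` its cycle space and `ℋ` its Hamilton space.  Then
(i) `ℋ = 𝒞` if `X` is bipartite or of odd order; (ii) `ℋ` has codimension `2` in
`𝒞` if `X` is a prism over an odd cycle; (iii) otherwise `ℋ` has codimension `1`
in `𝒞`. -/
theorem stmt12 {G : Type*} [CommGroup G] [Fintype G] [DecidableEq G]
    (S : Set G) (hsymm : S⁻¹ = S) (h1 : (1 : G) ∉ S)
    (hconn : (cayleyGraph S).Connected) :
    (((cayleyGraph S).Colorable 2 ∨ Odd (Fintype.card G)) →
      hamiltonSpace (cayleyGraph S) = cycleSpace (cayleyGraph S)) ∧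
    ((∃ n : ℕ, Odd n ∧ 3 ≤ n ∧
        Nonempty (cayleyGraph S ≃g
          SimpleGraph.boxProd (SimpleGraph.cycleGraph n) (⊤ : SimpleGraph (Fin 2)))) →
      Module.finrank (ZMod 2) (cycleSpace (cayleyGraph S)) =
        Module.finrank (ZMod 2) (hamiltonSpace (cayleyGraph S)) + 2) ∧
    ((¬ ((cayleyGraph S).Colorable 2 ∨ Odd (Fintype.card G)) ∧
      ¬ (∃ n : ℕ, Odd n ∧ 3 ≤ n ∧
        Nonempty (cayleyGraph S ≃g
          SimpleGraph.boxProd (SimpleGraph.cycleGraph n) (⊤ : SimpleGraph (Fin 2))))) →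
      Module.finrank (ZMod 2) (cycleSpace (cayleyGraph S)) =
        Module.finrank (ZMod 2) (hamiltonSpace (cayleyGraph S)) + 1) := by
  exact HamSp.final hsymm h1 hconn
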